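/- arXiv:2310.03709 — 3 statements merged into one kernel-verified Lean document; each statement's English description precedes it below -/
import Mathlib

section
/- Let K be a quadratic number field, E an elliptic curve over K, and L a quadratic extension of K. If E(K)_tor is isomorphic to C_4, then E(L)_tor is not isomorphic to C_2 ⊕ C_24. -/
open WeierstrassCurve WeierstrassCurve.Affine

/-- The `n`-torsion subgroup `G[n]` of an additive commutative group `G`. -/
def nTorsion (G : Type*) [AddCommGroup G] (n : ℕ) : AddSubgroup G where
  carrier := {x | n • x = 0}
  zero_mem' := by simp
  add_mem' := by
    intro a b ha hb
    simp only [Set.mem_setOf_eq, smul_add] at *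
    rw [ha, hb, add_zero]
  neg_mem' := by
    intro a ha
    simp only [Set.mem_setOf_eq, smul_neg] at *
    rw [ha, neg_zero]

/-- The `p`-primary torsion subgroup `G[p^∞]` of an additive commutative group `G`. -/
def pPrimary (G : Type*) [AddCommGroup G] (p : ℕ) : AddSubgroup G where
  carrier := {x | ∃ k : ℕ, p ^ k • x = 0}
  zero_mem' := ⟨0, by simp⟩
  add_mem' := by
    rintro a b ⟨m, hm⟩ ⟨n, hn⟩
    refine ⟨m + n, ?_⟩
    have h1 : (p ^ (m + n)) • a = 0 := by rw [pow_add, mul_comm, mul_smul, hm, smul_zero]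
    have h2 : (p ^ (m + n)) • b = 0 := by rw [pow_add, mul_smul, hn, smul_zero]
    rw [smul_add, h1, h2, add_zero]
  neg_mem' := by
    rintro a ⟨m, hm⟩
    exact ⟨m, by rw [smul_neg, hm, neg_zero]⟩

/-- The Weierstrass curve over `K` with short Weierstrass equation `y² = x³ + Ax + B`. -/
def shortW {K : Type*} [CommRing K] (A B : K) : WeierstrassCurve K :=
  ⟨0, 0, 0, A, B⟩


lemma three_not_dvd_sq_add_sq {x w : ℤ} (h : IsCoprime x w) : IsCoprime (x ^ 2 + w ^ 2) 3 := by
  have hp : Prime (3 : ℤ) := Int.prime_three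
  refine (hp.coprime_iff_not_dvd.mpr ?_).symm
  intro hd
  have key : (3 : ℤ) ∣ x ∧ (3 : ℤ) ∣ w := by
    have h1 : (x % 3 = 0 ∨ x % 3 = 1 ∨ x % 3 = 2) := by omega
    have h2 : (w % 3 = 0 ∨ w % 3 = 1 ∨ w % 3 = 2) := by omega
    have h3 : (x ^ 2 + w ^ 2) % 3 = 0 := Int.emod_eq_zero_of_dvd hd
    rcases h1 with h1 | h1 | h1 <;> rcases h2 with h2 | h2 | h2 <;>
      simp [pow_two, Int.add_emod, Int.mul_emod, h1, h2] at h3 <;> omega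
  obtain ⟨a, b, hab⟩ := h
  obtain ⟨⟨c, hc⟩, ⟨d, hd⟩⟩ := key
  have : (3 : ℤ) ∣ 1 := ⟨a * c + b * d, by rw [← hab, hc, hd]; ring⟩
  norm_num at this

lemma coprime_step {x w : ℤ} (h : IsCoprime x w) :
    IsCoprime (x ^ 2 + w ^ 2) (4 * x ^ 2 + w ^ 2) := by
  have h1 : IsCoprime (x ^ 2 + w ^ 2) (x ^ 2) := by
    have := (h.pow (m := 2) (n := 2)).symm
    have h2 := this.add_mul_right_left 1
    rwa [one_mul, add_comm] at h2
  have h2 := ((three_not_dvd_sq_add_sq h).mul_right h1)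
  have h3 := h2.add_mul_right_right 1
  have e : 4 * x ^ 2 + w ^ 2 = 3 * x ^ 2 + 1 * (x ^ 2 + w ^ 2) := by ring
  rw [e]; exact h3

lemma split_step {x y z w : ℤ} (hxw : IsCoprime x w) (hyz : IsCoprime y z)
    (h : y ^ 2 * (x ^ 2 + w ^ 2) = z ^ 2 * (4 * x ^ 2 + w ^ 2)) (hz : z ≠ 0) :
    x ^ 2 + w ^ 2 = z ^ 2 ∧ 4 * x ^ 2 + w ^ 2 = y ^ 2 := by
  have hyz2 : IsCoprime (y ^ 2) (z ^ 2) := hyz.pow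
  have hc := coprime_step hxw
  have h1 : z ^ 2 ∣ x ^ 2 + w ^ 2 := hyz2.symm.dvd_of_dvd_mul_left ⟨_, h⟩
  have h2 : x ^ 2 + w ^ 2 ∣ z ^ 2 := hc.dvd_of_dvd_mul_right ⟨y ^ 2, by rw [← h]; ring⟩
  have h3 : x ^ 2 + w ^ 2 = z ^ 2 := Int.dvd_antisymm (by positivity) (by positivity) h2 h1
  refine ⟨h3, ?_⟩
  have hz2 : z ^ 2 ≠ 0 := pow_ne_zero _ hz
  apply mul_left_cancel₀ hz2
  rw [← h, h3]; ring

lemma four_numbers {m n u v : ℤ} (hm : m ≠ 0) (h : u * v = m * n) :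
    ∃ x y z w : ℤ, m = x * y ∧ n = z * w ∧ u = x * z ∧ v = y * w := by
  obtain ⟨x, y, ⟨z, hz⟩, ⟨w, hw⟩, hxy⟩ := exists_dvd_and_dvd_of_dvd_mul (Dvd.intro n h.symm)
  refine ⟨x, y, z, w, hxy, ?_, hz, hw⟩
  apply mul_left_cancel₀ hm
  rw [← h, hz, hw, hxy]; ring

lemma descent (N : ℕ) : ∀ b s a c : ℤ, 0 < b → 0 < s → b ^ 2 + s ^ 2 = a ^ 2 →
    b ^ 2 + 4 * s ^ 2 = c ^ 2 → b * s = N → False := by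
  induction N using Nat.strong_induction_on with
  | _ N ih =>
  intro b s a c hb hs ha hc hN
  have ih' : ∀ b' s' a' c' : ℤ, b' ≠ 0 → s' ≠ 0 → b' ^ 2 + s' ^ 2 = a' ^ 2 →
      b' ^ 2 + 4 * s' ^ 2 = c' ^ 2 → |b'| * |s'| < b * s → False := by
    intro b' s' a' c' hb' hs' ha' hc' hlt
    have e : ((|b'| * |s'|).toNat : ℤ) = |b'| * |s'| := Int.toNat_of_nonneg (by positivity)
    refine ih (|b'| * |s'|).toNat ?_ |b'| |s'| a' c' (abs_pos.mpr hb') (abs_pos.mpr hs')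
      (by simpa using ha') (by simpa using hc') e.symm
    omega
  by_cases hg : Int.gcd b s = 1
  swap
  · -- divide by the gcd
    obtain ⟨g, hgdef⟩ : ∃ g : ℤ, g = (Int.gcd b s : ℤ) := ⟨_, rfl⟩
    have hgpos : 0 < g := by
      rw [hgdef]; exact_mod_cast Int.gcd_pos_of_ne_zero_left _ hb.ne'
    have hg1 : 1 < g := by
      have : g ≠ 1 := by rw [hgdef]; exact_mod_cast hg
      omega
    obtain ⟨b', hb'⟩ : g ∣ b := hgdef ▸ Int.gcd_dvd_left ..
    obtain ⟨s', hs'⟩ : g ∣ s := hgdef ▸ Int.gcd_dvd_right ..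
    obtain ⟨a', ha'⟩ : g ∣ a := (Int.pow_dvd_pow_iff two_ne_zero).mp
      ⟨b' ^ 2 + s' ^ 2, by rw [← ha, hb', hs']; ring⟩
    obtain ⟨c', hc'⟩ : g ∣ c := (Int.pow_dvd_pow_iff two_ne_zero).mp
      ⟨b' ^ 2 + 4 * s' ^ 2, by rw [← hc, hb', hs']; ring⟩
    have hb'0 : 0 < b' := by rw [hb'] at hb; exact pos_of_mul_pos_right hb hgpos.le
    have hs'0 : 0 < s' := by rw [hs'] at hs; exact pos_of_mul_pos_right hs hgpos.le
    have hg2 : g ^ 2 ≠ 0 := by positivity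
    refine ih' b' s' a' c' hb'0.ne' hs'0.ne' ?_ ?_ ?_
    · apply mul_left_cancel₀ hg2
      rw [hb', hs', ha'] at ha; linear_combination ha
    · apply mul_left_cancel₀ hg2
      rw [hb', hs', hc'] at hc; linear_combination hc
    · rw [abs_of_pos hb'0, abs_of_pos hs'0, hb', hs']
      have : 0 < b' * s' := by positivity
      have h3 : 1 < g * g := by nlinarith
      nlinarith
  rcases Int.even_or_odd b with hbe | hbo
  · obtain ⟨b', hb'⟩ := hbe
    have hb2 : b = 2 * b' := by omega
    obtain ⟨c', hc'⟩ : (2 : ℤ) ∣ c := (Int.pow_dvd_pow_iff two_ne_zero).mp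
      ⟨b' ^ 2 + s ^ 2, by rw [← hc, hb2]; ring⟩
    have hb'0 : 0 < b' := by omega
    refine ih' s b' c' a hs.ne' hb'0.ne' ?_ ?_ ?_
    · rw [hb2, hc'] at hc; linarith
    · rw [← ha, hb2]; ring
    · rw [abs_of_pos hs, abs_of_pos hb'0, hb2]
      have : 0 < b' * s := by positivity
      nlinarith
  · have hb1 : b % 2 = 1 := Int.odd_iff.mp hbo
    have ha0 : a ≠ 0 := by rintro rfl; nlinarith
    have hc0 : c ≠ 0 := by rintro rfl; nlinarith
    have hcop : IsCoprime b s := Int.isCoprime_iff_gcd_eq_one.mpr hg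
    have hcop2 : IsCoprime b (2 * s) := by
      refine IsCoprime.mul_right ?_ hcop
      obtain ⟨k, hk⟩ := hbo
      exact ⟨1, -k, by rw [hk]; ring⟩
    obtain ⟨m, n, h1, h2, -, h4, -, -⟩ := PythagoreanTriple.coprime_classification'
      (x := b) (y := s) (z := |a|) (by
        unfold PythagoreanTriple; rw [abs_mul_abs_self]; linarith) hg hb1 (abs_pos.mpr ha0)
    obtain ⟨u, v, k1, k2, -, k4, k5, -⟩ := PythagoreanTriple.coprime_classification'
      (x := b) (y := 2 * s) (z := |c|) (by
        unfold PythagoreanTriple; rw [abs_mul_abs_self]; linarith)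
        (Int.isCoprime_iff_gcd_eq_one.mp hcop2) hb1 (abs_pos.mpr hc0)
    have hm : m ≠ 0 := by rintro rfl; simp at h2; omega
    have hn : n ≠ 0 := by rintro rfl; simp at h2; omega
    have hmn : IsCoprime m n := Int.isCoprime_iff_gcd_eq_one.mpr h4
    have huv : IsCoprime u v := Int.isCoprime_iff_gcd_eq_one.mpr k4
    have hs2 : s = u * v := by linarith
    have bound : ∀ x y z w : ℤ, s = 2 * (x * y * (z * w)) → x ≠ 0 → y ≠ 0 → z ≠ 0 → w ≠ 0 →
        |x| * |w| < b * s := by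
      intro x y z w e hx hy hz hw
      have : s = 2 * (|x| * |y| * (|z| * |w|)) := by
        rw [← abs_of_pos hs, e]; simp [abs_mul]
      have hx' := Int.one_le_abs hx
      have hy' := Int.one_le_abs hy
      have hz' := Int.one_le_abs hz
      have hw' := Int.one_le_abs hw
      have h3 : 1 ≤ |y| * |z| := by nlinarith
      have h4 : 1 ≤ |x| * |w| := by nlinarith
      have h5 : s = 2 * ((|x| * |w|) * (|y| * |z|)) := by rw [this]; ring
      nlinarith
    rcases k5 with ⟨hu, -⟩ | ⟨-, hv⟩
    · obtain ⟨u1, hu1⟩ : ∃ u1, u = 2 * u1 := ⟨u / 2, by omega⟩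
      obtain ⟨x, y, z, w, rfl, rfl, rfl, rfl⟩ := four_numbers (u := u1) (v := v) (n := n) hm
        (by rw [hu1] at hs2; linarith)
      have hx : x ≠ 0 := left_ne_zero_of_mul hm
      have hy : y ≠ 0 := right_ne_zero_of_mul hm
      have hz : z ≠ 0 := left_ne_zero_of_mul hn
      have hw : w ≠ 0 := right_ne_zero_of_mul hn
      have hyz : IsCoprime y z := (hmn.of_mul_left_right).of_mul_right_left
      rw [hu1] at huv k1
      have hxw : IsCoprime x w :=
        ((huv.of_mul_left_right).of_mul_left_left).of_mul_right_right
      obtain ⟨e1, e2⟩ := split_step hxw hyz (by linarith) hz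
      refine ih' w x z y hw hx (by linarith) (by linarith) ?_
      rw [mul_comm]
      exact bound x y z w (by rw [h2]; ring) hx hy hz hw
    · obtain ⟨v1, hv1⟩ : ∃ v1, v = 2 * v1 := ⟨v / 2, by omega⟩
      obtain ⟨x, y, z, w, rfl, rfl, rfl, rfl⟩ := four_numbers (u := u) (v := v1) (n := n) hm
        (by rw [hv1] at hs2; linarith)
      have hx : x ≠ 0 := left_ne_zero_of_mul hm
      have hy : y ≠ 0 := right_ne_zero_of_mul hm
      have hz : z ≠ 0 := left_ne_zero_of_mul hn
      have hw : w ≠ 0 := right_ne_zero_of_mul hn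
      have hyz : IsCoprime y z := (hmn.of_mul_left_right).of_mul_right_left
      rw [hv1] at huv k1
      have hxw : IsCoprime x w :=
        ((huv.of_mul_left_left).of_mul_right_right).of_mul_right_right
      obtain ⟨e1, e2⟩ := split_step (x := w) (w := x) (y := z) (z := y) hxw.symm hyz.symm
        (by linarith) hy
      refine ih' x w y z hx hw (by linarith) (by linarith) ?_
      exact bound x y z w (by rw [h2]; ring) hx hy hz hw

lemma rat_descent {V U W : ℚ} (h1 : V ^ 2 + 1 = U ^ 2) (h2 : V ^ 2 + 4 = W ^ 2) : V = 0 := by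
  by_contra hV
  have hd : (V.den : ℚ) ≠ 0 := by exact_mod_cast V.den_ne_zero
  have hVn : V * V.den = V.num := Rat.mul_den_eq_num V
  have sq : ∀ (R : ℚ) (k : ℤ), (k : ℚ) = R ^ 2 → ∃ a : ℤ, k = a ^ 2 := by
    intro R k hk
    have : IsSquare (k : ℚ) := ⟨R, by rw [hk]; ring⟩
    obtain ⟨a, ha⟩ := Rat.isSquare_intCast_iff.mp this
    exact ⟨a, by rw [ha]; ring⟩
  obtain ⟨a, ha⟩ := sq (U * V.den) (V.num ^ 2 + (V.den : ℤ) ^ 2) (by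
    push_cast; rw [← hVn]; linear_combination (V.den : ℚ) ^ 2 * h1)
  obtain ⟨c, hc⟩ := sq (W * V.den) (V.num ^ 2 + 4 * (V.den : ℤ) ^ 2) (by
    push_cast; rw [← hVn]; linear_combination (V.den : ℚ) ^ 2 * h2)
  have hn : V.num ≠ 0 := Rat.num_ne_zero.mpr hV
  have hp : (0 : ℤ) < V.den := by exact_mod_cast V.den_pos
  exact descent (|V.num| * V.den).toNat |V.num| V.den a c (abs_pos.mpr hn) hp
    (by simpa using ha) (by simpa using hc) (Int.toNat_of_nonneg (by positivity)).symm

lemma curve24 {X y : ℚ} (h : X * (X - 1) * (X + 3) = y ^ 2) :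
    X = 0 ∨ X = 1 ∨ X = -3 ∨ X = 3 ∨ X = -1 := by
  by_cases hy : y = 0
  · rw [hy] at h
    have h' : X * (X - 1) * (X + 3) = 0 := by rw [h]; ring
    rcases mul_eq_zero.mp h' with h' | h'
    · rcases mul_eq_zero.mp h' with h' | h'
      · left; exact h'
      · right; left; linarith
    · right; right; left; linarith
  · have := rat_descent (V := (X ^ 2 - 2 * X - 3) / (2 * y)) (U := (X ^ 2 + 3) / (2 * y))
      (W := (X ^ 2 + 6 * X - 3) / (2 * y))
      (by field_simp; linear_combination -4 * h) (by field_simp; linear_combination -16 * h)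
    have h2 : X ^ 2 - 2 * X - 3 = 0 := by
      rcases div_eq_zero_iff.mp this with h2 | h2
      · exact h2
      · exact absurd h2 (by simpa using hy)
    have h3 : (X - 3) * (X + 1) = 0 := by linear_combination h2
    rcases mul_eq_zero.mp h3 with h3 | h3
    · right; right; right; left; linarith
    · right; right; right; right; linarith

lemma rat_sq_ne_three (x : ℚ) (h : x ^ 2 = 3) : False := by
  have : IsSquare ((3 : ℤ) : ℚ) := ⟨x, by push_cast; rw [← h]; ring⟩
  obtain ⟨a, ha⟩ := Rat.isSquare_intCast_iff.mp this
  have h1 : a < 2 := by nlinarith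
  have h2 : -2 < a := by nlinarith
  interval_cases a <;> omega

lemma ratA {u N : ℚ} (h0 : u ≠ 0) (h1 : u ≠ 1) (h2 : u ≠ -1) (h3 : u ≠ 3) (h4 : u ≠ -3)
    (h : (u - 1) ^ 3 * (u + 3) * N ^ 2 = (u + 1) ^ 3 * (u - 3)) : False := by
  have e1 : u - 1 ≠ 0 := sub_ne_zero.mpr h1
  have e2 : u + 1 ≠ 0 := fun h => h2 (by linarith)
  have e3 : u - 3 ≠ 0 := sub_ne_zero.mpr h3
  have e4 : u + 3 ≠ 0 := fun h => h4 (by linarith)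
  have key := curve24 (X := (3 * u + 3) / (u - 3))
    (y := 6 * (u + 3) * (u - 1) ^ 2 * N / ((u + 1) * (u - 3) ^ 2)) (by
      have a1 : (3 * u + 3) / (u - 3) - 1 = (2 * u + 6) / (u - 3) := by field_simp; ring
      have a2 : (3 * u + 3) / (u - 3) + 3 = (6 * u - 6) / (u - 3) := by field_simp; ring
      rw [a1, a2, div_mul_div_comm, div_mul_div_comm, div_pow,
        div_eq_div_iff (by positivity) (by positivity)]
      linear_combination (-36 * (u + 3) * (u - 1) * (u - 3) ^ 3) * h)
  rcases key with k | k | k | k | k <;> field_simp at k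
  · exact e2 (by linarith)
  · exact e4 (by linarith)
  · exact e1 (by linarith)
  · linarith
  · exact h0 (by linarith)

lemma ratB {b N : ℚ} (hb : b ≠ 0)
    (h : 4 * b ^ 3 * (b ^ 2 + b + 1) * N ^ 2 = (b ^ 2 + 1) ^ 3 * (b ^ 2 + 4 * b + 1)) :
    b = 1 ∨ b = -1 := by
  have e1 : b ^ 2 + 1 ≠ 0 := by positivity
  have e2 : b ^ 2 + b + 1 ≠ 0 := by nlinarith [sq_nonneg (b + 1 / 2)]
  have key := curve24 (X := (b ^ 2 + b + 1) / b)
    (y := 2 * N * (b ^ 2 + b + 1) / (b ^ 2 + 1)) (by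
      have a1 : (b ^ 2 + b + 1) / b - 1 = (b ^ 2 + 1) / b := by field_simp; ring
      have a2 : (b ^ 2 + b + 1) / b + 3 = (b ^ 2 + 4 * b + 1) / b := by field_simp; ring
      rw [a1, a2, div_mul_div_comm, div_mul_div_comm, div_pow,
        div_eq_div_iff (by positivity) (by positivity)]
      linear_combination (-(b ^ 2 + b + 1)) * h)
  rcases key with k | k | k | k | k <;> field_simp at k
  · exact absurd (by linarith) e2
  · exact absurd (by linarith) e1
  · exact (rat_sq_ne_three (b + 2) (by linear_combination k)).elim
  · left
    have : (b - 1) ^ 2 = 0 := by linear_combination k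
    have := pow_eq_zero_iff (two_ne_zero) |>.mp this
    linarith
  · right
    have : (b + 1) ^ 2 = 0 := by linear_combination k
    have := pow_eq_zero_iff (two_ne_zero) |>.mp this
    linarith

lemma ratC {b N : ℚ} (hb : b ≠ 0)
    (h : -4 * b ^ 3 * (b ^ 2 + b + 1) * N ^ 2 = (b + 1) ^ 6 * (b - 1) ^ 2) :
    b = 1 ∨ b = -1 := by
  by_contra hne
  push Not at hne
  have e1 : b - 1 ≠ 0 := sub_ne_zero.mpr hne.1
  have e3 : b + 1 ≠ 0 := fun h => hne.2 (by linarith)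
  have e2 : b ^ 2 + b + 1 ≠ 0 := by nlinarith [sq_nonneg (b + 1 / 2)]
  have hN : N ≠ 0 := by
    rintro rfl
    have : (b + 1) ^ 6 * (b - 1) ^ 2 ≠ 0 := by positivity
    exact this (by rw [← h]; ring)
  have key := curve24 (X := -(b ^ 2 + b + 1) / b)
    (y := (b + 1) ^ 4 * (b - 1) ^ 2 / (2 * N * b ^ 3)) (by
      have a1 : -(b ^ 2 + b + 1) / b - 1 = -(b + 1) ^ 2 / b := by field_simp; ring
      have a2 : -(b ^ 2 + b + 1) / b + 3 = -(b - 1) ^ 2 / b := by field_simp; ring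
      rw [a1, a2, div_mul_div_comm, div_mul_div_comm, div_pow,
        div_eq_div_iff (by positivity) (by positivity)]
      linear_combination (b ^ 3 * (b + 1) ^ 2 * (b - 1) ^ 2) * h)
  rcases key with k | k | k | k | k <;> field_simp at k
  · exact absurd (by linarith) e2
  · have : (b + 1) ^ 2 = 0 := by linear_combination -k
    exact e3 (pow_eq_zero_iff (two_ne_zero) |>.mp this)
  · have : (b - 1) ^ 2 = 0 := by linear_combination -k
    exact e1 (pow_eq_zero_iff (two_ne_zero) |>.mp this)
  · exact (rat_sq_ne_three (b + 2) (by linear_combination -k)).elim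
  · have : b ^ 2 + 1 = 0 := by linear_combination -k
    nlinarith

lemma quad_conj {F M : Type*} [Field F] [Field M] [Algebra F M] [CharZero F]
    (h : Module.finrank F M = 2) :
    ∃ τ : M ≃ₐ[F] M, (∀ x, τ x = x → ∃ r, algebraMap F M r = x) ∧ ∀ x, τ (τ x) = x := by
  haveI : Algebra.IsQuadraticExtension F M := ⟨h⟩
  haveI : FiniteDimensional F M := FiniteDimensional.of_finrank_pos (by omega)
  haveI : IsGalois F M := inferInstance
  have hcard : Nat.card (M ≃ₐ[F] M) = 2 := by rw [IsGalois.card_aut_eq_finrank, h]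
  obtain ⟨a, b, hab, huniv⟩ := Nat.card_eq_two_iff.mp hcard
  obtain ⟨τ, hτ⟩ : ∃ τ : M ≃ₐ[F] M, τ ≠ 1 := by
    by_cases h1 : a = 1
    · exact ⟨b, fun h2 => hab (by rw [h1, h2])⟩
    · exact ⟨a, h1⟩
  have hall : ∀ g : M ≃ₐ[F] M, g = 1 ∨ g = τ := by
    intro g
    have hu : ∀ g : M ≃ₐ[F] M, g = a ∨ g = b := fun g => by
      have : g ∈ ({a, b} : Set _) := by rw [huniv]; trivial
      simpa using this
    have h1 := hu g; have h2 := hu 1; have h3 := hu τ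
    grind
  refine ⟨τ, ?_, ?_⟩
  · intro x hx
    have := (IsGalois.mem_range_algebraMap_iff_fixed (F := F) (E := M) x).mpr (by
      intro g
      rcases hall g with rfl | rfl
      · rfl
      · exact hx)
    exact this
  · intro x
    have : τ * τ = 1 := by
      rcases hall (τ * τ) with h | h
      · exact h
      · exact absurd (mul_eq_left.mp h) hτ
    exact congrArg (fun g : M ≃ₐ[F] M => g x) this

lemma caseIII_reduce {K : Type*} [Field K] {b p q : K} (hp : b * p ^ 2 = (1 - b ^ 2) * p + b ^ 2 + b + 1)
    (hq : q = (p - 1) * (p + 1 + 2 * b)) :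
    b ^ 3 * ((p ^ 2 - 1) * q) = ((1 - b ^ 4) * (1 - b ^ 2) + 2 * b * (1 + b ^ 4)) * p
      + (1 - b ^ 4) * (1 + b) ^ 2 := by
  have h1 : b * (p ^ 2 - 1) = (1 - b ^ 2) * p + b ^ 2 + 1 := by linear_combination hp
  have h2 : b * q = (1 + b ^ 2) * p + 1 - b ^ 2 := by rw [hq]; linear_combination hp
  have h3 : b ^ 3 * ((p ^ 2 - 1) * q) = b * ((b * (p ^ 2 - 1)) * (b * q)) := by ring
  rw [h3, h1, h2]
  linear_combination (1 - b ^ 4) * hp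

/-- norm of a linear form in `p` -/
lemma norm_lin {K : Type*} [Field K] {b p p' A C : K} (hS : b * (p + p') = 1 - b ^ 2)
    (hM : b * (p * p') = -(b ^ 2 + b + 1)) :
    b * ((A * p + C) * (A * p' + C)) =
      -A ^ 2 * (b ^ 2 + b + 1) + A * C * (1 - b ^ 2) + b * C ^ 2 := by
  linear_combination A ^ 2 * hM + A * C * hS

lemma caseIII {K : Type*} [Field K] [CharZero K] {b p p' q q' n n' N e : K} (hb : b ≠ 0)
    (hS : b * (p + p') = 1 - b ^ 2) (hM : b * (p * p') = -(b ^ 2 + b + 1))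
    (hq : q = (p - 1) * (p + 1 + 2 * b)) (hq' : q' = (p' - 1) * (p' + 1 + 2 * b))
    (hn : (p ^ 2 - 1) * q * n ^ 2 = (p ^ 2 - 1) * q + 4 * e * p)
    (hn' : (p' ^ 2 - 1) * q' * n' ^ 2 = (p' ^ 2 - 1) * q' + 4 * e * p')
    (hN : N = n * n') :
    (e = 1 → 4 * b ^ 3 * (b ^ 2 + b + 1) * N ^ 2 = (b ^ 2 + 1) ^ 3 * (b ^ 2 + 4 * b + 1)) ∧
    (e = -1 → -4 * b ^ 3 * (b ^ 2 + b + 1) * N ^ 2 = (b + 1) ^ 6 * (b - 1) ^ 2) := by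
  have hp : b * p ^ 2 = (1 - b ^ 2) * p + b ^ 2 + b + 1 := by linear_combination p * hS - hM
  have hp' : b * p' ^ 2 = (1 - b ^ 2) * p' + b ^ 2 + b + 1 := by linear_combination p' * hS - hM
  have r := caseIII_reduce hp hq
  have r' := caseIII_reduce hp' hq'
  set A := (1 - b ^ 4) * (1 - b ^ 2) + 2 * b * (1 + b ^ 4) with hA
  set C := (1 - b ^ 4) * (1 + b) ^ 2 with hC
  set d := (p ^ 2 - 1) * q
  set d' := (p' ^ 2 - 1) * q'
  have n1 := norm_lin (A := A) (C := C) hS hM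
  have n2 := norm_lin (A := A + 4 * e * b ^ 3) (C := C) hS hM
  have s1 : b ^ 3 * (d + 4 * e * p) = (A + 4 * e * b ^ 3) * p + C := by linear_combination r
  have s1' : b ^ 3 * (d' + 4 * e * p') = (A + 4 * e * b ^ 3) * p' + C := by linear_combination r'
  have prod : (b * ((A * p + C) * (A * p' + C))) * N ^ 2 =
      b * (((A + 4 * e * b ^ 3) * p + C) * ((A + 4 * e * b ^ 3) * p' + C)) := by
    rw [← s1, ← s1', ← hn, ← hn', ← r, ← r', hN]; ring
  rw [n1, n2] at prod
  have h4 : (4 : K) ≠ 0 := by norm_num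
  constructor
  · rintro rfl
    have hk : (-4 * b ^ 3 : K) ≠ 0 := by simp [hb]
    apply mul_left_cancel₀ hk
    rw [hA, hC] at prod
    linear_combination prod
  · rintro rfl
    have hk : (4 * b ^ 3 : K) ≠ 0 := by simp [hb]
    apply mul_left_cancel₀ hk
    rw [hA, hC] at prod
    linear_combination prod

set_option maxHeartbeats 2000000 in
/-- The core arithmetic fact: no suitable quadratic points on (a model of) `X₁(24)`. -/
lemma core {K : Type*} [Field K] [CharZero K] [Algebra ℚ K] (hK : Module.finrank ℚ K = 2)
    {p q n : K} (hp0 : p ≠ 0) (h1 : p ^ 2 ≠ 1) (h2 : p ^ 2 ≠ -1) (h3 : p ^ 2 ≠ 3)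
    (h4 : p ^ 2 ≠ -3) (hq : q ^ 2 = (p ^ 2 - 1) * (p ^ 2 + 3))
    (hn : (p ^ 2 - 1) * q * n ^ 2 = (p ^ 2 - 1) * q + 4 * p) : False := by
  obtain ⟨τ, hfix', hinv⟩ := quad_conj hK
  have hfix : ∀ x, τ x = x → ∃ r : ℚ, (r : K) = x := by
    intro x hx
    obtain ⟨r, hr⟩ := hfix' x hx
    exact ⟨r, by rw [← hr, eq_ratCast]⟩
  have hτr : ∀ r : ℚ, τ (r : K) = r := fun r => map_ratCast τ r
  have t4 : τ 4 = (4 : K) := map_ofNat τ 4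
  have t3 : τ 3 = (3 : K) := map_ofNat τ 3
  have e1 : p ^ 2 - 1 ≠ 0 := sub_ne_zero.mpr h1
  have e4 : p ^ 2 + 3 ≠ 0 := fun h => h4 (by linear_combination h)
  have hq0 : q ≠ 0 := by
    rintro rfl
    have : (p ^ 2 - 1) * (p ^ 2 + 3) = 0 := by rw [← hq]; ring
    exact (mul_ne_zero e1 e4) this
  obtain ⟨N, hN⟩ := hfix (n * τ n) (by rw [map_mul, hinv]; ring)
  have hn' : (τ p ^ 2 - 1) * τ q * τ n ^ 2 = (τ p ^ 2 - 1) * τ q + 4 * τ p := by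
    simpa [t4] using congrArg τ hn
  have hq' : τ q ^ 2 = (τ p ^ 2 - 1) * (τ p ^ 2 + 3) := by
    simpa [t3] using congrArg τ hq
  -- rational `k = p ^ 2` with `p / q` anti-invariant
  have caseA : ∀ k : ℚ, (k : K) = p ^ 2 → τ p * τ q = - (p * q) → τ p ^ 2 = p ^ 2 → False := by
    intro k hk hpq hpp
    have k0 : k ≠ 0 := by rintro rfl; exact pow_ne_zero 2 hp0 (by simpa using hk.symm)
    have k1 : k ≠ 1 := by rintro rfl; exact h1 (by simpa using hk.symm)
    have k2 : k ≠ -1 := by rintro rfl; exact h2 (by simpa using hk.symm)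
    have k3 : k ≠ 3 := by rintro rfl; exact h3 (by simpa using hk.symm)
    have k4 : k ≠ -3 := by rintro rfl; exact h4 (by simpa using hk.symm)
    refine ratA (u := k) (N := N) k0 k1 k2 k3 k4 ?_
    have : (((k - 1) ^ 3 * (k + 3) * N ^ 2 : ℚ) : K) = (((k + 1) ^ 3 * (k - 3) : ℚ) : K) := by
      push_cast
      rw [hN, hk]
      rw [hpp] at hn' hq'
      have f1 : (p ^ 2 - 1) ^ 2 * (p ^ 2 + 3) * n ^ 2 =
          (p ^ 2 - 1) ^ 2 * (p ^ 2 + 3) + 4 * (p * q) := by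
        linear_combination q * hn - (p ^ 2 - 1) * n ^ 2 * hq + (p ^ 2 - 1) * hq
      have f2 : (p ^ 2 - 1) ^ 2 * (p ^ 2 + 3) * τ n ^ 2 =
          (p ^ 2 - 1) ^ 2 * (p ^ 2 + 3) - 4 * (p * q) := by
        linear_combination τ q * hn' - (p ^ 2 - 1) * τ n ^ 2 * hq' + (p ^ 2 - 1) * hq' + 4 * hpq
      have hc : (p ^ 2 - 1) * (p ^ 2 + 3) ≠ 0 := mul_ne_zero e1 e4
      apply mul_left_cancel₀ hc
      have f3 : ((p ^ 2 - 1) ^ 2 * (p ^ 2 + 3) * n ^ 2) * ((p ^ 2 - 1) ^ 2 * (p ^ 2 + 3) * τ n ^ 2)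
        = ((p ^ 2 - 1) ^ 2 * (p ^ 2 + 3)) ^ 2 - 16 * p ^ 2 * ((p ^ 2 - 1) * (p ^ 2 + 3)) := by
        rw [f1, f2, ← hq]; ring
      linear_combination f3
    exact_mod_cast this
  by_cases hpτ : τ p = p
  · obtain ⟨r, hr⟩ := hfix p hpτ
    have hqq : τ q ^ 2 = q ^ 2 := by rw [hq', hq, hpτ]
    rcases sq_eq_sq_iff_eq_or_eq_neg.mp hqq with h | h
    · obtain ⟨s, hs⟩ := hfix q h
      have : r ^ 2 * (r ^ 2 - 1) * (r ^ 2 + 3) = (r * s) ^ 2 := by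
        have : ((r ^ 2 * (r ^ 2 - 1) * (r ^ 2 + 3) : ℚ) : K) = (((r * s) ^ 2 : ℚ) : K) := by
          push_cast; rw [hr, hs]; linear_combination -p ^ 2 * hq
        exact_mod_cast this
      have hrk : ∀ c : ℚ, r ^ 2 = c → p ^ 2 = (c : K) := by
        rintro c rfl; rw [← hr]; push_cast; ring
      rcases curve24 this with h | h | h | h | h
      · exact pow_ne_zero 2 hp0 (by simpa using hrk _ h)
      · exact h1 (by simpa using hrk _ h)
      · exact h4 (by simpa using hrk _ h)
      · exact h3 (by simpa using hrk _ h)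
      · exact h2 (by simpa using hrk _ h)
    · exact caseA (r ^ 2) (by push_cast; rw [hr]) (by rw [hpτ, h]; ring) (by rw [hpτ])
  have hd : τ p - p ≠ 0 := sub_ne_zero.mpr hpτ
  obtain ⟨b, hb⟩ := hfix ((τ (q - p ^ 2) - (q - p ^ 2)) / (2 * (τ p - p))) (by
    have hd' : p - τ p ≠ 0 := fun h => hd (by linear_combination -h)
    have h2' : τ 2 = (2 : K) := map_ofNat τ 2
    simp only [map_div₀, map_mul, map_sub, map_pow, hinv, h2']
    field_simp
    ring)
  have hb' : 2 * (b : K) * (τ p - p) = τ (q - p ^ 2) - (q - p ^ 2) := by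
    rw [hb]; field_simp
  simp only [map_sub, map_pow] at hb'
  obtain ⟨g, hg⟩ := hfix (q - p ^ 2 - 2 * b * p) (by
    have h2' : τ 2 = (2 : K) := map_ofNat τ 2
    simp only [map_mul, map_sub, map_pow, hτr, h2']
    linear_combination -hb')
  have hqe : q = p ^ 2 + 2 * b * p + g := by rw [hg]; ring
  have hqe' : τ q = τ p ^ 2 + 2 * b * τ p + g := by linear_combination -hb' + hqe
  have cub : 4 * (b : K) * p ^ 3 + (4 * b ^ 2 + 2 * g - 2) * p ^ 2 + 4 * b * g * p + g ^ 2 + 3 = 0 := by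
    rw [hqe] at hq; linear_combination hq
  have cub' : 4 * (b : K) * τ p ^ 3 + (4 * b ^ 2 + 2 * g - 2) * τ p ^ 2 + 4 * b * g * τ p
      + g ^ 2 + 3 = 0 := by
    rw [hqe'] at hq'; linear_combination hq'
  by_cases hb0 : b = 0
  · subst hb0
    simp only [Rat.cast_zero] at *
    have hg1 : (2 * g - 2 : ℚ) ≠ 0 := by
      intro h
      have : g = 1 := by linarith
      rw [this] at cub
      norm_num at cub
    have hg1' : (2 * (g : K) - 2) ≠ 0 := by exact_mod_cast hg1
    have hk : (((-(g ^ 2 + 3) / (2 * g - 2) : ℚ)) : K) = p ^ 2 := by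
      push_cast
      rw [div_eq_iff hg1']; linear_combination -cub
    have hpp : τ p ^ 2 = p ^ 2 := by
      have := hτr (-(g ^ 2 + 3) / (2 * g - 2))
      rw [hk] at this
      simpa using this
    have hpm : τ p = -p := by
      rcases sq_eq_sq_iff_eq_or_eq_neg.mp hpp with h | h
      · exact absurd h hpτ
      · exact h
    exact caseA _ hk (by rw [hqe', hpp, hqe, hpm]; ring) hpp
  have hbK : (b : K) ≠ 0 := by exact_mod_cast hb0
  obtain ⟨s, hs⟩ := hfix (p + τ p) (by rw [map_add, hinv]; ring)
  obtain ⟨m, hm⟩ := hfix (p * τ p) (by rw [map_mul, hinv]; ring)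
  obtain ⟨r, hr⟩ : ∃ r : ℚ, 4 * b * (r + s) = -(4 * b ^ 2 + 2 * g - 2) :=
    ⟨-(4 * b ^ 2 + 2 * g - 2) / (4 * b) - s, by field_simp; ring⟩
  have hrK : 4 * (b : K) * (r + s) = -(4 * b ^ 2 + 2 * g - 2) := by exact_mod_cast hr
  have h4b : (4 * b : K) ≠ 0 := mul_ne_zero (by norm_num) hbK
  have gK : (g : K) = m + r * s := by
    have : (τ p - p) * (4 * b) * ((g : K) - (m + r * s)) = 0 := by
      rw [hs] at hrK
      rw [hm, hs]
      linear_combination cub' - cub - (τ p ^ 2 - p ^ 2) * hrK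
    have := (mul_eq_zero.mp this).resolve_left (mul_ne_zero hd h4b)
    linear_combination this
  have gK2 : (g : K) ^ 2 + 3 = -4 * b * r * m := by
    have e : (4 * (b : K) ^ 2 + 2 * g - 2) = - (4 * b * (r + s)) := by linear_combination hrK
    rw [e] at cub
    have : 4 * (b : K) * g * p = 4 * b * (m + r * s) * p := by rw [gK]
    rw [hs] at cub this
    rw [hm] at this ⊢
    linear_combination cub - this
  have gQ : g = m + r * s := by exact_mod_cast gK
  have gQ2 : g ^ 2 + 3 = -4 * b * r * m := by exact_mod_cast gK2
  have hcr : (r ^ 2 + 2 * b * r + g) ^ 2 = (r ^ 2 - 1) * (r ^ 2 + 3) := by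
    linear_combination gQ2 + 4 * b * r * gQ + r ^ 2 * hr
  have hr1 : r ^ 2 = 1 := by
    rcases curve24 (X := r ^ 2) (y := r * (r ^ 2 + 2 * b * r + g))
      (by linear_combination -r ^ 2 * hcr) with h | h | h | h | h
    · rw [h] at hcr; nlinarith
    · exact h
    · nlinarith
    · exact (rat_sq_ne_three r h).elim
    · nlinarith
  have hr0 : r ^ 2 + 2 * b * r + g = 0 := by
    rw [hr1] at hcr ⊢
    have : (1 + 2 * b * r + g) ^ 2 = 0 := by rw [hcr]; ring
    exact (pow_eq_zero_iff two_ne_zero).mp this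
  have hr' : r = 1 ∨ r = -1 := by
    rcases mul_eq_zero.mp (show (r - 1) * (r + 1) = 0 by linear_combination hr1) with h | h
    · left; linarith
    · right; linarith
  have hpp : p ^ 2 = s * p - m := by rw [hs, hm]; ring
  have fin : b = 1 ∨ b = -1 → False := by
    intro hb1
    have hss : s = 0 ∧ (m = -3 ∨ m = 1) := by
      rcases hb1 with h | h <;> rcases hr' with h' | h' <;> subst h <;> subst h'
      · have : s = 0 := by linarith
        subst this; exact ⟨rfl, by left; linarith⟩
      · have : s = 0 := by linarith
        subst this; exact ⟨rfl, by right; linarith⟩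
      · have : s = 0 := by linarith
        subst this; exact ⟨rfl, by right; linarith⟩
      · have : s = 0 := by linarith
        subst this; exact ⟨rfl, by left; linarith⟩
    obtain ⟨rfl, rfl | rfl⟩ := hss
    · exact h3 (by rw [hpp]; push_cast; ring)
    · exact h2 (by rw [hpp]; push_cast; ring)
  rcases hr' with h | h <;> subst h
  · have hgK : (g : K) = -1 - 2 * b := by
      have : g = -1 - 2 * b := by linarith
      rw [this]; push_cast; ring
    have S : b * s = 1 - b ^ 2 := by nlinarith
    have M : b * m = -(b ^ 2 + b + 1) := by nlinarith
    have SK : (b : K) * (p + τ p) = 1 - b ^ 2 := by rw [← hs]; exact_mod_cast S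
    have MK : (b : K) * (p * τ p) = -(b ^ 2 + b + 1) := by rw [← hm]; exact_mod_cast M
    have := (caseIII (e := 1) hbK SK MK (q := q) (q' := τ q) (n := n) (n' := τ n) (N := N)
      (by rw [hqe, hgK]; ring) (by rw [hqe', hgK]; ring) (by rw [hn]; ring) (by rw [hn']; ring)
      hN).1 rfl
    exact fin (ratB hb0 (by exact_mod_cast this))
  · have hgK : (g : K) = -1 + 2 * b := by
      have : g = -1 + 2 * b := by linarith
      rw [this]; push_cast; ring
    have S : b * s = 1 - b ^ 2 := by nlinarith
    have M : b * m = (b ^ 2 - b + 1) * (-1) * (-1) := by nlinarith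
    have SK : (b : K) * (p + τ p) = 1 - b ^ 2 := by rw [← hs]; exact_mod_cast S
    have MK : (b : K) * (p * τ p) = (b ^ 2 - b + 1) * (-1) * (-1) := by
      rw [← hm]; exact_mod_cast M
    have := (caseIII (b := -(b : K)) (p := -p) (p' := -τ p) (e := -1) (neg_ne_zero.mpr hbK)
      (by linear_combination SK) (by linear_combination -MK) (q := q) (q' := τ q) (n := n)
      (n' := τ n) (N := N)
      (by rw [hqe, hgK]; ring) (by rw [hqe', hgK]; ring)
      (by linear_combination hn) (by linear_combination hn') hN).2 rfl
    have h' := ratC (b := -b) (N := N) (neg_ne_zero.mpr hb0) (by exact_mod_cast this)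
    refine fin ?_
    rcases h' with h' | h'
    · right; linarith
    · left; linarith
lemma alg4 {L : Type*} [Field L] [CharZero L] (σ : L →+* L) {A B X0 Y0 U V Xr Yr l μ ν : L}
    (hAB : A^2 ≠ 4*B)
    (hY0 : Y0^2 = X0^3 + A*X0^2 + B*X0) (hY0n : Y0 ≠ 0)
    (d1 : 2*Y0*l = 3*X0^2 + 2*A*X0 + B) (d2 : 0 = l^2 - A - 2*X0) (d3 : 0 = -(Y0 + l*(0 - X0)))
    (hV : V^2 = U^3 + A*U^2 + B*U) (hVn : V ≠ 0)
    (e1 : 2*V*μ = 3*U^2 + 2*A*U + B) (e2 : X0 = μ^2 - A - 2*U) (e3 : Y0 = -(V + μ*(X0 - U)))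
    (hR : Yr^2 = Xr^3 + A*Xr^2 + B*Xr) (hRn : Yr ≠ 0)
    (f1 : 2*Yr*ν = 3*Xr^2 + 2*A*Xr + B) (f2 : Xr = ν^2 - A - 2*Xr)
    (sB : σ B = B) (sX0 : σ X0 = X0) (sU : σ U = U) (sXr : σ Xr = Xr)
    (sY0 : σ Y0 = -Y0) (sV : σ V = -V) (sYr : σ Yr = -Yr) :
    ∃ p q n : L, σ p = p ∧ σ q = q ∧ σ n = n ∧ p ≠ 0 ∧ p^2 ≠ 1 ∧ p^2 ≠ -1 ∧ p^2 ≠ 3 ∧ p^2 ≠ -3 ∧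
      q^2 = (p^2-1)*(p^2+3) ∧ (p^2-1)*q*n^2 = (p^2-1)*q + 4*p := by
  have hX0n : X0 ≠ 0 := by
    rintro rfl
    apply hY0n
    have : Y0^2 = 0 := by rw [hY0]; ring
    exact pow_eq_zero_iff (two_ne_zero) |>.1 this
  have hUn : U ≠ 0 := by
    rintro rfl
    apply hVn
    have : V^2 = 0 := by rw [hV]; ring
    exact pow_eq_zero_iff (two_ne_zero) |>.1 this
  have hXrn : Xr ≠ 0 := by
    rintro rfl
    apply hRn
    have : Yr^2 = 0 := by rw [hR]; ring
    exact pow_eq_zero_iff (two_ne_zero) |>.1 this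
  have hl : Y0 = l*X0 := by linear_combination d3
  have hln : l ≠ 0 := by rintro rfl; apply hY0n; rw [hl]; ring
  have hA : A = l^2 - 2*X0 := by linear_combination d2
  have hB : B = X0^2 := by
    linear_combination -d1 + 2*l*hl - 2*X0*hA
  subst hA hB hl
  have two : (2:L) ≠ 0 := two_ne_zero
  have sl : σ l = -l := by
    have : σ l * X0 = -l*X0 := by
      rw [map_mul, sX0] at sY0; rw [sY0]; ring
    exact mul_right_cancel₀ hX0n this
  -- m0
  obtain ⟨m, hm⟩ : ∃ m, 2*V*m = U^2 - X0^2 := ⟨(U^2-X0^2)/(2*V), by field_simp⟩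
  have hVm : μ*U = m*U + V := by
    apply mul_left_cancel₀ (mul_ne_zero two hVn)
    linear_combination U*e1 - U*hm - 2*hV
  have hm2 : m^2 = X0 := by
    have h2 : (2*V)^2*m^2 = (2*V)^2*X0 := by
      have : U^2*((2*V)^2*m^2 - (2*V)^2*X0) = 0 := by
        have e2' : X0*U^2 = (m*U+V)^2 - (l^2 - 2*X0)*U^2 - 2*U^3 := by
          rw [← hVm]; linear_combination U^2*e2
        have : m^2*U^2 = X0 * U^2 := by
          linear_combination -e2' - hV - U*hm
        linear_combination (2*V)^2*this
      have := (mul_eq_zero.1 this).resolve_left (pow_ne_zero 2 hUn)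
      linear_combination this
    exact mul_left_cancel₀ (pow_ne_zero 2 (mul_ne_zero two hVn)) h2
  have hmn : m ≠ 0 := by rintro rfl; apply hX0n; rw [← hm2]; ring
  have sm : σ m = -m := by
    have h := congrArg σ hm
    simp only [map_mul, map_sub, map_pow, sV, sU, sX0, map_ofNat] at h
    apply mul_left_cancel₀ (mul_ne_zero two hVn)
    linear_combination -h + hm
  have hvl : V^2 = U^2*(l^2 + 2*l*m) := by
    have e3' : l*X0*U = -(V*U + (m*U+V)*(X0-U)) := by
      rw [← hVm]; linear_combination U*e3
    have : X0*(V^2 - U^2*(l^2 + 2*l*m)) = 0 := by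
      subst hm2
      have e4 : l*m*U = U*(U-m^2) - V*m := by
        apply mul_left_cancel₀ hmn
        linear_combination e3'
      linear_combination -(m*U*l + (U*(U-m^2)-V*m))*e4 - 2*m^2*U*e4 + U^2*hm
    have := (mul_eq_zero.1 this).resolve_left hX0n
    linear_combination this
  -- k
  obtain ⟨k, hk⟩ : ∃ k, X0 = k*Xr := ⟨X0/Xr, by field_simp⟩
  have h3 : 3*Xr^4 + 4*(l^2-2*X0)*Xr^3 + 6*X0^2*Xr^2 - X0^4 = 0 := by
    have : (2*Yr)^2 * (3*Xr) = (2*Yr*ν)^2 - (2*Yr)^2 * (l^2-2*X0) := by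
      linear_combination (2*Yr)^2*f2
    rw [f1] at this
    linear_combination this - 4*(3*Xr+(l^2-2*X0))*hR
  have hkl : 4*l^2 = Xr*((k-1)^3*(k+3)) := by
    apply mul_left_cancel₀ (pow_ne_zero 3 hXrn)
    rw [hk] at h3
    linear_combination h3
  have hYr : 4*Yr^2 = Xr^3*((k-1)^2*(k+1)^2) := by
    rw [hk] at hR
    linear_combination 4*hR + Xr^2*hkl
  have k1 : k - 1 ≠ 0 := by
    intro h; rw [h] at hkl; apply pow_ne_zero 2 hln
    apply mul_left_cancel₀ (by norm_num : (4:L) ≠ 0); rw [hkl]; ring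
  have k3 : k + 3 ≠ 0 := by
    intro h; rw [h] at hkl; apply pow_ne_zero 2 hln
    apply mul_left_cancel₀ (by norm_num : (4:L) ≠ 0); rw [hkl]; ring
  have k2 : k + 1 ≠ 0 := by
    intro h; rw [h] at hYr; apply pow_ne_zero 2 hRn
    apply mul_left_cancel₀ (by norm_num : (4:L) ≠ 0); rw [hYr]; ring
  have k4 : k ≠ 3 := by
    rintro rfl; apply hAB
    linear_combination (l^2)*(1/4)*hkl - (l^2)*4*hk
  have sk : σ k = k := by
    have h := congrArg σ hk
    rw [map_mul, sX0, sXr] at h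
    exact mul_right_cancel₀ hXrn (h.symm.trans hk)
  obtain ⟨ρ, hρ⟩ : ∃ ρ, ρ*(Xr*(k-1)*(k+1)) = 2*Yr := ⟨2*Yr/(Xr*(k-1)*(k+1)), by field_simp⟩
  have hcn : Xr*(k-1)*(k+1) ≠ 0 := mul_ne_zero (mul_ne_zero hXrn k1) k2
  have sρ : σ ρ = -ρ := by
    have h := congrArg σ hρ
    simp only [map_mul, map_sub, map_add, map_one, sk, sXr, sYr, map_ofNat] at h
    apply mul_right_cancel₀ hcn
    linear_combination h + hρ
  have hρ2 : ρ^2 = Xr := by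
    apply mul_right_cancel₀ (pow_ne_zero 2 hcn)
    linear_combination (ρ*(Xr*(k-1)*(k+1)) + 2*Yr)*hρ + hYr
  have hρn : ρ ≠ 0 := by rintro rfl; apply hXrn; rw [← hρ2]; ring
  have hp2 : (m/ρ)^2 = k := by
    rw [div_pow, hm2, hρ2, hk]; field_simp
  have hq2 : (2*l/(ρ*(k-1)))^2 = (k-1)*(k+3) := by
    rw [div_pow, mul_pow, mul_pow, hρ2, show (2:L)^2 = 4 by norm_num, hkl]; field_simp
  have hn2 : (V/(U*l))^2 = (l + 2*m)/l := by
    rw [div_pow, hvl]; field_simp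
  refine ⟨m/ρ, 2*l/(ρ*(k-1)), V/(U*l), ?_, ?_, ?_, div_ne_zero hmn hρn, ?_, ?_, ?_, ?_, ?_, ?_⟩
  · rw [map_div₀, sm, sρ, neg_div_neg_eq]
  · simp only [map_div₀, map_mul, map_sub, map_one, sl, sρ, sk, map_ofNat]
    rw [neg_mul, mul_neg, neg_div_neg_eq]
  · simp only [map_div₀, map_mul, sl, sU, sV]
    rw [mul_neg, neg_div_neg_eq]
  · rw [hp2]; intro h; exact k1 (by rw [h]; ring)
  · rw [hp2]; intro h; exact k2 (by rw [h]; ring)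
  · rw [hp2]; exact k4
  · rw [hp2]; intro h; exact k3 (by rw [h]; ring)
  · rw [hp2, hq2]
  · rw [hp2, hn2]; field_simp; ring
/-- The additive map of `C₂ ⊕ C₂₄` with `(1,0) ↦ u` and `(0,1) ↦ w - (0,1)`. -/
def fmap (u w x : ZMod 2 × ZMod 24) : ZMod 2 × ZMod 24 :=
  x.1.val • u + x.2.val • (w - (0, 1))

lemma fmap_fin : ∀ w : ZMod 2 × ZMod 24, 4 • w = 0 → ∀ u : ZMod 2 × ZMod 24, 2 • u = 0 →
    fmap u w w = w → fmap u w u = (1, 0) →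
    (¬ ∀ v : ZMod 2 × ZMod 24, 2 • v = 0 → fmap u w v = v) →
    (∀ v : ZMod 2 × ZMod 24, fmap u w v = v → 4 • v = 0) →
    ∃ z : ZMod 2 × ZMod 24, fmap u w z = -z ∧ 12 • z ≠ 0 ∧ 8 • z ≠ 0 := by
  decide +kernel

lemma group_part (s : (ZMod 2 × ZMod 24) →+ (ZMod 2 × ZMod 24)) (hs : ∀ x, s (s x) = x)
    (h4 : ∀ x, s x = x → 4 • x = 0) (h2 : ¬ ∀ x, 2 • x = 0 → s x = x) :
    ∃ z, s z = -z ∧ 12 • z ≠ 0 ∧ 8 • z ≠ 0 := by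
  have key : ∀ x, s x = fmap (s (1, 0)) (s (0, 1) + (0, 1)) x := by
    intro x
    have hx : x = x.1.val • ((1, 0) : ZMod 2 × ZMod 24) + x.2.val • ((0, 1) : ZMod 2 × ZMod 24) := by
      ext <;> simp
    conv_lhs => rw [hx]
    rw [map_add, map_nsmul, map_nsmul, fmap, add_sub_cancel_right]
  have hw : s (s (0, 1) + (0, 1)) = s (0, 1) + (0, 1) := by
    rw [map_add, hs, add_comm]
  have := fmap_fin (s (0, 1) + (0, 1)) (h4 _ hw) (s (1, 0))
    (by rw [← map_nsmul, show 2 • ((1, 0) : ZMod 2 × ZMod 24) = 0 by decide, map_zero])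
    (by rw [← key, hw]) (by rw [← key, hs])
  simp only [← key] at this
  exact this h2 h4
section Geo

variable {F : Type*} [Field F] [CharZero F]

lemma eqn_Y (V : Affine F) {x y : F} (h : V.Equation x y) :
    (y + (V.a₁*x + V.a₃)/2)^2 = x^3 + V.b₂/4*x^2 + V.b₄/2*x + V.b₆/4 := by
  rw [WeierstrassCurve.Affine.equation_iff] at h
  simp only [WeierstrassCurve.b₂, WeierstrassCurve.b₄, WeierstrassCurve.b₆]
  linear_combination h

open scoped Classical in
lemma dbl_zero (V : Affine F) {x y : F} {h : V.Nonsingular x y}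
    (hd : Point.some x y h + Point.some x y h = 0) : y + (V.a₁*x + V.a₃)/2 = 0 := by
  by_cases hy : y = V.negY x y
  · rw [WeierstrassCurve.Affine.negY] at hy
    linear_combination hy/2
  · rw [Point.add_self_of_Y_ne hy] at hd
    cases hd

open scoped Classical in
lemma dbl_some (V : Affine F) {x y x' y' : F} {h : V.Nonsingular x y} {h' : V.Nonsingular x' y'}
    (hd : Point.some x y h + Point.some x y h = Point.some x' y' h') :
    y + (V.a₁*x + V.a₃)/2 ≠ 0 ∧ ∃ l, 2*(y + (V.a₁*x + V.a₃)/2)*l = 3*x^2 + V.b₂/2*x + V.b₄/2 ∧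
      x' = l^2 - V.b₂/4 - 2*x ∧
      y' + (V.a₁*x' + V.a₃)/2 = -((y + (V.a₁*x + V.a₃)/2) + l*(x'-x)) := by
  by_cases hy : y = V.negY x y
  · rw [Point.add_self_of_Y_eq hy] at hd
    cases hd
  · rw [Point.add_self_of_Y_ne hy] at hd
    have hn : y - V.negY x y ≠ 0 := sub_ne_zero.2 hy
    have hsl := slope_of_Y_ne (W := V) (x₁ := x) (x₂ := x) (y₁ := y) (y₂ := y) rfl hy
    set sl := V.slope x x y y
    injection hd with hx hy'
    rw [eq_div_iff hn] at hsl
    simp only [WeierstrassCurve.Affine.addX, WeierstrassCurve.Affine.addY,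
      WeierstrassCurve.Affine.negAddY, WeierstrassCurve.Affine.negY] at hx hy' hsl hn
    simp only [WeierstrassCurve.b₂, WeierstrassCurve.b₄]
    refine ⟨fun h => hn (by linear_combination 2*h), sl + V.a₁/2, ?_, ?_, ?_⟩
    · linear_combination hsl
    · linear_combination -hx
    · rw [hx] at hy'
      linear_combination -hy'

lemma disc_ne (V : WeierstrassCurve F) (hV : V.Δ ≠ 0) {e : F}
    (he : 0 = e^3 + V.b₂/4*e^2 + V.b₄/2*e + V.b₆/4) :
    (3*e + V.b₂/4)^2 ≠ 4*(3*e^2 + V.b₂/2*e + V.b₄/2) := by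
  intro h
  apply hV
  have h8 := V.b_relation
  have h8' : V.b₈ = (V.b₂*V.b₆ - V.b₄^2)/4 := by linear_combination h8/4
  have h6 : V.b₆ = -(4*e^3 + V.b₂*e^2 + 2*V.b₄*e) := by linear_combination -4*he
  have h4 : V.b₄ = (3*e + V.b₂/4)^2/2 - 6*e^2 - V.b₂*e := by linear_combination -h/2
  rw [WeierstrassCurve.Δ, h8', h6, h4]
  ring
end Geo
section Final

variable {K : Type*} [Field K] [CharZero K] {L : Type*} [Field L] [Algebra K L]

open scoped Classical in
lemma anti_point [CharZero L] (W : WeierstrassCurve K) (σ : L →ₐ[K] L)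
    (T : Affine.Point (W.baseChange L)) (hT : T ≠ 0)
    (hs : Affine.Point.map (W' := W) σ T = -T) :
    ∃ x y h, T = Point.some x y h ∧ σ x = x ∧
      σ (y + ((W.baseChange L).a₁*x + (W.baseChange L).a₃)/2) =
        -(y + ((W.baseChange L).a₁*x + (W.baseChange L).a₃)/2) := by
  rcases T with _ | ⟨x, y, h⟩
  · exact absurd rfl hT
  · refine ⟨x, y, h, rfl, ?_⟩
    rw [Point.map_some, Point.neg_some] at hs
    injection hs with hx hy
    refine ⟨hx, ?_⟩
    rw [WeierstrassCurve.Affine.negY] at hy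
    have c1 : σ (W.baseChange L).a₁ = (W.baseChange L).a₁ := σ.commutes W.a₁
    have c3 : σ (W.baseChange L).a₃ = (W.baseChange L).a₃ := σ.commutes W.a₃
    simp only [map_add, map_div₀, map_mul, c1, c3, hx, map_ofNat]
    linear_combination hy

open scoped Classical in
lemma geo [Algebra ℚ K] (hK : Module.finrank ℚ K = 2) (W : WeierstrassCurve K) (hW : W.Δ ≠ 0)
    (σ : L →ₐ[K] L) (hfix : ∀ x, σ x = x → ∃ r, algebraMap K L r = x)
    (Q : Affine.Point (W.baseChange L)) (hs : Affine.Point.map (W' := W) σ Q = -Q)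
    (h24 : 24 • Q = 0) (h12 : 12 • Q ≠ 0) (h8 : 8 • Q ≠ 0) : False := by
  have : CharZero L := charZero_of_injective_algebraMap (algebraMap K L).injective
  have hsn : ∀ n : ℕ, Affine.Point.map (W' := W) σ (n • Q) = -(n • Q) := by
    intro n; rw [map_nsmul, hs, smul_neg]
  have h6 : 6 • Q ≠ 0 := by
    intro h; apply h12; rw [show 12 = 2*6 from rfl, mul_smul, h, smul_zero]
  have h3 : 3 • Q ≠ 0 := by
    intro h; apply h12; rw [show 12 = 4*3 from rfl, mul_smul, h, smul_zero]
  obtain ⟨e, ye, he, hE, sE, sYe⟩ := anti_point W σ _ h12 (hsn 12)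
  obtain ⟨x0, y0, h0, hP4, sx0, sy0⟩ := anti_point W σ _ h6 (hsn 6)
  obtain ⟨u, v, huv, hP8, su, sv⟩ := anti_point W σ _ h3 (hsn 3)
  obtain ⟨xr, yr, hr, hR, sxr, syr⟩ := anti_point W σ _ h8 (hsn 8)
  have D2 := dbl_zero (W.baseChange L) (h := he) (by
    rw [← hE, ← two_smul ℕ (12 • Q), ← mul_smul]; exact h24)
  obtain ⟨y0n, l, d1, d2, d3⟩ := dbl_some (W.baseChange L) (h := h0) (h' := he) (by
    rw [← hE, ← hP4, ← two_smul ℕ (6 • Q), ← mul_smul]; rfl)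
  obtain ⟨vn, μ, e1, e2, e3⟩ := dbl_some (W.baseChange L) (h := huv) (h' := h0) (by
    rw [← hP8, ← hP4, ← two_smul ℕ (3 • Q), ← mul_smul]; rfl)
  have h16 : (8 • Q : Affine.Point (W.baseChange L)) + (8 • Q : Affine.Point (W.baseChange L)) =
      -(8 • Q : Affine.Point (W.baseChange L)) := by
    rw [eq_neg_iff_add_eq_zero, ← h24]; abel
  rw [hR, Point.neg_some] at h16
  obtain ⟨yrn, ν, f1, f2, -⟩ := dbl_some (W.baseChange L) h16
  have E2 := eqn_Y (W.baseChange L) he.1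
  have E4 := eqn_Y (W.baseChange L) h0.1
  have E8 := eqn_Y (W.baseChange L) huv.1
  have ER := eqn_Y (W.baseChange L) hr.1
  have hD : (W.baseChange L).Δ ≠ 0 := by
    have : (W.baseChange L).Δ = algebraMap K L W.Δ := W.map_Δ _
    rw [this]
    exact (map_ne_zero _).2 hW
  rw [D2] at E2 d3
  have E2' : 0 = e^3 + (W.baseChange L).b₂/4*e^2 + (W.baseChange L).b₄/2*e
      + (W.baseChange L).b₆/4 := by linear_combination E2
  have hdisc := disc_ne (W.baseChange L) hD E2'
  have cb2 : σ (W.baseChange L).b₂ = (W.baseChange L).b₂ := by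
    have : (W.baseChange L).b₂ = algebraMap K L W.b₂ := W.map_b₂ _
    rw [this]; exact σ.commutes _
  have cb4 : σ (W.baseChange L).b₄ = (W.baseChange L).b₄ := by
    have : (W.baseChange L).b₄ = algebraMap K L W.b₄ := W.map_b₄ _
    rw [this]; exact σ.commutes _
  generalize (W.baseChange L).b₂ = b2 at *
  generalize (W.baseChange L).b₄ = b4 at *
  generalize (W.baseChange L).b₆ = b6 at *
  generalize y0 + ((W.baseChange L).a₁*x0 + (W.baseChange L).a₃)/2 = Y0 at *
  generalize v + ((W.baseChange L).a₁*u + (W.baseChange L).a₃)/2 = V at *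
  generalize yr + ((W.baseChange L).a₁*xr + (W.baseChange L).a₃)/2 = Yr at *
  obtain ⟨p, q, n, sp, sq, sn, hp0, hp1, hp2, hp3, hp4, hq, hn⟩ :=
    alg4 (σ : L →+* L) (A := 3*e + b2/4) (B := 3*e^2 + b2/2*e + b4/2) (X0 := x0 - e) (Y0 := Y0)
      (U := u - e) (V := V) (Xr := xr - e) (Yr := Yr) (l := l) (μ := μ) (ν := ν)
      hdisc (by linear_combination E4 - E2') y0n (by linear_combination d1)
      (by linear_combination d2) (by linear_combination d3)
      (by linear_combination E8 - E2') vn (by linear_combination e1)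
      (by linear_combination e2) (by linear_combination e3)
      (by linear_combination ER - E2') yrn (by linear_combination f1)
      (by linear_combination f2)
      (by simp [sE, cb2, cb4, map_ofNat]) (by simp [sE, sx0]) (by simp [sE, su]) (by simp [sE, sxr])
      (by simpa using sy0) (by simpa using sv) (by simpa using syr)
  obtain ⟨p, rfl⟩ := hfix p sp
  obtain ⟨q, rfl⟩ := hfix q sq
  obtain ⟨n, rfl⟩ := hfix n sn
  have inj := (algebraMap K L).injective
  refine core (p := p) (q := q) (n := n) hK ?_ ?_ ?_ ?_ ?_ (inj ?_) (inj ?_)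
  · rintro rfl; simp at hp0
  · intro h; apply hp1; rw [← map_pow, h]; simp [map_ofNat]
  · intro h; apply hp2; rw [← map_pow, h]; simp [map_ofNat]
  · intro h; apply hp3; rw [← map_pow, h]; simp [map_ofNat]
  · intro h; apply hp4; rw [← map_pow, h]; simp [map_ofNat]
  · simpa [map_ofNat] using hq
  · simpa [map_ofNat] using hn

open scoped Classical in
lemma fixed_point (W : WeierstrassCurve K) (σ : L →ₐ[K] L)
    (hfix : ∀ x, σ x = x → ∃ r, algebraMap K L r = x)
    (T : Affine.Point (W.baseChange L)) (hs : Affine.Point.map (W' := W) σ T = T) :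
    ∃ S : Affine.Point (W.baseChange K), Affine.Point.map (W' := W) (Algebra.ofId K L) S = T := by
  rcases T with _ | ⟨x, y, h⟩
  · exact ⟨0, rfl⟩
  · rw [Point.map_some] at hs
    injection hs with hx hy
    obtain ⟨a, rfl⟩ := hfix x hx
    obtain ⟨b, rfl⟩ := hfix y hy
    exact ⟨Point.some a b ((WeierstrassCurve.Affine.baseChange_nonsingular (W := W) (f := Algebra.ofId K L)
      (algebraMap K L).injective a b).1 h), rfl⟩

end Final

open scoped Classical in
/-- Let `K` be a quadratic number field, `E` an elliptic curve over `K`, and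
`L` a quadratic extension of `K`. If `E(K)_tor ≃ C₄`, then `E(L)_tor ≄ C₂ ⊕ C₂₄`. -/
theorem stmt6 {K : Type*} [Field K] [NumberField K] (hK : Module.finrank ℚ K = 2)
    {L : Type*} [Field L] [Algebra K L] (hL : Module.finrank K L = 2)
    (W : WeierstrassCurve K) (hW : W.Δ ≠ 0)
    (h4 : Nonempty (AddCommGroup.torsion (Affine.Point (W.baseChange K)) ≃+ ZMod 4)) :
    IsEmpty (AddCommGroup.torsion (Affine.Point (W.baseChange L)) ≃+ (ZMod 2 × ZMod 24)) := by

  refine ⟨fun φ => ?_⟩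
  obtain ⟨ψ⟩ := h4
  obtain ⟨τ, hfix, hinv⟩ := quad_conj hL
  let s0 := Affine.Point.map (W' := W) (τ : L →ₐ[K] L)
  have hs0 : ∀ T, s0 (s0 T) = T := by
    rintro (_ | ⟨x, y, h⟩)
    · rfl
    · simp only [s0, Point.map_some]
      congr 1
      · exact hinv x
      · exact hinv y
  -- restriction to the torsion subgroup
  let s1 : AddCommGroup.torsion (Affine.Point (W.baseChange L)) →+
      AddCommGroup.torsion (Affine.Point (W.baseChange L)) :=
    (s0.comp (AddSubgroup.subtype _)).codRestrict _ (fun x => s0.isOfFinAddOrder x.2)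
  have hs1 : ∀ x, (s1 x : Affine.Point (W.baseChange L)) = s0 x := fun x => rfl
  let s : (ZMod 2 × ZMod 24) →+ (ZMod 2 × ZMod 24) :=
    (φ.toAddMonoidHom.comp s1).comp φ.symm.toAddMonoidHom
  have hsφ : ∀ x, s x = φ (s1 (φ.symm x)) := fun x => rfl
  -- fixed torsion points descend
  have desc : ∀ x, s x = x → ∃ S : AddCommGroup.torsion (Affine.Point (W.baseChange K)),
      Affine.Point.map (W' := W) (Algebra.ofId K L) S.1 = (φ.symm x).1 := by
    intro x hx
    rw [hsφ] at hx
    have h1 : s1 (φ.symm x) = φ.symm x := by rw [← φ.symm_apply_apply (s1 _), hx]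
    have h2 : s0 (φ.symm x).1 = (φ.symm x).1 := by rw [← hs1, h1]
    obtain ⟨S, hS⟩ := fixed_point W _ hfix _ h2
    refine ⟨⟨S, ?_⟩, hS⟩
    have hfo : IsOfFinAddOrder (φ.symm x).1 := (φ.symm x).2
    rw [← hS] at hfo
    exact (Point.map_injective (W' := W) (Algebra.ofId K L)).isOfFinAddOrder_iff.1 hfo
  have z4 : ∀ z : ZMod 4, 4 • z = 0 := by decide
  obtain ⟨z, hz, hz12, hz8⟩ := group_part s
    (by
      intro x
      rw [hsφ, hsφ, φ.symm_apply_apply]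
      have : s1 (s1 (φ.symm x)) = φ.symm x := Subtype.ext (hs0 _)
      rw [this, φ.apply_symm_apply])
    (by
      intro x hx
      obtain ⟨S, hS⟩ := desc x hx
      have hS4 : 4 • S = 0 := by
        apply ψ.injective; rw [map_nsmul, z4, map_zero]
      apply φ.symm.injective
      apply Subtype.ext
      rw [map_nsmul, map_zero, AddSubgroup.coe_nsmul, ← hS, ← map_nsmul, ← AddSubgroup.coe_nsmul,
        hS4]
      rfl)
    (by
      intro hall
      have hd : ∀ x : ZMod 2 × ZMod 24, 2 • x = 0 → ∃ c : ZMod 4, 2 • c = 0 ∧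
          Affine.Point.map (W' := W) (Algebra.ofId K L) (ψ.symm c).1 = (φ.symm x).1 := by
        intro x hx
        obtain ⟨S, hS⟩ := desc x (hall x hx)
        refine ⟨ψ S, ?_, by rw [ψ.symm_apply_apply, hS]⟩
        rw [← map_nsmul]
        have : 2 • S = 0 := by
          apply Subtype.ext
          apply Point.map_injective (W' := W) (Algebra.ofId K L)
          rw [AddSubgroup.coe_nsmul, map_nsmul, hS, ← AddSubgroup.coe_nsmul, ← map_nsmul, hx,
            map_zero]
          rfl
        rw [this, map_zero]
      obtain ⟨c1, hc1, hh1⟩ := hd (1, 0) (by decide)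
      obtain ⟨c2, hc2, hh2⟩ := hd (0, 12) (by decide)
      obtain ⟨c3, hc3, hh3⟩ := hd (0, 0) (by decide)
      have dd : ∀ a b c : ZMod 4, 2 • a = 0 → 2 • b = 0 → 2 • c = 0 → a = b ∨ b = c ∨ a = c := by
        decide
      have inj : ∀ {c x y}, Affine.Point.map (W' := W) (Algebra.ofId K L) (ψ.symm c).1 =
          (φ.symm x).1 → Affine.Point.map (W' := W) (Algebra.ofId K L) (ψ.symm c).1 =
          (φ.symm y).1 → x = y := fun h h' => φ.symm.injective (Subtype.ext (h.symm.trans h'))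
      rcases dd c1 c2 c3 hc1 hc2 hc3 with h | h | h
      · rw [h] at hh1
        exact absurd (inj hh1 hh2) (by decide)
      · rw [h] at hh2
        exact absurd (inj hh2 hh3) (by decide)
      · rw [h] at hh1
        exact absurd (inj hh1 hh3) (by decide))
  have back : ∀ n : ℕ, n • (φ.symm z).1 = 0 ↔ n • z = 0 := by
    intro n
    rw [← AddSubgroup.coe_nsmul, ← map_nsmul, ZeroMemClass.coe_eq_zero,
      EmbeddingLike.map_eq_zero_iff]
  have z24 : ∀ z : ZMod 2 × ZMod 24, 24 • z = 0 := by decide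
  refine geo hK W hW (τ : L →ₐ[K] L) hfix (φ.symm z).1 ?_ ((back 24).2 (z24 z))
    (fun h => hz12 ((back 12).1 h)) (fun h => hz8 ((back 8).1 h))
  have h1 : s1 (φ.symm z) = -φ.symm z := by
    rw [← φ.symm_apply_apply (s1 _), ← hsφ, hz, map_neg]
  exact congrArg Subtype.val h1
end

section
/- Let K be a quadratic number field, E an elliptic curve over K given by y² = x³ + Ax + B, d ∈ K a nonsquare, and L = K(√d). If E(L) contains a subgroup isomorphic to C_32 (equivalently, a point of order 32), then E(K) or E^d(K) contains a point of order 16. -/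
open WeierstrassCurve WeierstrassCurve.Affine

open scoped Classical in
/-- Scaling `(x, y) ↦ (u²x, u³y)` between short Weierstrass curves. -/
noncomputable def scaleHom {F : Type*} [Field F] (W V : Affine F) (u : F) (hu : u ≠ 0)
    (h1 : W.a₁ = 0) (h2 : W.a₂ = 0) (h3 : W.a₃ = 0)
    (k1 : V.a₁ = 0) (k2 : V.a₂ = 0) (k3 : V.a₃ = 0)
    (h4 : V.a₄ = u ^ 4 * W.a₄) (h6 : V.a₆ = u ^ 6 * W.a₆) : W.Point →+ V.Point :=
  have key : ∀ {x y : F}, W.Nonsingular x y → V.Nonsingular (u ^ 2 * x) (u ^ 3 * y) := by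
    intro x y h
    rw [nonsingular_iff', equation_iff'] at h ⊢
    rw [h1, h2, h3] at h
    rw [k1, k2, k3, h4, h6]
    obtain ⟨he, hn⟩ := h
    refine ⟨by linear_combination u ^ 6 * he, ?_⟩
    rcases hn with hn | hn
    · left
      intro h0
      apply hn
      apply (mul_eq_zero.mp (?_ : u ^ 4 * _ = 0)).resolve_left (pow_ne_zero 4 hu)
      linear_combination h0
    · right
      intro h0
      apply hn
      apply (mul_eq_zero.mp (?_ : u ^ 3 * _ = 0)).resolve_left (pow_ne_zero 3 hu)
      linear_combination h0
  { toFun := fun P => match P with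
      | 0 => 0
      | .some _ _ h => .some _ _ (key h)
    map_zero' := rfl
    map_add' := by
      have u2 := pow_ne_zero 2 hu
      have u3 := pow_ne_zero 3 hu
      have hneg : ∀ x y, V.negY (u ^ 2 * x) (u ^ 3 * y) = u ^ 3 * W.negY x y := by
        intro x y
        simp only [negY, h1, h3, k1, k3]
        ring
      rintro (_ | ⟨x₁, y₁, p₁⟩) (_ | ⟨x₂, y₂, p₂⟩)
      any_goals rfl
      by_cases hxy : x₁ = x₂ ∧ y₁ = W.negY x₂ y₂
      · rw [Point.add_of_Y_eq hxy.left hxy.right]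
        exact (Point.add_of_Y_eq (by rw [hxy.1]) (by rw [hneg, hxy.2])).symm
      · have hxy' : ¬ (u ^ 2 * x₁ = u ^ 2 * x₂ ∧ u ^ 3 * y₁ = V.negY (u ^ 2 * x₂) (u ^ 3 * y₂)) := by
          rw [hneg]
          exact fun h => hxy ⟨mul_left_cancel₀ u2 h.1, mul_left_cancel₀ u3 h.2⟩
        have hsl : V.slope (u ^ 2 * x₁) (u ^ 2 * x₂) (u ^ 3 * y₁) (u ^ 3 * y₂)
            = u * W.slope x₁ x₂ y₁ y₂ := by
          by_cases hx : x₁ = x₂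
          · have hy : y₁ ≠ W.negY x₂ y₂ := fun h => hxy ⟨hx, h⟩
            rw [slope_of_Y_ne hx hy, slope_of_Y_ne (by rw [hx])
              (by rw [hneg]; exact fun h => hy (mul_left_cancel₀ u3 h)), hneg, h1, h2, k1, k2, h4,
              ← mul_sub]
            have hd : y₁ - W.negY x₁ y₁ ≠ 0 := by
              have := Y_eq_of_Y_ne p₁.1 p₂.1 hx hy
              subst hx this
              exact sub_ne_zero.mpr hy
            field_simp
            ring
          · rw [slope_of_X_ne hx, slope_of_X_ne (fun h => hx (mul_left_cancel₀ u2 h)),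
              ← mul_sub, ← mul_sub]
            have := sub_ne_zero.mpr hx
            field_simp
        rw [Point.add_some hxy]
        refine Eq.trans ?_ (Point.add_some hxy').symm
        simp only [Point.some.injEq, addX, addY, negAddY, negY, hsl, h1, h2, h3, k1, k2, k3]
        constructor <;> ring }

/-- A quadratic extension `K(√d)` has an automorphism negating `√d` with fixed field `K`. -/
lemma exists_conj {K L : Type*} [Field K] [CharZero K] [Field L] [Algebra K L]
    (hL : Module.finrank K L = 2) (d : K) (hd : ¬ ∃ c : K, c ^ 2 = d)
    (s : L) (hs : s ^ 2 = algebraMap K L d) :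
    ∃ σ : L ≃ₐ[K] L, σ s = -s ∧ (∀ x, σ (σ x) = x) ∧ ∀ x, σ x = x → ∃ a, algebraMap K L a = x := by
  have : Module.Finite K L := Module.finite_of_finrank_pos (by omega)
  have : Algebra.IsQuadraticExtension K L := ⟨hL⟩
  have hc : Nat.card (L ≃ₐ[K] L) = 2 := by rw [IsGalois.card_aut_eq_finrank, hL]
  obtain ⟨σ, hσ, hu⟩ := (Nat.card_eq_two_iff' (1 : L ≃ₐ[K] L)).mp hc
  have hfix : ∀ x, σ x = x → ∃ a, algebraMap K L a = x := by
    intro x hx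
    have := (IsGalois.mem_bot_iff_fixed (F := K) x).mpr (by
      intro τ
      by_cases h : τ = 1
      · simp [h]
      · rw [hu τ h, hx])
    exact IntermediateField.mem_bot.mp this
  refine ⟨σ, ?_, ?_, hfix⟩
  · have h1 : σ s ^ 2 = s ^ 2 := by rw [← map_pow, hs, AlgEquiv.commutes]
    rcases sq_eq_sq_iff_eq_or_eq_neg.mp h1 with h | h
    · obtain ⟨a, ha⟩ := hfix s h
      refine absurd ⟨a, ?_⟩ hd
      apply (algebraMap K L).injective
      rw [map_pow, ha, hs]
    · exact h
  · intro x
    have h : σ * σ = 1 := by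
      by_contra h
      have := hu _ h
      exact hσ (by simpa using this)
    exact congrArg (fun τ : L ≃ₐ[K] L => τ x) h

open scoped Classical in
/-- Points fixed by conjugation descend. -/
lemma descend {K L : Type*} [Field K] [Field L] [Algebra K L] (W : WeierstrassCurve K)
    (σ : L →ₐ[K] L) (hfix : ∀ x, σ x = x → ∃ a, algebraMap K L a = x)
    (P : Affine.Point (W.baseChange L))
    (hP : Point.map (W' := W) σ P = P) :
    ∃ Q : Affine.Point (W.baseChange K), Point.map (W' := W) (Algebra.ofId K L) Q = P := by
  rcases P with _ | ⟨x, y, h⟩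
  · exact ⟨0, rfl⟩
  · have h' := hP
    erw [Point.map_some, Point.some.injEq] at h'
    obtain ⟨a, rfl⟩ := hfix _ h'.1
    obtain ⟨b, rfl⟩ := hfix _ h'.2
    exact ⟨.some a b ((W.toAffine.baseChange_nonsingular (Algebra.ofId K L).injective a b).mp h), rfl⟩

lemma order16 {G H : Type*} [AddCommGroup G] [AddCommGroup H] (f : G →+ H)
    (hf : Function.Injective f) (Q : G) (h32 : 32 • f Q = 0) (h8 : 8 • f Q ≠ 0) :
    ∃ P : G, addOrderOf P = 16 := by
  have h32' : 32 • Q = 0 := hf (by rw [map_nsmul, h32, map_zero])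
  have h8' : 8 • Q ≠ 0 := fun h => h8 (by rw [← map_nsmul, h, map_zero])
  have : Fact (Nat.Prime 2) := ⟨Nat.prime_two⟩
  by_cases h16 : 16 • Q = 0
  · exact ⟨Q, addOrderOf_eq_prime_pow (p := 2) (n := 3) h8' h16⟩
  · refine ⟨2 • Q, addOrderOf_eq_prime_pow (p := 2) (n := 3) ?_ ?_⟩
    · rw [smul_smul]; exact h16
    · rw [smul_smul]; exact h32'

open scoped Classical in
/-- Let `K` be a quadratic number field, `E : y² = x³ + Ax + B` an elliptic
curve over `K`, `d ∈ K` a nonsquare and `L = K(√d)`. If `E(L)` contains a subgroup isomorphic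
to `C₃₂` (equivalently, a point of order `32`), then `E(K)` or `E^d(K)` contains a point of
order `16`. -/
theorem stmt7 {K : Type*} [Field K] [NumberField K] (hK : Module.finrank ℚ K = 2)
    (A B d : K) (hd : ¬ ∃ c : K, c ^ 2 = d) (hΔ : (shortW A B).Δ ≠ 0)
    {L : Type*} [Field L] [Algebra K L] (hL : Module.finrank K L = 2)
    (s : L) (hs : s ^ 2 = algebraMap K L d)
    (h32 : ∃ P : Affine.Point ((shortW A B).baseChange L), addOrderOf P = 32) :
    (∃ P : Affine.Point ((shortW A B).baseChange K), addOrderOf P = 16) ∨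
      (∃ P : Affine.Point ((shortW (d ^ 2 * A) (d ^ 3 * B)).baseChange K), addOrderOf P = 16) := by
  obtain ⟨P, hP⟩ := h32
  obtain ⟨σ, hσs, hσσ, hfix⟩ := exists_conj hL d hd s hs
  have hs0 : s ≠ 0 := by
    rintro rfl
    apply hd
    refine ⟨0, ?_⟩
    apply (algebraMap K L).injective
    rw [← hs]
    simp
  let T : Affine.Point ((shortW A B).baseChange L) →+ Affine.Point ((shortW A B).baseChange L) :=
    Point.map (W' := shortW A B) σ.toAlgHom
  have hTT : ∀ R, T (T R) = R := by
    rintro (_ | ⟨x, y, h⟩)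
    · rfl
    · change Point.some (σ (σ x)) (σ (σ y)) _ = _
      simp only [hσσ]
  have h16 : 16 • P ≠ 0 := by
    intro h
    have := addOrderOf_dvd_of_nsmul_eq_zero h
    rw [hP] at this
    norm_num at this
  have h32 : 32 • P = 0 := by rw [← hP]; exact addOrderOf_nsmul_eq_zero P
  by_cases h8 : 8 • (P + T P) = 0
  · right
    have h8' : 8 • (P - T P) ≠ 0 := by
      intro h
      apply h16
      have e : 16 • P = 8 • (P + T P) + 8 • (P - T P) := by abel
      rw [e, h8, h, add_zero]
    let φ : Affine.Point ((shortW A B).baseChange L) →+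
        Affine.Point ((shortW (d ^ 2 * A) (d ^ 3 * B)).baseChange L) :=
      scaleHom ((shortW A B).baseChange L) ((shortW (d ^ 2 * A) (d ^ 3 * B)).baseChange L) s hs0
        (by simp [shortW]) (by simp [shortW]) (by simp [shortW])
        (by simp [shortW]) (by simp [shortW]) (by simp [shortW])
        (by simp [shortW, ← hs]; left; ring) (by simp [shortW, ← hs]; left; ring)
    have hφ : Function.Injective φ := by
      rw [injective_iff_map_eq_zero]
      rintro (_ | ⟨x, y, h⟩) h0
      · rfl
      · cases h0
    have hTφ : ∀ R, Point.map (W' := shortW (d ^ 2 * A) (d ^ 3 * B)) σ.toAlgHom (φ R)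
        = φ (-(T R)) := by
      rintro (_ | ⟨x, y, h⟩)
      · rfl
      · change Point.some (σ (s ^ 2 * x)) (σ (s ^ 3 * y)) _ =
          Point.some (s ^ 2 * σ x) (s ^ 3 * (Affine.negY ((shortW A B).baseChange L) (σ x) (σ y))) _
        simp only [Point.some.injEq, map_mul, map_pow, hσs, negY]
        constructor
        · ring
        · simp [shortW]
          ring
    obtain ⟨Q, hQ⟩ := descend _ σ.toAlgHom hfix (φ (P - T P)) (by
      rw [hTφ, map_sub, hTT, neg_sub])
    refine order16 _ (Point.map_injective (Algebra.ofId K L)) Q ?_ ?_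
    · rw [hQ, ← map_nsmul, smul_sub, ← map_nsmul, h32, map_zero, sub_zero, map_zero]
    · rw [hQ, ← map_nsmul]
      exact fun h => h8' (hφ (by rw [h, map_zero]))
  · left
    obtain ⟨Q, hQ⟩ := descend _ σ.toAlgHom hfix (P + T P) (by
      change T (P + T P) = _
      rw [map_add, hTT, add_comm])
    refine order16 _ (Point.map_injective (Algebra.ofId K L)) Q ?_ ?_
    · rw [hQ, smul_add, ← map_nsmul, h32, map_zero, add_zero]
    · rwa [hQ]
end

section
/- Let K be a number field, E an elliptic curve over K, L a quadratic extension of K, and p an odd prime. Then: (a) if E(K)[p] is trivial and E(L)[p] is isomorphic to C_p ⊕ C_p, then K contains a primitive p-th root of unity; (b) if E(K)[p] is isomorphic to C_p and E(L)[p^∞] is strictly larger than the image of E(K)[p^∞] under the base-change inclusion E(K) → E(L), then E(L)[p] is isomorphic to C_p ⊕ C_p; (c) if E(K)[p] is isomorphic to C_p and E(L)[p] is isomorphic to C_p ⊕ C_p, then K does not contain a primitive p-th root of unity; (d) if E(K)[p] is isomorphic to C_p ⊕ C_p, then E(L)[p^∞] equals the image of E(K)[p^∞] under the base-change inclusion E(K)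 → E(L). -/
open WeierstrassCurve WeierstrassCurve.Affine

namespace WP
open scoped Classical
open Polynomial

section setup
variable {K k S : Type*} [Field K] [Field k] [CommRing S] [Algebra K k] [Algebra K S]
  (W : WeierstrassCurve K)

lemma bc_a₁ : (W⁄S).a₁ = algebraMap K S W.a₁ := rfl
lemma bc_a₂ : (W⁄S).a₂ = algebraMap K S W.a₂ := rfl
lemma bc_a₃ : (W⁄S).a₃ = algebraMap K S W.a₃ := rfl
lemma bc_a₄ : (W⁄S).a₄ = algebraMap K S W.a₄ := rfl
lemma bc_a₆ : (W⁄S).a₆ = algebraMap K S W.a₆ := rfl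

/-- class of X -/
noncomputable def xR (W : WeierstrassCurve K) (k : Type*) [Field k] [Algebra K k] :
    (W⁄k).CoordinateRing := CoordinateRing.mk (W⁄k) (C X)
/-- class of Y -/
noncomputable def yR (W : WeierstrassCurve K) (k : Type*) [Field k] [Algebra K k] :
    (W⁄k).CoordinateRing := CoordinateRing.mk (W⁄k) X

lemma lift_aux (j : k →ₐ[K] S) (a b : S) (h : (W⁄S).Equation a b) :
    (W⁄k).polynomial.eval₂ (eval₂RingHom (j : k →+* S) a) b = 0 := by
  rw [equation_iff] at h
  simp only [bc_a₁, bc_a₂, bc_a₃, bc_a₄, bc_a₆] at h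
  rw [← sub_eq_zero] at h
  rw [← h]
  simp only [WeierstrassCurve.Affine.polynomial, bc_a₁, bc_a₂, bc_a₃, bc_a₄, bc_a₆,
    eval₂_sub, eval₂_add, eval₂_mul, eval₂_C, eval₂_X, eval₂_X_pow, coe_eval₂RingHom,
    RingHom.coe_coe, AlgHom.commutes]
  ring

/-- evaluation hom -/
noncomputable def lift (j : k →ₐ[K] S) (a b : S) (h : (W⁄S).Equation a b) :
    (W⁄k).CoordinateRing →+* S :=
  AdjoinRoot.lift (eval₂RingHom (j : k →+* S) a) b (lift_aux W j a b h)

variable {W}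
@[simp] lemma lift_x (j : k →ₐ[K] S) (a b : S) (h : (W⁄S).Equation a b) :
    lift W j a b h (xR W k) = a := by
  simp [lift, xR]

@[simp] lemma lift_y (j : k →ₐ[K] S) (a b : S) (h : (W⁄S).Equation a b) :
    lift W j a b h (yR W k) = b := by
  simp [lift, yR]

@[simp] lemma lift_poly (j : k →ₐ[K] S) (a b : S) (h : (W⁄S).Equation a b) (q : k[X]) :
    lift W j a b h (algebraMap k[X] _ q) = q.eval₂ (j : k →+* S) a := by
  have : algebraMap k[X] (W⁄k).CoordinateRing q = AdjoinRoot.of _ q := rfl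
  rw [this]
  simp [lift]

@[simp] lemma lift_const (j : k →ₐ[K] S) (a b : S) (h : (W⁄S).Equation a b) (c : k) :
    lift W j a b h (algebraMap k _ c) = j c := by
  rw [IsScalarTower.algebraMap_apply k k[X] (W⁄k).CoordinateRing, lift_poly]
  simp

lemma poly_x (q : k[X]) : algebraMap k[X] (W⁄k).CoordinateRing q = aeval (xR W k) q := by
  have : (Algebra.ofId k[X] (W⁄k).CoordinateRing).restrictScalars k = aeval (xR W k) := by
    ext
    simp [Algebra.ofId_apply, xR]
  exact DFunLike.congr_fun this q

lemma exists_rep (r : (W⁄k).CoordinateRing) : ∃ p q : k[X],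
    r = algebraMap k[X] _ p + algebraMap k[X] _ q * yR W k := by
  obtain ⟨p, q, h⟩ := CoordinateRing.exists_smul_basis_eq r
  refine ⟨p, q, ?_⟩
  rw [← h, Algebra.smul_def, Algebra.smul_def, mul_one, yR]

lemma hom_ext {S : Type*} [Semiring S] {f g : (W⁄k).CoordinateRing →+* S}
    (hc : ∀ c : k, f (algebraMap k _ c) = g (algebraMap k _ c))
    (hx : f (xR W k) = g (xR W k)) (hy : f (yR W k) = g (yR W k)) : f = g := by
  have hp : ∀ q : k[X], f (algebraMap k[X] _ q) = g (algebraMap k[X] _ q) := by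
    intro q
    rw [poly_x]
    induction q using Polynomial.induction_on' with
    | add p q hp hq => rw [map_add, map_add, map_add, hp, hq]
    | monomial n a => rw [aeval_monomial, map_mul, map_mul, map_pow, map_pow, hx, hc]
  refine RingHom.ext fun r => ?_
  obtain ⟨p, q, rfl⟩ := exists_rep r
  rw [map_add, map_add, map_mul, map_mul, hp, hp, hy]

/-- nonsingularity is automatic -/
lemma nons {S : Type*} [Field S] [Algebra K S] (hW : W.Δ ≠ 0) {a b : S}
    (h : (W⁄S).Equation a b) : (W⁄S).Nonsingular a b := by
  refine (equation_iff_nonsingular_of_Δ_ne_zero ?_).mp h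
  change (W.map (algebraMap K S)).Δ ≠ 0
  rw [map_Δ]
  simpa using hW

lemma eqn_R : (W⁄((W⁄k).CoordinateRing)).Equation (xR W k) (yR W k) := by
  have h : CoordinateRing.mk (W⁄k) (W⁄k).polynomial = 0 := AdjoinRoot.mk_self
  have h2 : CoordinateRing.mk (W⁄k) (X ^ 2 + C (C (W⁄k).a₁ * X + C (W⁄k).a₃) * X -
    C (X ^ 3 + C (W⁄k).a₂ * X ^ 2 + C (W⁄k).a₄ * X + C (W⁄k).a₆)) = 0 := h
  clear h
  have h := h2
  simp only [map_sub, map_add, map_mul, map_pow] at h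
  rw [equation_iff, ← sub_eq_zero, ← h]
  have e : ∀ c : K, algebraMap K (W⁄k).CoordinateRing c =
    CoordinateRing.mk (W⁄k) (C (C (algebraMap K k c))) := fun c => rfl
  simp only [bc_a₁, bc_a₂, bc_a₃, bc_a₄, bc_a₆, xR, yR, e]
  ring

end setup
end WP


namespace WP
open scoped Classical
open Polynomial

section filt
variable {K k : Type*} [Field K] [Field k] [Algebra K k] {W : WeierstrassCurve K}

/-- norm -/
noncomputable abbrev nm (r : (W⁄k).CoordinateRing) : k[X] := Algebra.norm k[X] r

lemma nm_rep (p q : k[X]) : nm (algebraMap k[X] (W⁄k).CoordinateRing p +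
    algebraMap k[X] _ q * yR W k) = Algebra.norm k[X]
      (p • (1 : (W⁄k).CoordinateRing) + q • CoordinateRing.mk (W⁄k) X) := by
  rw [Algebra.smul_def, Algebra.smul_def, mul_one, yR]

lemma deg_nm_rep (p q : k[X]) : (nm (algebraMap k[X] (W⁄k).CoordinateRing p +
    algebraMap k[X] _ q * yR W k)).degree = max (2 • p.degree) (2 • q.degree + 3) := by
  rw [nm_rep, CoordinateRing.degree_norm_smul_basis]

lemma two_le_iff (d : WithBot ℕ) (n : ℕ) : 2 • d ≤ (n : WithBot ℕ) ↔ d ≤ ((n / 2 : ℕ) : WithBot ℕ) := by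
  cases d with
  | bot => simp
  | coe d =>
    change ((2 • d : ℕ) : WithBot ℕ) ≤ ((n : ℕ) : WithBot ℕ) ↔ ((d : ℕ) : WithBot ℕ) ≤ _
    rw [Nat.cast_le, Nat.cast_le, smul_eq_mul]
    omega

/-- functions with pole order at most n -/
noncomputable def V (W : WeierstrassCurve K) (k : Type*) [Field k] [Algebra K k] (n : ℕ) :
    Submodule k (W⁄k).CoordinateRing where
  carrier := {r | (nm r).degree ≤ n}
  zero_mem' := by
    have h := deg_nm_rep (W := W) (0 : k[X]) 0
    rw [map_zero, zero_mul, add_zero] at h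
    rw [Set.mem_ofPred_eq, h]
    simp only [degree_zero]
    exact bot_le
  add_mem' := by
    intro a b ha hb
    obtain ⟨p, q, rfl⟩ := exists_rep a
    obtain ⟨p', q', rfl⟩ := exists_rep b
    simp only [Set.mem_ofPred_eq, deg_nm_rep, max_le_iff] at ha hb
    have : algebraMap k[X] (W⁄k).CoordinateRing p + algebraMap k[X] _ q * yR W k +
      (algebraMap k[X] _ p' + algebraMap k[X] _ q' * yR W k) =
      algebraMap k[X] _ (p + p') + algebraMap k[X] _ (q + q') * yR W k := by
      simp only [map_add]; ring
    rw [Set.mem_ofPred_eq, this, deg_nm_rep, max_le_iff]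
    have h1 := degree_add_le p p'
    have h2 := degree_add_le q q'
    constructor
    · rcases le_max_iff.mp h1 with h | h
      · exact (nsmul_le_nsmul_right h 2).trans ha.1
      · exact (nsmul_le_nsmul_right h 2).trans hb.1
    · rcases le_max_iff.mp h2 with h | h
      · exact (add_le_add_left (nsmul_le_nsmul_right h 2) 3).trans ha.2
      · exact (add_le_add_left (nsmul_le_nsmul_right h 2) 3).trans hb.2
  smul_mem' := by
    intro c a ha
    rw [Set.mem_ofPred_eq] at *
    have : c • a = algebraMap k[X] _ (C c) * a := by
      rw [Algebra.smul_def]; rfl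
    rw [this, nm, map_mul, degree_mul, Algebra.norm_algebraMap_of_basis (CoordinateRing.basis (W⁄k)),
      degree_pow]
    have h0 : (C c).degree ≤ 0 := degree_C_le
    have : Fintype.card (Fin 2) • (C c).degree ≤ 0 := by
      simpa using nsmul_le_nsmul_right h0 2
    calc _ ≤ 0 + (nm a).degree := add_le_add_left this _
      _ ≤ _ := by simpa using ha

lemma mem_V {n : ℕ} {r : (W⁄k).CoordinateRing} : r ∈ V W k n ↔ (nm r).degree ≤ n := Iff.rfl

lemma V_mono {m n : ℕ} (h : m ≤ n) : V W k m ≤ V W k n := by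
  intro r hr
  rw [mem_V] at *
  exact hr.trans (by exact_mod_cast h)

lemma V_mul {m n : ℕ} {r s : (W⁄k).CoordinateRing} (hr : r ∈ V W k m) (hs : s ∈ V W k n) :
    r * s ∈ V W k (m + n) := by
  rw [mem_V] at *
  rw [nm, map_mul, degree_mul, Nat.cast_add]
  exact add_le_add hr hs

lemma V_pow {m i : ℕ} {r : (W⁄k).CoordinateRing} (hr : r ∈ V W k m) : r ^ i ∈ V W k (m * i) := by
  induction i with
  | zero => simp [mem_V, nm]
  | succ i ih => rw [pow_succ]; exact V_mul ih hr

lemma one_mem_V (n : ℕ) : 1 ∈ V W k n := by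
  simp [mem_V, nm]

lemma const_mem_V (n : ℕ) (c : k) : algebraMap k _ c ∈ V W k n := by
  rw [Algebra.algebraMap_eq_smul_one]
  exact Submodule.smul_mem _ _ (one_mem_V n)

lemma poly_mem_V (n : ℕ) (p : k[X]) (h : p.degree ≤ ((n / 2 : ℕ) : WithBot ℕ)) :
    algebraMap k[X] (W⁄k).CoordinateRing p ∈ V W k n := by
  have := deg_nm_rep (W := W) p 0
  rw [map_zero, zero_mul, add_zero] at this
  rw [mem_V, this]
  simp only [degree_zero]
  have e : (2 • (⊥ : WithBot ℕ) + 3) = ⊥ := rfl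
  rw [e, max_bot_right]
  exact (two_le_iff _ _).mpr h

lemma x_mem_V : xR W k ∈ V W k 2 := by
  have := poly_mem_V (W := W) 2 (X : k[X]) (by simp)
  rwa [poly_x, aeval_X] at this

lemma y_mem_V : yR W k ∈ V W k 3 := by
  have := deg_nm_rep (W := W) (0 : k[X]) 1
  rw [map_zero, map_one, one_mul, zero_add] at this
  rw [mem_V, this]
  simp only [degree_zero, degree_one]
  rfl

lemma nm_eq_zero {r : (W⁄k).CoordinateRing} : nm r = 0 ↔ r = 0 :=
  Algebra.norm_eq_zero_iff_of_basis (CoordinateRing.basis (W⁄k))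

lemma V_le_span (n : ℕ) : V W k n ≤ Submodule.span k
    {r | ∃ i j : ℕ, 2 * i + 3 * j ≤ n ∧ r = xR W k ^ i * yR W k ^ j} := by
  intro r hr
  obtain ⟨p, q, rfl⟩ := exists_rep r
  rw [mem_V, deg_nm_rep, max_le_iff] at hr
  have hp := (two_le_iff _ _).mp hr.1
  refine Submodule.add_mem _ ?_ ?_
  · rw [poly_x, aeval_eq_sum_range' (n := n / 2 + 1)]
    · refine Submodule.sum_mem _ fun i hi => Submodule.smul_mem _ _ (Submodule.subset_span ?_)
      refine ⟨i, 0, ?_, by simp⟩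
      have := Finset.mem_range.mp hi
      omega
    · exact Nat.lt_succ_of_le (natDegree_le_iff_degree_le.mpr hp)
  · by_cases hq0 : q = 0
    · simp [hq0]
    have hq : 2 * q.natDegree + 3 ≤ n := by
      have := hr.2
      rw [degree_eq_natDegree hq0] at this
      rw [nsmul_eq_mul] at this
      exact_mod_cast this
    rw [poly_x, aeval_eq_sum_range, Finset.sum_mul]
    refine Submodule.sum_mem _ fun i hi => ?_
    rw [smul_mul_assoc]
    refine Submodule.smul_mem _ _ (Submodule.subset_span ?_)
    refine ⟨i, 1, ?_, by simp⟩
    have := Finset.mem_range.mp hi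
    omega

instance (n : ℕ) : FiniteDimensional k (V W k n) := by
  have hf : Set.Finite {r : (W⁄k).CoordinateRing | ∃ i j : ℕ, 2 * i + 3 * j ≤ n ∧
      r = xR W k ^ i * yR W k ^ j} := by
    refine Set.Finite.subset (((Finset.range (n+1)) ×ˢ (Finset.range (n+1))).image
      (fun ij => xR W k ^ ij.1 * yR W k ^ ij.2)).finite_toSet ?_
    rintro r ⟨i, j, h, rfl⟩
    simp only [Finset.coe_image, Set.mem_image, Finset.mem_coe, Finset.mem_product, Finset.mem_range]
    exact ⟨(i, j), ⟨by simp; omega, by simp; omega⟩, rfl⟩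
  have := FiniteDimensional.span_of_finite k hf
  exact Submodule.finiteDimensional_of_le (V_le_span n)

lemma exists_mem_V (r : (W⁄k).CoordinateRing) : ∃ n, r ∈ V W k n :=
  ⟨(nm r).natDegree, degree_le_natDegree⟩

lemma V_zero {r : (W⁄k).CoordinateRing} (h : r ∈ V W k 0) : ∃ c : k, r = algebraMap k _ c := by
  have := V_le_span 0 h
  have hs : {r : (W⁄k).CoordinateRing | ∃ i j : ℕ, 2 * i + 3 * j ≤ 0 ∧
      r = xR W k ^ i * yR W k ^ j} ⊆ {1} := by
    rintro r ⟨i, j, h, rfl⟩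
    obtain rfl : i = 0 := by omega
    obtain rfl : j = 0 := by omega
    simp
  obtain ⟨c, hc⟩ := Submodule.mem_span_singleton.mp (Submodule.span_mono hs this)
  exact ⟨c, by rw [← hc, Algebra.algebraMap_eq_smul_one]⟩

/-- an element all of whose powers are bounded is constant -/
lemma const_of_pow {n : ℕ} {r : (W⁄k).CoordinateRing} (h : ∀ i, r ^ i ∈ V W k n) :
    ∃ c : k, r = algebraMap k _ c := by
  apply V_zero
  by_contra h0
  have hr : nm r ≠ 0 := by
    intro h; rw [mem_V, h] at h0; simp at h0
  have hd : 1 ≤ (nm r).natDegree := by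
    by_contra hh
    exact h0 (natDegree_le_iff_degree_le.mp (by omega))
  have := natDegree_le_iff_degree_le.mpr (h (n + 1))
  rw [nm, map_pow, natDegree_pow] at this
  change (n + 1) * (nm r).natDegree ≤ n at this
  nlinarith

/-- cancellation -/
lemma V_of_mul {m n : ℕ} {u v : (W⁄k).CoordinateRing} (hu : m ≤ (nm u).natDegree) (hu0 : u ≠ 0)
    (h : u * v ∈ V W k (n + m)) : v ∈ V W k n := by
  by_cases hv : v = 0
  · rw [hv]; exact Submodule.zero_mem _
  have := natDegree_le_iff_degree_le.mpr h
  rw [nm, map_mul, natDegree_mul (mt nm_eq_zero.mp hu0) (mt nm_eq_zero.mp hv)] at this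
  exact natDegree_le_iff_degree_le.mp (by change _ + (nm v).natDegree ≤ _ at this; omega)

lemma neg_eqn : (W⁄((W⁄k).CoordinateRing)).Equation (xR W k)
    ((W⁄((W⁄k).CoordinateRing)).negY (xR W k) (yR W k)) :=
  (equation_neg ..).mpr eqn_R

/-- conjugation -/
noncomputable def conj (W : WeierstrassCurve K) (k : Type*) [Field k] [Algebra K k] :
    (W⁄k).CoordinateRing →+* (W⁄k).CoordinateRing :=
  lift W (IsScalarTower.toAlgHom K k _) _ _ neg_eqn

lemma nm_conj (r : (W⁄k).CoordinateRing) : algebraMap k[X] _ (nm r) = r * conj W k r := by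
  obtain ⟨p, q, rfl⟩ := exists_rep r
  rw [nm_rep]
  refine (CoordinateRing.coe_norm_smul_basis (W' := W⁄k) p q).trans ?_
  have hp : ∀ p : k[X], conj W k (algebraMap k[X] _ p) = algebraMap k[X] _ p := by
    intro p
    rw [conj, lift_poly, poly_x]; rfl
  rw [map_add (conj W k), map_mul (conj W k), hp, hp, conj, lift_y, map_mul]
  have e : ∀ p : k[X], algebraMap k[X] (W⁄k).CoordinateRing p = CoordinateRing.mk (W⁄k) (C p) :=
    fun p => rfl
  have e2 : ∀ c : K, algebraMap K (W⁄k).CoordinateRing c =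
    CoordinateRing.mk (W⁄k) (C (C (algebraMap K k c))) := fun c => rfl
  rw [negY, e, e]
  simp only [bc_a₁, bc_a₃, e2, xR, yR, map_add, map_mul, map_sub, map_neg]
  ring

lemma nm_poly (p : k[X]) : nm (algebraMap k[X] (W⁄k).CoordinateRing p) = p ^ 2 := by
  rw [nm, Algebra.norm_algebraMap_of_basis (CoordinateRing.basis (W⁄k)), Fintype.card_fin]

end filt
end WP


namespace WP
set_option linter.unusedSectionVars false
open scoped Classical
open Polynomial

section ff
variable {K k : Type*} [Field K] [Field k] [IsAlgClosed k] [Algebra K k] {W : WeierstrassCurve K}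

lemma lift_injective {S : Type*} [Field S] [Algebra K S] (j : k →ₐ[K] S) (a b : S)
    (h : (W⁄S).Equation a b) (ha : ∀ c, j c ≠ a) : Function.Injective (lift W j a b h) := by
  rw [injective_iff_map_eq_zero]
  intro r hr
  by_contra h0
  have hn : nm r ≠ 0 := mt nm_eq_zero.mp h0
  have h1 : lift W j a b h (algebraMap k[X] _ (nm r)) = 0 := by
    rw [nm_conj, map_mul, hr, zero_mul]
  rw [lift_poly] at h1
  have hs := IsAlgClosed.splits (nm r)
  obtain ⟨c, hc⟩ := Splits.mem_range_of_isRoot hs hn (i := (j : k →+* S)) (x := a) (by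
    rw [IsRoot.def, eval_map]; exact h1)
  exact ha c hc

end ff

section F
variable {K k F : Type*} [Field K] [Field k] [IsAlgClosed k] [Algebra K k] {W : WeierstrassCurve K}
  [hW : Fact (W.Δ ≠ 0)]
  [Field F] [Algebra (W⁄k).CoordinateRing F] [IsFractionRing (W⁄k).CoordinateRing F]
  [Algebra k F] [IsScalarTower k (W⁄k).CoordinateRing F] [Algebra K F] [IsScalarTower K k F]

lemma towK : IsScalarTower K (W⁄k).CoordinateRing F := by
  refine IsScalarTower.of_algebraMap_eq fun c => ?_
  rw [IsScalarTower.algebraMap_apply K k F, IsScalarTower.algebraMap_apply k (W⁄k).CoordinateRing F,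
    ← IsScalarTower.algebraMap_apply K k (W⁄k).CoordinateRing]

/-- the inclusion of constants -/
noncomputable abbrev cj (K k F : Type*) [Field K] [Field k] [Field F] [Algebra K k] [Algebra k F]
  [Algebra K F] [IsScalarTower K k F] : k →ₐ[K] F := IsScalarTower.toAlgHom K k F

/-- inclusion of coordinate ring -/
noncomputable abbrev io (W : WeierstrassCurve K) (k F : Type*) [Field k] [Algebra K k] [Field F]
  [Algebra (W⁄k).CoordinateRing F] : (W⁄k).CoordinateRing →+* F :=
  algebraMap (W⁄k).CoordinateRing F

lemma io_inj : Function.Injective (io W k F) := IsFractionRing.injective _ _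

lemma io_const (c : k) : io W k F (algebraMap k _ c) = algebraMap k F c :=
  (IsScalarTower.algebraMap_apply k (W⁄k).CoordinateRing F c).symm

lemma eqn_F : (W⁄F).Equation (io W k F (xR W k)) (io W k F (yR W k)) := by
  have h := eqn_R (W := W) (k := k)
  have t := towK (W := W) (k := k) (F := F) 
  rw [equation_iff] at h ⊢
  have := congrArg (io W k F) h
  simp only [map_add, map_mul, map_pow, bc_a₁, bc_a₂, bc_a₃, bc_a₄, bc_a₆] at this ⊢
  simpa only [← IsScalarTower.algebraMap_apply K (W⁄k).CoordinateRing F] using this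

/-- the generic point -/
noncomputable def eta (W : WeierstrassCurve K) [hW : Fact (W.Δ ≠ 0)] (k F : Type*) [Field k]
  [IsAlgClosed k] [Algebra K k] [Field F] [Algebra (W⁄k).CoordinateRing F]
  [IsFractionRing (W⁄k).CoordinateRing F]
  [Algebra k F] [IsScalarTower k (W⁄k).CoordinateRing F] [Algebra K F] [IsScalarTower K k F] :
  (W⁄F).Point := Point.some _ _ (nons hW.out (eqn_F (W := W) (k := k) (F := F)))

/-- constant points -/
noncomputable abbrev cst (F : Type*) [Field F] [Algebra k F] [Algebra K F] [IsScalarTower K k F] :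
  (W⁄k).Point →+ (W⁄F).Point := Point.map (cj K k F)

lemma x_ne_const (c : k) : algebraMap k F c ≠ io W k F (xR W k) := by
  intro h
  rw [← io_const (W := W)] at h
  have h := io_inj h
  have h2 : nm (algebraMap k[X] (W⁄k).CoordinateRing (X - C c)) = 0 := by
    rw [nm_eq_zero, poly_x, map_sub, aeval_X, aeval_C, h, sub_self]
  rw [nm_poly] at h2
  exact X_sub_C_ne_zero c (pow_eq_zero_iff two_ne_zero |>.mp h2)

/-- solving for y -/
lemma y_const {S : Type*} [Field S] [Algebra K S] (j : k →ₐ[K] S) {x : k} {b : S}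
    (h : (W⁄S).Equation (j x) b) : ∃ y, b = j y ∧ (W⁄k).Equation x y := by
  have hd : (X ^ 2 + C ((W⁄k).a₁ * x + (W⁄k).a₃) * X + C (-(x ^ 3 + (W⁄k).a₂ * x ^ 2 +
      (W⁄k).a₄ * x + (W⁄k).a₆)) : k[X]).degree ≠ 0 := by
    have := degree_quadratic (one_ne_zero (α := k)) (b := ((W⁄k).a₁ * x + (W⁄k).a₃))
      (c := -(x ^ 3 + (W⁄k).a₂ * x ^ 2 + (W⁄k).a₄ * x + (W⁄k).a₆))
    rw [map_one, one_mul] at this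
    rw [this]
    decide
  obtain ⟨y, hy⟩ := IsAlgClosed.exists_root _ hd
  simp only [IsRoot.def, eval_add, eval_mul, eval_pow, eval_X, eval_C] at hy
  have hy' := congrArg j hy
  rw [equation_iff] at h
  simp only [bc_a₁, bc_a₂, bc_a₃, bc_a₄, bc_a₆, map_add, map_mul, map_neg, map_pow, map_zero, AlgHom.commutes] at hy' h
  have : (b - j y) * (b - j (-y - (W⁄k).a₁ * x - (W⁄k).a₃)) = 0 := by
    simp only [bc_a₁, bc_a₃, map_sub, map_neg, map_mul, AlgHom.commutes]
    linear_combination h - hy'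
  rcases mul_eq_zero.mp this with h1 | h1
  · refine ⟨y, sub_eq_zero.mp h1, ?_⟩
    rw [equation_iff]
    linear_combination hy
  · refine ⟨_, sub_eq_zero.mp h1, ?_⟩
    rw [equation_iff]
    linear_combination hy

lemma pt_cases (P : (W⁄F).Point) : (∃ T, P = cst (k := k) F T) ∨
    ∃ a b, ∃ h : (W⁄F).Nonsingular a b, P = Point.some a b h ∧ ∀ c : k, cj K k F c ≠ a := by
  rcases P with _ | ⟨a, b, h⟩
  · left; exact ⟨0, rfl⟩
  by_cases hc : ∃ c : k, cj K k F c = a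
  · left
    obtain ⟨c, rfl⟩ := hc
    obtain ⟨y, rfl, hy⟩ := y_const _ h.1
    exact ⟨Point.some c y (nons hW.out hy), rfl⟩
  · right
    exact ⟨a, b, h, rfl, not_exists.mp hc⟩

lemma eta_ne (T : (W⁄k).Point) : eta W k F ≠ cst F T := by
  rcases T with _ | ⟨a, b, h⟩
  · exact Point.some_ne_zero _
  · intro h
    rw [eta, cst, Point.map_some, Point.some.injEq] at h
    exact x_ne_const _ h.1.symm

lemma homF_exists (j : k →ₐ[K] F) {a b : F} (h : (W⁄F).Nonsingular a b) (ha : ∀ c, j c ≠ a) :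
    ∃ φ : F →ₐ[K] F, (∀ c, φ (algebraMap k F c) = j c) ∧
      Point.map φ (eta W k F) = Point.some a b h := by
  let φ : F →+* F := IsFractionRing.lift (lift_injective j a b h.1 ha)
  have hφ : ∀ r, φ (io W k F r) = lift W j a b h.1 r := fun r => IsFractionRing.lift_algebraMap _ r
  have hc : ∀ c, φ (algebraMap k F c) = j c := by
    intro c
    rw [← io_const (W := W), hφ, lift_const]
  refine ⟨{ φ with commutes' := ?_ }, hc, ?_⟩
  · intro r
    change φ _ = _
    rw [IsScalarTower.algebraMap_apply K k F, hc, AlgHom.commutes, ← IsScalarTower.algebraMap_apply K k F]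
  · rw [eta, Point.map_some, Point.some.injEq]
    constructor
    · change φ _ = _
      rw [hφ, lift_x]
    · change φ _ = _
      rw [hφ, lift_y]

lemma homF_ext {φ ψ : F →ₐ[K] F} (hc : ∀ c : k, φ (algebraMap k F c) = ψ (algebraMap k F c))
    (he : Point.map φ (eta W k F) = Point.map ψ (eta W k F)) : φ = ψ := by
  rw [eta, Point.map_some, Point.map_some, Point.some.injEq] at he
  have h1 : (φ : F →+* F).comp (io W k F) = (ψ : F →+* F).comp (io W k F) := by
    refine hom_ext (fun c => ?_) he.1 he.2
    rw [RingHom.comp_apply, RingHom.comp_apply, io_const]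
    exact hc c
  have h2 : (φ : F →+* F) = (ψ : F →+* F) := IsLocalization.ringHom_ext (nonZeroDivisors (W⁄k).CoordinateRing) h1
  exact AlgHom.ext fun x => DFunLike.congr_fun h2 x

lemma tau_exists (T : (W⁄k).Point) : ∃ φ : F →ₐ[K] F, (∀ c : k, φ (algebraMap k F c) = algebraMap k F c) ∧
      Point.map φ (eta W k F) = cst F T + eta W k F := by
  rcases pt_cases (k := k) (cst F T + eta W k F) with ⟨S, hS⟩ | ⟨a, b, h, he, ha⟩
  · exfalso
    apply eta_ne (F := F) (S - T)
    rw [map_sub, ← hS]; abel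
  · rw [he]
    exact homF_exists _ h ha

/-- translation -/
noncomputable def tau (F : Type*) [Field F] [Algebra (W⁄k).CoordinateRing F]
  [IsFractionRing (W⁄k).CoordinateRing F]
  [Algebra k F] [IsScalarTower k (W⁄k).CoordinateRing F] [Algebra K F] [IsScalarTower K k F]
  (T : (W⁄k).Point) : F →ₐ[K] F := (tau_exists (F := F) T).choose

lemma tau_const (T : (W⁄k).Point) (c : k) : tau F T (algebraMap k F c) = algebraMap k F c :=
  (tau_exists (F := F) T).choose_spec.1 c

lemma tau_eta (T : (W⁄k).Point) : Point.map (tau F T) (eta W k F) = cst F T + eta W k F :=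
  (tau_exists (F := F) T).choose_spec.2

lemma map_cst (φ : F →ₐ[K] F) (hφ : ∀ c : k, φ (algebraMap k F c) = algebraMap k F c) (T : (W⁄k).Point) :
    Point.map φ (cst F T) = cst F T := by
  rw [cst, Point.map_map]
  congr 1
  congr 1
  ext c
  exact hφ c

lemma tau_add (S T : (W⁄k).Point) : tau F (S + T) = (tau F S).comp (tau F T) := by
  apply homF_ext (W := W) (k := k)
  · intro c
    rw [AlgHom.comp_apply, tau_const, tau_const, tau_const]
  · rw [← Point.map_map, tau_eta, tau_eta, map_add, map_add (Point.map (tau F S)), tau_eta,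
      map_cst _ (tau_const S)]
    abel

lemma tau_zero : tau F (0 : (W⁄k).Point) = AlgHom.id K F := by
  apply homF_ext (W := W) (k := k)
  · intro c
    rw [tau_const]; rfl
  · rw [tau_eta, map_zero, zero_add]; rfl

lemma tau_add_apply (S T : (W⁄k).Point) (f : F) : tau F (S + T) f = tau F S (tau F T f) := by
  rw [tau_add]; rfl

lemma tau_inj (T : (W⁄k).Point) : Function.Injective (tau F T) := (tau F T).injective

lemma gal_exists (σ : k ≃ₐ[K] k) : ∃ φ : F →ₐ[K] F, (∀ c : k, φ (algebraMap k F c) = algebraMap k F (σ c)) ∧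
      Point.map φ (eta W k F) = eta W k F :=
  homF_exists ((cj K k F).comp (σ : k →ₐ[K] k)) _ (fun _ => x_ne_const _)

/-- semilinear Galois action fixing the generic point -/
noncomputable def gal (W : WeierstrassCurve K) [hW : Fact (W.Δ ≠ 0)] (F : Type*) [Field F] [Algebra (W⁄k).CoordinateRing F]
  [IsFractionRing (W⁄k).CoordinateRing F]
  [Algebra k F] [IsScalarTower k (W⁄k).CoordinateRing F] [Algebra K F] [IsScalarTower K k F]
  (σ : k ≃ₐ[K] k) : F →ₐ[K] F := (gal_exists (W := W) (F := F) σ).choose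

lemma gal_const (σ : k ≃ₐ[K] k) (c : k) : gal W F σ (algebraMap k F c) = algebraMap k F (σ c) :=
  (gal_exists (W := W) (F := F) σ).choose_spec.1 c

lemma gal_eta (σ : k ≃ₐ[K] k) : Point.map (gal W F σ) (eta W k F) = eta W k F :=
  (gal_exists (W := W) (F := F) σ).choose_spec.2

lemma gal_x (σ : k ≃ₐ[K] k) : gal W F σ (io W k F (xR W k)) = io W k F (xR W k) := by
  have := gal_eta (F := F) (W := W) σ
  rw [eta, Point.map_some, Point.some.injEq] at this
  exact this.1

lemma gal_y (σ : k ≃ₐ[K] k) : gal W F σ (io W k F (yR W k)) = io W k F (yR W k) := by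
  have := gal_eta (F := F) (W := W) σ
  rw [eta, Point.map_some, Point.some.injEq] at this
  exact this.2

lemma gal_tau (σ : k ≃ₐ[K] k) (T : (W⁄k).Point) (f : F) : gal W F σ (tau F T f) =
    tau F (Point.map (σ : k →ₐ[K] k) T) (gal W F σ f) := by
  have : (gal W F σ).comp (tau F T) = (tau F (Point.map (σ : k →ₐ[K] k) T)).comp (gal W F σ) := by
    apply homF_ext (W := W) (k := k)
    · intro c
      rw [AlgHom.comp_apply, AlgHom.comp_apply, tau_const, gal_const, tau_const]
    · rw [← Point.map_map, ← Point.map_map, gal_eta, tau_eta, tau_eta, map_add, gal_eta, cst,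
        Point.map_map, Point.map_map]
      congr 2
      congr 1
      ext c
      exact gal_const (W := W) σ c
  exact DFunLike.congr_fun this f

lemma gal_symm (σ : k ≃ₐ[K] k) (f : F) : gal W F σ (gal W F σ.symm f) = f := by
  have : (gal W F σ).comp (gal W F σ.symm) = AlgHom.id K F := by
    apply homF_ext (W := W) (k := k)
    · intro c
      rw [AlgHom.comp_apply, gal_const, gal_const, AlgEquiv.apply_symm_apply]; rfl
    · rw [← Point.map_map, gal_eta, gal_eta]; rfl
  exact DFunLike.congr_fun this f

/-- image of V in F -/
noncomputable def VF (W : WeierstrassCurve K) (k : Type*) [Field k] [Algebra K k] (F : Type*) [Field F]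
  [Algebra (W⁄k).CoordinateRing F] [Algebra k F]
  [IsScalarTower k (W⁄k).CoordinateRing F] (n : ℕ) : Submodule k F :=
  (V W k n).map (IsScalarTower.toAlgHom k (W⁄k).CoordinateRing F).toLinearMap

lemma mem_VF {n : ℕ} {f : F} : f ∈ VF W k F n ↔ ∃ r ∈ V W k n, io W k F r = f := Iff.rfl

lemma gal_VF (σ : k ≃ₐ[K] k) {n : ℕ} {f : F} (hf : f ∈ VF W k F n) : gal W F σ f ∈ VF W k F n := by
  obtain ⟨r, hr, rfl⟩ := mem_VF.mp hf
  have := V_le_span n hr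
  clear hr hf
  induction this using Submodule.span_induction with
  | zero => rw [map_zero, map_zero]; exact Submodule.zero_mem _
  | mem r h =>
    obtain ⟨i, j, h, rfl⟩ := h
    rw [map_mul, map_mul, map_pow, map_pow, map_pow, map_pow, gal_x, gal_y]
    refine mem_VF.mpr ⟨xR W k ^ i * yR W k ^ j, ?_, by rw [map_mul, map_pow, map_pow]⟩
    exact V_mono h (V_mul (V_pow x_mem_V) (V_pow y_mem_V))
  | add a b _ _ ha hb => rw [map_add, map_add]; exact Submodule.add_mem _ ha hb
  | smul c a _ ha =>
    rw [Algebra.smul_def, map_mul, map_mul, io_const, gal_const, ← Algebra.smul_def]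
    exact Submodule.smul_mem _ _ ha

end F
end WP


namespace WP
set_option linter.unusedSectionVars false
open scoped Classical
open Polynomial

/-- numerator of x-coordinate of sum -/
def fA {S : Type*} [CommRing S] (a1 a2 x1 y1 x y : S) : S :=
  (y - y1) ^ 2 + a1 * (y - y1) * (x - x1) - (a2 + x1 + x) * (x - x1) ^ 2

/-- numerator of y-coordinate of sum -/
def fB {S : Type*} [CommRing S] (a1 a2 a3 x1 y1 x y : S) : S :=
  -((y - y1) * (fA a1 a2 x1 y1 x y - x1 * (x - x1) ^ 2) + y1 * (x - x1) ^ 3)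
    - a1 * fA a1 a2 x1 y1 x y * (x - x1) - a3 * (x - x1) ^ 3

lemma map_fA {S S' : Type*} [CommRing S] [CommRing S'] (f : S →+* S') (a1 a2 x1 y1 x y : S) :
    f (fA a1 a2 x1 y1 x y) = fA (f a1) (f a2) (f x1) (f y1) (f x) (f y) := by
  simp only [fA, map_add, map_sub, map_mul, map_pow]

lemma map_fB {S S' : Type*} [CommRing S] [CommRing S'] (f : S →+* S') (a1 a2 a3 x1 y1 x y : S) :
    f (fB a1 a2 a3 x1 y1 x y) = fB (f a1) (f a2) (f a3) (f x1) (f y1) (f x) (f y) := by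
  simp only [fB, map_fA, map_add, map_sub, map_mul, map_pow, map_neg]

lemma add_formula {S : Type*} [Field S] {W : Affine S} {x1 y1 x y a b : S} (h1 : W.Nonsingular x1 y1)
    (h : W.Nonsingular x y) (h' : W.Nonsingular a b) (hx : x1 ≠ x)
    (hs : Point.some _ _ h1 + Point.some _ _ h = Point.some _ _ h') :
    fA W.a₁ W.a₂ x1 y1 x y = (x - x1) ^ 2 * a ∧ fB W.a₁ W.a₂ W.a₃ x1 y1 x y = (x - x1) ^ 3 * b := by
  rw [Point.add_of_X_ne hx, Point.some.injEq] at hs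
  obtain ⟨rfl, rfl⟩ := hs
  have h0 : x - x1 ≠ 0 := sub_ne_zero.mpr hx.symm
  have hl : W.slope x1 x y1 y * (x - x1) = y - y1 := by
    have h0' : x1 - x ≠ 0 := sub_ne_zero.mpr hx
    rw [slope_of_X_ne hx]
    field_simp
    ring
  have e1 : fA W.a₁ W.a₂ x1 y1 x y = (x - x1) ^ 2 * W.addX x1 x (W.slope x1 x y1 y) := by
    rw [fA, addX, ← hl]; ring
  refine ⟨e1, ?_⟩
  rw [fB, e1, addY, negY, negAddY, ← hl]
  ring

section F
variable {K k F : Type*} [Field K] [Field k] [IsAlgClosed k] [Algebra K k] {W : WeierstrassCurve K}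
  [hW : Fact (W.Δ ≠ 0)]
  [Field F] [Algebra (W⁄k).CoordinateRing F] [IsFractionRing (W⁄k).CoordinateRing F]
  [Algebra k F] [IsScalarTower k (W⁄k).CoordinateRing F] [Algebra K F] [IsScalarTower K k F]

local notation "al" => algebraMap k (CoordinateRing (W⁄k))
local notation "aK" => algebraMap K (CoordinateRing (W⁄k))

/-- the function x - a -/
noncomputable def Dx (W : WeierstrassCurve K) {k : Type*} [Field k] [Algebra K k] (a : k) :
    (W⁄k).CoordinateRing := xR W k - algebraMap k _ a
/-- the function y - b -/
noncomputable def Ny (W : WeierstrassCurve K) {k : Type*} [Field k] [Algebra K k] (b : k) :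
    (W⁄k).CoordinateRing := yR W k - algebraMap k _ b
/-- the maximal ideal -/
noncomputable abbrev mI (W : WeierstrassCurve K) {k : Type*} [Field k] [Algebra K k] (a b : k) :
    Ideal (W⁄k).CoordinateRing := CoordinateRing.XYIdeal (W⁄k) a (C b)

lemma XClass_eq (a : k) : CoordinateRing.XClass (W⁄k) a = Dx W a := by
  rw [CoordinateRing.XClass, Dx, xR, C_sub, map_sub]; rfl

lemma YClass_eq (b : k) : CoordinateRing.YClass (W⁄k) (C b) = Ny W b := by
  rw [CoordinateRing.YClass, Ny, yR, map_sub]; rfl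

lemma mI_eq (a b : k) : mI W a b = Ideal.span {Dx W a, Ny W b} := by
  rw [mI, CoordinateRing.XYIdeal, XClass_eq, YClass_eq]

lemma Dx_mem (a b : k) : Dx W a ∈ mI W a b := by
  rw [mI_eq]; exact Ideal.subset_span (by simp)

lemma Ny_mem (a b : k) : Ny W b ∈ mI W a b := by
  rw [mI_eq]; exact Ideal.subset_span (by simp)

lemma Dx_V (a : k) : Dx W a ∈ V W k 2 := Submodule.sub_mem _ x_mem_V (const_mem_V _ _)
lemma Ny_V (a : k) : Ny W a ∈ V W k 3 := Submodule.sub_mem _ y_mem_V (const_mem_V _ _)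

lemma Dx_ne (a : k) : Dx W a ≠ 0 := by
  rw [← XClass_eq]; exact CoordinateRing.XClass_ne_zero a

/-- A in the coordinate ring -/
noncomputable def RA (W : WeierstrassCurve K) {k : Type*} [Field k] [Algebra K k] (a b : k) :
    (W⁄k).CoordinateRing := fA (algebraMap K _ W.a₁) (algebraMap K _ W.a₂) (algebraMap k _ a)
      (algebraMap k _ b) (xR W k) (yR W k)
/-- B in the coordinate ring -/
noncomputable def RB (W : WeierstrassCurve K) {k : Type*} [Field k] [Algebra K k] (a b : k) :
    (W⁄k).CoordinateRing := fB (algebraMap K _ W.a₁) (algebraMap K _ W.a₂) (algebraMap K _ W.a₃)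
      (algebraMap k _ a) (algebraMap k _ b) (xR W k) (yR W k)

lemma RA_def (a b : k) : RA W a b = Ny W b ^ 2 + aK W.a₁ * Ny W b * Dx W a -
    (aK W.a₂ + al a + xR W k) * Dx W a ^ 2 := rfl
lemma RB_def (a b : k) : RB W a b = -(Ny W b * (RA W a b - al a * Dx W a ^ 2) + al b * Dx W a ^ 3)
    - aK W.a₁ * RA W a b * Dx W a - aK W.a₃ * Dx W a ^ 3 := rfl

lemma RA_mem (a b : k) : RA W a b ∈ mI W a b ^ 2 := by
  rw [RA_def]
  refine Ideal.sub_mem _ (Ideal.add_mem _ (Ideal.pow_mem_pow (Ny_mem a b) 2) ?_)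
    (Ideal.mul_mem_left _ _ (Ideal.pow_mem_pow (Dx_mem a b) 2))
  rw [mul_assoc, pow_two]
  exact Ideal.mul_mem_left _ _ (Ideal.mul_mem_mul (Ny_mem a b) (Dx_mem a b))

lemma RB_mem (a b : k) : RB W a b ∈ mI W a b ^ 3 := by
  rw [RB_def]
  have h3 : Dx W a ^ 3 ∈ mI W a b ^ 3 := Ideal.pow_mem_pow (Dx_mem a b) 3
  refine Ideal.sub_mem _ (Ideal.sub_mem _ (Ideal.neg_mem_iff _ |>.mpr (Ideal.add_mem _ ?_ ?_)) ?_) ?_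
  · rw [pow_succ']
    refine Ideal.mul_mem_mul (Ny_mem a b) (Ideal.sub_mem _ (RA_mem a b)
      (Ideal.mul_mem_left _ _ (Ideal.pow_mem_pow (Dx_mem a b) 2)))
  · exact Ideal.mul_mem_left _ _ h3
  · rw [pow_succ, mul_assoc]
    exact Ideal.mul_mem_left _ _ (Ideal.mul_mem_mul (RA_mem a b) (Dx_mem a b))
  · exact Ideal.mul_mem_left _ _ h3

lemma aK_mul_V {n : ℕ} (c : K) {r : (W⁄k).CoordinateRing} (h : r ∈ V W k n) : aK c * r ∈ V W k n := by
  rw [IsScalarTower.algebraMap_apply K k (W⁄k).CoordinateRing, ← Algebra.smul_def]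
  exact Submodule.smul_mem _ _ h

lemma al_mul_V {n : ℕ} (c : k) {r : (W⁄k).CoordinateRing} (h : r ∈ V W k n) : al c * r ∈ V W k n := by
  rw [← Algebra.smul_def]
  exact Submodule.smul_mem _ _ h

lemma RA_V3 (a b : k) : RA W a b - al a * Dx W a ^ 2 ∈ V W k 3 := by
  have h := eqn_R (W := W) (k := k)
  rw [equation_iff] at h
  simp only [bc_a₁, bc_a₂, bc_a₃, bc_a₄, bc_a₆] at h
  have e : RA W a b - al a * Dx W a ^ 2 =
      al (-(algebraMap K k W.a₃ + 2 * b + algebraMap K k W.a₁ * a)) * yR W k +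
      al (algebraMap K k W.a₄ - algebraMap K k W.a₁ * b + 2 * a * (algebraMap K k W.a₂ + 2 * a) - a ^ 2)
        * xR W k +
      al (algebraMap K k W.a₆ + b ^ 2 + algebraMap K k W.a₁ * a * b - a ^ 2 * (algebraMap K k W.a₂ + 2 * a)) := by
    simp only [map_add, map_sub, map_neg, map_mul, map_pow, map_ofNat,
      ← IsScalarTower.algebraMap_apply K k (W⁄k).CoordinateRing]
    rw [RA_def, Dx, Ny]
    linear_combination h
  rw [e]
  refine Submodule.add_mem _ (Submodule.add_mem _ ?_ ?_) (const_mem_V _ _)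
  · exact al_mul_V _ y_mem_V
  · exact al_mul_V _ (V_mono (by norm_num) x_mem_V)

lemma RA_V (a b : k) : RA W a b ∈ V W k 4 := by
  have h1 := V_mono (show 3 ≤ 4 by norm_num) (RA_V3 (W := W) a b)
  have h2 : al a * Dx W a ^ 2 ∈ V W k 4 := al_mul_V _ (V_pow (i := 2) (Dx_V a))
  have := Submodule.add_mem _ h1 h2
  rwa [sub_add_cancel] at this

lemma RB_V (a b : k) : RB W a b ∈ V W k 6 := by
  rw [RB_def]
  have h3 : Dx W a ^ 3 ∈ V W k 6 := V_pow (i := 3) (Dx_V a)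
  refine Submodule.sub_mem _ (Submodule.sub_mem _ (Submodule.neg_mem _ (Submodule.add_mem _ ?_ ?_)) ?_) ?_
  · exact V_mul (Ny_V b) (RA_V3 a b)
  · exact al_mul_V _ h3
  · rw [mul_assoc]
    exact aK_mul_V _ (V_mul (RA_V a b) (Dx_V a))
  · exact aK_mul_V _ h3

/-- evaluation at a point -/
noncomputable def ev (W : WeierstrassCurve K) {k : Type*} [Field k] [Algebra K k] {a b : k}
    (h : (W⁄k).Nonsingular a b) : (W⁄k).CoordinateRing →+* k := lift W (AlgHom.id K k) a b h.1

lemma ev_x {a b : k} (h : (W⁄k).Nonsingular a b) : ev W h (xR W k) = a := lift_x ..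
lemma ev_y {a b : k} (h : (W⁄k).Nonsingular a b) : ev W h (yR W k) = b := lift_y ..
lemma ev_c {a b : k} (h : (W⁄k).Nonsingular a b) (c : k) : ev W h (al c) = c := lift_const ..
lemma ev_cK {a b : k} (h : (W⁄k).Nonsingular a b) (c : K) : ev W h (aK c) = algebraMap K k c := by
  rw [IsScalarTower.algebraMap_apply K k (W⁄k).CoordinateRing, ev_c]
lemma ev_D {a b : k} (h : (W⁄k).Nonsingular a b) (c : k) : ev W h (Dx W c) = a - c := by
  rw [Dx, map_sub, ev_x, ev_c]

lemma ev_poly {a b : k} (h : (W⁄k).Nonsingular a b) (q : k[X]) : 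
    ev W h (algebraMap k[X] _ q) = q.eval a := by
  rw [ev, lift_poly, eval, RingHom.id]; rfl

lemma io_D (a : k) : io W k F (Dx W a) = io W k F (xR W k) - algebraMap k F a := by
  rw [Dx, map_sub, io_const]

lemma D_n (a : k) : io W k F (Dx W a) ≠ 0 := by
  rw [Ne, map_eq_zero_iff _ io_inj]; exact Dx_ne a

lemma io_K (c : K) : io W k F (aK c) = algebraMap K F c := by
  rw [IsScalarTower.algebraMap_apply K k (W⁄k).CoordinateRing, io_const, ← IsScalarTower.algebraMap_apply K k F]

lemma tau_xy {a b : k} (h : (W⁄k).Nonsingular a b) :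
    io W k F (RA W a b) = io W k F (Dx W a) ^ 2 * tau F (Point.some _ _ h) (io W k F (xR W k)) ∧
    io W k F (RB W a b) = io W k F (Dx W a) ^ 3 * tau F (Point.some _ _ h) (io W k F (yR W k)) := by
  have := tau_eta (F := F) (Point.some _ _ h)
  rw [eta, cst, Point.map_some, Point.map_some] at this
  have h2 := add_formula _ _ _ (x_ne_const (W := W) a) this.symm
  rw [RA, RB, map_fA, map_fB, io_D]
  simp only [io_const, io_K]
  exact h2

lemma ev_AB {a b a1 b1 a2 b2 : k} (h : (W⁄k).Nonsingular a b) (h1 : (W⁄k).Nonsingular a1 b1)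
    (h2 : (W⁄k).Nonsingular a2 b2) (hx : a1 ≠ a)
    (hs : Point.some _ _ h + Point.some _ _ h1 = Point.some _ _ h2) :
    ev W h1 (RA W a b) = (a1 - a) ^ 2 * a2 ∧ ev W h1 (RB W a b) = (a1 - a) ^ 3 * b2 := by
  have := add_formula _ _ _ hx.symm hs
  rw [RA, RB, map_fA, map_fB]
  simp only [ev_c, ev_cK, ev_x, ev_y]
  exact this

lemma key_mono {a b : k} (h : (W⁄k).Nonsingular a b) {n : ℕ} {r : (W⁄k).CoordinateRing}
    (hr : r ∈ V W k n) : ∃ G : (W⁄k).CoordinateRing, G ∈ mI W a b ^ n ∧ G ∈ V W k (2 * n) ∧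
      io W k F G = io W k F (Dx W a) ^ n * tau F (Point.some _ _ h) (io W k F r) ∧
      ∀ (a1 b1 a2 b2 : k) (h1 : (W⁄k).Nonsingular a1 b1) (h2 : (W⁄k).Nonsingular a2 b2), a1 ≠ a →
        Point.some _ _ h + Point.some _ _ h1 = Point.some _ _ h2 →
        ev W h1 G = (a1 - a) ^ n * ev W h2 r := by
  have := V_le_span n hr
  clear hr
  induction this using Submodule.span_induction with
  | zero => exact ⟨0, Ideal.zero_mem _, Submodule.zero_mem _, by simp, by simp⟩
  | mem r hr =>
    obtain ⟨i, j, hij, rfl⟩ := hr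
    obtain ⟨m, rfl⟩ := Nat.exists_eq_add_of_le hij
    refine ⟨RA W a b ^ i * RB W a b ^ j * Dx W a ^ m, ?_, ?_, ?_, ?_⟩
    · rw [pow_add, pow_add, pow_mul, pow_mul]
      exact Ideal.mul_mem_mul (Ideal.mul_mem_mul (Ideal.pow_mem_pow (RA_mem a b) i)
        (Ideal.pow_mem_pow (RB_mem a b) j)) (Ideal.pow_mem_pow (Dx_mem a b) m)
    · have := V_mul (V_mul (V_pow (i := i) (RA_V (W := W) a b)) (V_pow (i := j) (RB_V (W := W) a b)))
        (V_pow (i := m) (Dx_V (W := W) a))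
      exact V_mono (by omega) this
    · simp only [map_mul, map_pow, (tau_xy h).1, (tau_xy h).2]
      ring
    · intro a1 b1 a2 b2 h1 h2 hx hs
      simp only [map_mul, map_pow, (ev_AB h h1 h2 hx hs).1, (ev_AB h h1 h2 hx hs).2, ev_x, ev_y, ev_D, mul_pow]
      generalize a1 - a = d
      ring
  | add r s _ _ hr hs =>
    obtain ⟨G, h1, h2, h3, h4⟩ := hr
    obtain ⟨G', h1', h2', h3', h4'⟩ := hs
    refine ⟨G + G', Ideal.add_mem _ h1 h1', Submodule.add_mem _ h2 h2', ?_, ?_⟩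
    · rw [map_add, h3, h3', map_add, map_add]; ring
    · intro a1 b1 a2 b2 H1 H2 hx hs
      rw [map_add, h4 _ _ _ _ H1 H2 hx hs, h4' _ _ _ _ H1 H2 hx hs, map_add]; ring
  | smul c r _ hr =>
    obtain ⟨G, h1, h2, h3, h4⟩ := hr
    refine ⟨c • G, ?_, Submodule.smul_mem _ _ h2, ?_, ?_⟩
    · rw [Algebra.smul_def]; exact Ideal.mul_mem_left _ _ h1
    · simp only [Algebra.smul_def, map_mul, io_const, tau_const, h3]; ring
    · intro a1 b1 a2 b2 H1 H2 hx hs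
      simp only [Algebra.smul_def, map_mul, ev_c, h4 _ _ _ _ H1 H2 hx hs]; ring

lemma conj_x : conj W k (xR W k) = xR W k := lift_x ..
lemma conj_c (c : k) : conj W k (al c) = al c := lift_const ..

lemma conj_mI {a b : k} {r : (W⁄k).CoordinateRing} (hr : r ∈ mI W a b) :
    conj W k r ∈ mI W a ((W⁄k).negY a b) := by
  suffices h : mI W a b ≤ (mI W a ((W⁄k).negY a b)).comap (conj W k) from h hr
  rw [mI_eq, Ideal.span_le]
  rintro _ (rfl | rfl)
  · change conj W k (Dx W a) ∈ mI W a ((W⁄k).negY a b)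
    rw [Dx, map_sub, conj_x, conj_c]
    exact Dx_mem _ _
  · change conj W k (Ny W b) ∈ mI W a ((W⁄k).negY a b)
    have : conj W k (Ny W b) = - Ny W ((W⁄k).negY a b) - aK W.a₁ * Dx W a := by
      rw [Ny, map_sub, conj_c, conj, lift_y, negY, negY, Ny, Dx]
      simp only [bc_a₁, bc_a₃, map_sub, map_neg, map_mul,
        ← IsScalarTower.algebraMap_apply K k (W⁄k).CoordinateRing]
      ring
    rw [this]
    exact Ideal.sub_mem _ (Ideal.neg_mem_iff _ |>.mpr (Ny_mem _ _)) (Ideal.mul_mem_left _ _ (Dx_mem _ _))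

lemma conj_mI_pow {a b : k} {r : (W⁄k).CoordinateRing} {n : ℕ} (hr : r ∈ mI W a b ^ n) :
    conj W k r ∈ mI W a ((W⁄k).negY a b) ^ n := by
  have h1 : (mI W a b ^ n).map (conj W k) ≤ mI W a ((W⁄k).negY a b) ^ n := by
    rw [Ideal.map_pow]
    refine Ideal.pow_right_mono ?_ n
    rw [Ideal.map_le_iff_le_comap]
    intro r hr
    exact conj_mI hr
  exact h1 (Ideal.mem_map_of_mem _ hr)

lemma exists_u {a b : k} (h : (W⁄k).Nonsingular a b) {p : ℕ} (hp : p • Point.some _ _ h = 0) :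
    ∃ u : (W⁄k).CoordinateRing, u ≠ 0 ∧ mI W a b ^ p = Ideal.span {u} ∧ u ∣ Dx W a ^ p ∧
      p ≤ (nm u).natDegree := by
  have h1 := congrArg Point.toClass hp
  rw [map_nsmul, map_zero, Point.toClass_some] at h1
  have h2 : ClassGroup.mk (W⁄k).FunctionField (CoordinateRing.XYIdeal' h ^ p) = 1 := by
    rw [map_pow]; exact h1
  rw [ClassGroup.mk_eq_one_of_coe_ideal (I' := mI W a b ^ p)] at h2
  · obtain ⟨u, hu0, hu⟩ := h2
    have hD : u ∣ Dx W a ^ p := by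
      rw [← Ideal.mem_span_singleton, ← hu]
      exact Ideal.pow_mem_pow (Dx_mem a b) p
    refine ⟨u, hu0, hu, hD, ?_⟩
    have hum : u ∈ mI W a b ^ p := by rw [hu]; exact Ideal.mem_span_singleton_self u
    have h3 : algebraMap k[X] _ (nm u) ∈ Ideal.span {Dx W a ^ p} := by
      have e : mI W a ((W⁄k).negY a b) * mI W a b = Ideal.span {Dx W a} := by
        rw [mI, mI, CoordinateRing.XYIdeal_neg_mul h, CoordinateRing.XIdeal, XClass_eq]
      rw [nm_conj, ← Ideal.span_singleton_pow, ← e, mul_pow, mul_comm u]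
      exact Ideal.mul_mem_mul (conj_mI_pow hum) hum
    obtain ⟨s, hs⟩ := Ideal.mem_span_singleton.mp h3
    have h4 := congrArg nm hs
    have eD : Dx W a = algebraMap k[X] _ (X - C a) := by
      rw [poly_x, map_sub, aeval_X, aeval_C]; rfl
    have e2 : nm (Dx W a ^ p * s) = ((X - C a) ^ p) ^ 2 * nm s := by
      rw [eD, ← map_pow, nm, map_mul]
      congr 1
      exact nm_poly _
    rw [nm_poly, e2] at h4
    have hun : nm u ≠ 0 := mt nm_eq_zero.mp hu0
    have hsn : nm s ≠ 0 := by
      rintro h; rw [h, mul_zero] at h4; exact hun (pow_eq_zero_iff two_ne_zero |>.mp h4)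
    have h5 := congrArg natDegree h4
    rw [natDegree_pow, natDegree_mul (pow_ne_zero _ (pow_ne_zero _ (X_sub_C_ne_zero a))) hsn,
      natDegree_pow, natDegree_pow, natDegree_X_sub_C] at h5
    omega
  · rw [Units.val_pow_eq_pow_val, CoordinateRing.XYIdeal'_eq, FractionalIdeal.coeIdeal_pow]

end F
end WP


namespace WP
set_option linter.unusedSectionVars false
open scoped Classical
open Polynomial

section F
variable {K k F : Type*} [Field K] [Field k] [IsAlgClosed k] [Algebra K k] {W : WeierstrassCurve K}
  [hW : Fact (W.Δ ≠ 0)]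
  [Field F] [Algebra (W⁄k).CoordinateRing F] [IsFractionRing (W⁄k).CoordinateRing F]
  [Algebra k F] [IsScalarTower k (W⁄k).CoordinateRing F] [Algebra K F] [IsScalarTower K k F]
  {p : ℕ}

/-- theta functions -/
def Theta (p : ℕ) (T : (W⁄k).Point) (f : F) : Prop :=
  f ≠ 0 ∧ ∀ v ∈ VF W k F p, f * tau F T v ∈ VF W k F p

lemma exists_theta_some {a b : k} (h : (W⁄k).Nonsingular a b) (hp : p • Point.some _ _ h = 0) :
    ∃ (u : (W⁄k).CoordinateRing) (f : F), u ≠ 0 ∧ u ∣ Dx W a ^ p ∧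
      f * io W k F u = io W k F (Dx W a) ^ p ∧ Theta p (Point.some _ _ h) f := by
  obtain ⟨u, hu0, hu, hD, hd⟩ := exists_u h hp
  have hu1 : io W k F u ≠ 0 := by rw [Ne, map_eq_zero_iff _ io_inj]; exact hu0
  refine ⟨u, io W k F (Dx W a) ^ p / io W k F u, hu0, hD, div_mul_cancel₀ _ hu1,
    div_ne_zero (pow_ne_zero _ (D_n a)) hu1, ?_⟩
  intro v hv
  obtain ⟨r, hr, rfl⟩ := mem_VF.mp hv
  obtain ⟨G, hG1, hG2, hG3, -⟩ := key_mono (F := F) h hr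
  rw [hu, Ideal.mem_span_singleton] at hG1
  obtain ⟨w, rfl⟩ := hG1
  refine mem_VF.mpr ⟨w, ?_, ?_⟩
  · apply V_of_mul hd hu0
    rwa [two_mul] at hG2
  · rw [div_mul_eq_mul_div, ← hG3, map_mul, mul_div_cancel_left₀ _ hu1]

lemma theta_one : Theta p (0 : (W⁄k).Point) (1 : F) := by
  refine ⟨one_ne_zero, fun v hv => ?_⟩
  rwa [tau_zero, one_mul]

lemma exists_theta {T : (W⁄k).Point} (hp : p • T = 0) : ∃ f : F, Theta p T f := by
  rcases T with _ | ⟨a, b, h⟩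
  · exact ⟨1, theta_one⟩
  · obtain ⟨u, f, -, -, -, hf⟩ := exists_theta_some (F := F) h hp
    exact ⟨f, hf⟩

lemma tau_ne {T : (W⁄k).Point} {f : F} (hf : f ≠ 0) : tau F T f ≠ 0 := by
  rw [Ne, map_eq_zero_iff _ (tau_inj T)]; exact hf

lemma theta_mul {S T : (W⁄k).Point} {f g : F} (hf : Theta p S f) (hg : Theta p T g) :
    Theta p (S + T) (f * tau F S g) := by
  refine ⟨mul_ne_zero hf.1 (tau_ne hg.1), fun v hv => ?_⟩
  rw [tau_add_apply, mul_assoc, ← map_mul]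
  exact hf.2 _ (hg.2 _ hv)

lemma one_mem_VF (n : ℕ) : (1 : F) ∈ VF W k F n := mem_VF.mpr ⟨1, one_mem_V n, map_one _⟩

lemma theta_const {w : F} (hw : Theta p (0 : (W⁄k).Point) w) : ∃ c : k, c ≠ 0 ∧ w = algebraMap k F c := by
  have h1 : ∀ i, w ^ i ∈ VF W k F p := by
    intro i
    induction i with
    | zero => rw [pow_zero]; exact one_mem_VF p
    | succ i ih =>
      have := hw.2 _ ih
      rw [tau_zero] at this
      rw [pow_succ']
      exact this
  have h2 := h1 1
  rw [pow_one] at h2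
  obtain ⟨r, hr, rfl⟩ := mem_VF.mp h2
  obtain ⟨c, rfl⟩ := const_of_pow (n := p) (r := r) (by
    intro i
    obtain ⟨s, hs, he⟩ := mem_VF.mp (h1 i)
    rw [← map_pow] at he
    rw [← io_inj he]; exact hs)
  refine ⟨c, ?_, io_const c⟩
  rintro rfl
  exact hw.1 (by rw [map_zero, map_zero])

lemma theta_unique {T : (W⁄k).Point} (hp : p • T = 0) {f g : F} (hf : Theta p T f) (hg : Theta p T g) :
    ∃ c : k, c ≠ 0 ∧ f = algebraMap k F c * g := by
  obtain ⟨h, hh⟩ := exists_theta (F := F) (T := -T) (p := p) (by rw [smul_neg, hp, neg_zero])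
  have h1 := theta_mul hf hh
  have h2 := theta_mul hg hh
  rw [add_neg_cancel] at h1 h2
  obtain ⟨c, hc, e1⟩ := theta_const h1
  obtain ⟨d, hd, e2⟩ := theta_const h2
  have h0 := tau_ne (T := T) hh.1
  have hd' : algebraMap k F d ≠ 0 := by simpa using hd
  refine ⟨c / d, div_ne_zero hc hd, ?_⟩
  rw [map_div₀]
  field_simp
  apply mul_right_cancel₀ h0
  linear_combination (algebraMap k F d) * e1 - (algebraMap k F c) * e2

/-- the Weil pairing as a relation -/
def E (F : Type*) [Field F] [Algebra (W⁄k).CoordinateRing F] [IsFractionRing (W⁄k).CoordinateRing F]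
  [Algebra k F] [IsScalarTower k (W⁄k).CoordinateRing F] [Algebra K F] [IsScalarTower K k F]
  (p : ℕ) (S T : (W⁄k).Point) (ζ : k) : Prop :=
  p • S = 0 ∧ p • T = 0 ∧ ∃ f g : F, Theta p S f ∧ Theta p T g ∧
    f * tau F S g = algebraMap k F ζ * (g * tau F T f)

lemma E_exists {S T : (W⁄k).Point} (hS : p • S = 0) (hT : p • T = 0) : ∃ ζ, E F p S T ζ := by
  obtain ⟨f, hf⟩ := exists_theta (F := F) hS
  obtain ⟨g, hg⟩ := exists_theta (F := F) hT
  have h1 := theta_mul hf hg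
  have h2 := theta_mul hg hf
  rw [add_comm] at h2
  obtain ⟨c, -, h⟩ := theta_unique (by rw [smul_add, hS, hT, add_zero]) h1 h2
  exact ⟨c, hS, hT, f, g, hf, hg, h⟩

lemma E_all {S T : (W⁄k).Point} {ζ : k} (h : E F p S T ζ) {f g : F} (hf : Theta p S f)
    (hg : Theta p T g) : f * tau F S g = algebraMap k F ζ * (g * tau F T f) := by
  obtain ⟨hS, hT, f', g', hf', hg', h⟩ := h
  obtain ⟨c, hc, rfl⟩ := theta_unique hS hf hf'
  obtain ⟨d, hd, rfl⟩ := theta_unique hT hg hg'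
  rw [map_mul, map_mul, tau_const, tau_const]
  linear_combination (algebraMap k F c) * (algebraMap k F d) * h

lemma E_unique {S T : (W⁄k).Point} {ζ ξ : k} (h : E F p S T ζ) (h' : E F p S T ξ) : ζ = ξ := by
  have h2 := h'
  obtain ⟨hS, hT, f', g', hf', hg', h'⟩ := h'
  have h1 := E_all h hf' hg'
  have := mul_right_cancel₀ (mul_ne_zero hg'.1 (tau_ne hf'.1)) (h1.symm.trans h')
  exact (algebraMap k F).injective this

lemma E_ne {S T : (W⁄k).Point} {ζ : k} (h : E F p S T ζ) : ζ ≠ 0 := by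
  rintro rfl
  obtain ⟨hS, hT, f', g', hf', hg', h'⟩ := h
  rw [map_zero, zero_mul] at h'
  exact mul_ne_zero hf'.1 (tau_ne hg'.1) h'

lemma E_self {S : (W⁄k).Point} (hS : p • S = 0) : E F p S S 1 := by
  obtain ⟨f, hf⟩ := exists_theta (F := F) hS
  exact ⟨hS, hS, f, f, hf, hf, by rw [map_one, one_mul]⟩

lemma E_swap {S T : (W⁄k).Point} {ζ : k} (h : E F p S T ζ) : E F p T S ζ⁻¹ := by
  have h0 := E_ne h
  obtain ⟨hS, hT, f, g, hf, hg, h⟩ := h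
  have h0' : algebraMap k F ζ ≠ 0 := by simpa using h0
  refine ⟨hT, hS, g, f, hg, hf, ?_⟩
  rw [h, map_inv₀, inv_mul_cancel_left₀ h0']

lemma E_zero {S : (W⁄k).Point} (hS : p • S = 0) : E F p S 0 1 := by
  obtain ⟨f, hf⟩ := exists_theta (F := F) hS
  refine ⟨hS, smul_zero _, f, 1, hf, theta_one, ?_⟩
  rw [map_one, map_one, tau_zero, mul_one, one_mul, one_mul]; rfl

lemma E_add {S T T' : (W⁄k).Point} {ζ ζ' : k} (h : E F p S T ζ) (h' : E F p S T' ζ') :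
    E F p S (T + T') (ζ * ζ') := by
  have H' := h'
  obtain ⟨hS, hT, f, g, hf, hg, h⟩ := h
  obtain ⟨-, hT', f', g', -, hg', -⟩ := h'
  have h' := E_all H' hf hg'
  refine ⟨hS, by rw [smul_add, hT, hT', add_zero], f, g * tau F T g', hf, theta_mul hg hg', ?_⟩
  have h2 := congrArg (tau F T) h'
  rw [map_mul, map_mul, map_mul, tau_const, ← tau_add_apply, ← tau_add_apply] at h2
  rw [map_mul, ← tau_add_apply, add_comm S T, map_mul]
  linear_combination (tau F (T + S) g') * h + algebraMap k F ζ * g * h2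

lemma E_nsmul {S T : (W⁄k).Point} {ζ : k} (h : E F p S T ζ) (n : ℕ) : E F p S (n • T) (ζ ^ n) := by
  induction n with
  | zero => rw [zero_smul, pow_zero]; exact E_zero h.1
  | succ n ih => rw [succ_nsmul, pow_succ]; exact E_add ih h

lemma E_pow {S T : (W⁄k).Point} {ζ : k} (h : E F p S T ζ) : ζ ^ p = 1 := by
  have h1 := E_nsmul h p
  rw [h.2.1] at h1
  exact E_unique h1 (E_zero h.1)

lemma E_neg {S T : (W⁄k).Point} {ζ : k} (h : E F p S T ζ) : E F p S (-T) ζ⁻¹ := by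
  obtain ⟨ξ, hξ⟩ := E_exists (F := F) h.1 (T := -T) (by rw [smul_neg, h.2.1, neg_zero])
  have h1 := E_add h hξ
  rw [add_neg_cancel] at h1
  have := E_unique h1 (E_zero h.1)
  rwa [eq_inv_of_mul_eq_one_right this] at hξ

lemma E_neg_left {S T : (W⁄k).Point} {ζ : k} (h : E F p S T ζ) : E F p (-S) T ζ⁻¹ := by
  have := E_swap (E_neg (E_swap h))
  rwa [inv_inv] at this

lemma E_add_left {S S' T : (W⁄k).Point} {ζ ζ' : k} (h : E F p S T ζ) (h' : E F p S' T ζ') :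
    E F p (S + S') T (ζ * ζ') := by
  have := E_swap (E_add (E_swap h) (E_swap h'))
  rwa [← mul_inv, inv_inv] at this

lemma theta_gal (σ : k ≃ₐ[K] k) {T : (W⁄k).Point} {f : F} (hf : Theta p T f) :
    Theta p (Point.map (σ : k →ₐ[K] k) T) (gal W F σ f) := by
  refine ⟨(map_ne_zero (gal W F σ)).mpr hf.1, fun v hv => ?_⟩
  have h1 := gal_VF σ (hf.2 _ (gal_VF σ.symm hv))
  rwa [map_mul, gal_tau, gal_symm] at h1

lemma E_gal (σ : k ≃ₐ[K] k) {S T : (W⁄k).Point} {ζ : k} (h : E F p S T ζ) :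
    E F p (Point.map (σ : k →ₐ[K] k) S) (Point.map (σ : k →ₐ[K] k) T) (σ ζ) := by
  obtain ⟨hS, hT, f, g, hf, hg, h⟩ := h
  refine ⟨by rw [← map_nsmul, hS, map_zero], by rw [← map_nsmul, hT, map_zero], _, _,
    theta_gal σ hf, theta_gal σ hg, ?_⟩
  have := congrArg (gal W F σ) h
  simpa only [map_mul, gal_tau, gal_const] using this

end F
end WP


namespace WP
set_option linter.unusedSectionVars false
open scoped Classical
open Polynomial

/-- joint eigenvector -/
lemma joint_eigen {k M : Type*} [Field k] [IsAlgClosed k] [AddCommGroup M] [Module k M]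
    [FiniteDimensional k M] [Nontrivial M] (A B : Module.End k M) (h : ∀ v, A (B v) = B (A v)) :
    ∃ v : M, v ≠ 0 ∧ (∃ a : k, A v = a • v) ∧ ∃ b : k, B v = b • v := by
  obtain ⟨a, ha⟩ := Module.End.exists_eigenvalue A
  have hm : ∀ v ∈ A.eigenspace a, B v ∈ A.eigenspace a := by
    intro v hv
    rw [Module.End.mem_eigenspace_iff] at hv ⊢
    rw [h, hv, map_smul]
  have : Nontrivial (A.eigenspace a) := Submodule.nontrivial_iff_ne_bot.mpr ha
  obtain ⟨b, hb⟩ := Module.End.exists_eigenvalue (B.restrict hm)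
  obtain ⟨v, hv⟩ := hb.exists_hasEigenvector
  refine ⟨v, fun h0 => hv.2 (Subtype.ext h0), ⟨a, Module.End.mem_eigenspace_iff.mp v.2⟩, b, ?_⟩
  have := hv.apply_eq_smul
  exact congrArg Subtype.val this

section pts
variable {K k : Type*} [Field K] [Field k] [IsAlgClosed k] [Algebra K k] {W : WeierstrassCurve K}
  [hW : Fact (W.Δ ≠ 0)]

lemma exists_y (W : WeierstrassCurve K) (x : k) : ∃ y, (W⁄k).Equation x y := by
  have hd : (X ^ 2 + C ((W⁄k).a₁ * x + (W⁄k).a₃) * X + C (-(x ^ 3 + (W⁄k).a₂ * x ^ 2 +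
      (W⁄k).a₄ * x + (W⁄k).a₆)) : k[X]).degree ≠ 0 := by
    have := degree_quadratic (one_ne_zero (α := k)) (b := ((W⁄k).a₁ * x + (W⁄k).a₃))
      (c := -(x ^ 3 + (W⁄k).a₂ * x ^ 2 + (W⁄k).a₄ * x + (W⁄k).a₆))
    rw [map_one, one_mul] at this
    rw [this]
    decide
  obtain ⟨y, hy⟩ := IsAlgClosed.exists_root _ hd
  simp only [IsRoot.def, eval_add, eval_mul, eval_pow, eval_X, eval_C] at hy
  refine ⟨y, ?_⟩
  rw [equation_iff]
  linear_combination hy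

/-- zero of a function -/
def isZ (r : (W⁄k).CoordinateRing) (P : (W⁄k).Point) : Prop :=
  ∃ a b, ∃ h : (W⁄k).Nonsingular a b, P = Point.some _ _ h ∧ ev W h r = 0

/-- x-coordinate -/
def xc : (W⁄k).Point → k
  | 0 => 0
  | Point.some a _ _ => a

lemma isZ_root {r : (W⁄k).CoordinateRing} {P : (W⁄k).Point} (h : isZ r P) : (nm r).IsRoot (xc P) := by
  obtain ⟨a, b, h, rfl, h0⟩ := h
  change (nm r).eval a = 0
  rw [← ev_poly h, nm_conj, map_mul, h0, zero_mul]

lemma ev_conj {a b : k} (h : (W⁄k).Nonsingular a b) (r : (W⁄k).CoordinateRing) :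
    ev W h (conj W k r) = ev W ((nonsingular_neg a b).mpr h) r := by
  have : (ev W h).comp (conj W k) = ev W ((nonsingular_neg a b).mpr h) := by
    apply hom_ext
    · intro c
      rw [RingHom.comp_apply, conj_c, ev_c, ev_c]
    · rw [RingHom.comp_apply, conj_x, ev_x, ev_x]
    · rw [RingHom.comp_apply, conj, lift_y, ev_y, negY, negY]
      simp only [bc_a₁, bc_a₃, map_sub, map_neg, map_mul, ev_cK, ev_x, ev_y]
  exact DFunLike.congr_fun this r

lemma exists_zero {r : (W⁄k).CoordinateRing} (h0 : r ≠ 0) (h : r ∉ V W k 0) : ∃ Z, isZ r Z := by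
  have hd : (nm r).degree ≠ 0 := by
    intro hd
    apply h
    rw [mem_V, hd]; rfl
  obtain ⟨x, hx⟩ := IsAlgClosed.exists_root _ hd
  obtain ⟨y, hy⟩ := exists_y W x
  have hn := nons hW.out hy
  rw [IsRoot.def, ← ev_poly hn, nm_conj, map_mul, ev_conj] at hx
  rcases mul_eq_zero.mp hx with hx | hx
  · exact ⟨_, _, _, _, rfl, hx⟩
  · exact ⟨_, _, _, _, rfl, hx⟩

lemma zeros_card {p : ℕ} {r : (W⁄k).CoordinateRing} (h0 : r ≠ 0) (hr : r ∈ V W k p)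
    (s : Finset (W⁄k).Point) (hs : ∀ P ∈ s, isZ r P) : s.card ≤ 2 * p := by
  have h1 : s.card ≤ 2 * (s.image xc).card := by
    apply Finset.card_le_mul_card_image
    intro c hc
    obtain ⟨P, hP, rfl⟩ := Finset.mem_image.mp hc
    have : (s.filter fun Q => xc Q = xc P) ⊆ {P, -P} := by
      intro Q hQ
      rw [Finset.mem_filter] at hQ
      obtain ⟨a, b, h, rfl, -⟩ := hs P hP
      obtain ⟨a', b', h', rfl, -⟩ := hs Q hQ.1
      have e : a' = a := hQ.2
      subst e
      rw [Finset.mem_insert, Finset.mem_singleton]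
      rcases Y_eq_of_X_eq h'.1 h.1 rfl with h2 | h2
      · left; subst h2; rfl
      · right; subst h2; rfl
    exact (Finset.card_le_card this).trans Finset.card_le_two
  have h2 : (s.image xc).card ≤ p := by
    have : s.image xc ⊆ (nm r).roots.toFinset := by
      intro c hc
      obtain ⟨P, hP, rfl⟩ := Finset.mem_image.mp hc
      rw [Multiset.mem_toFinset, mem_roots (mt nm_eq_zero.mp h0)]
      exact isZ_root (hs P hP)
    calc _ ≤ _ := Finset.card_le_card this
      _ ≤ _ := Multiset.toFinset_card_le _
      _ ≤ _ := card_roots' _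
      _ ≤ p := natDegree_le_iff_degree_le.mpr hr
  omega

end pts

/-- independence -/
def Indep {G : Type*} [AddCommGroup G] (p : ℕ) (P Q : G) : Prop :=
  ∀ m n : ℤ, m • P + n • Q = 0 → (p : ℤ) ∣ m ∧ (p : ℤ) ∣ n

lemma grid {G : Type*} [AddCommGroup G] {p : ℕ} (hp3 : 3 ≤ p) (hodd : Odd p) {P Q : G}
    (hP : p • P = 0) (hQ : p • Q = 0) (hi : Indep p P Q) (Z : G) : ∃ s : Finset G,
    2 * p < s.card ∧ ∀ R ∈ s, ∃ m n : ℕ, R = Z - (m • P + n • Q) ∧ m • P + n • Q ≠ Z ∧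
      2 • (m • P + n • Q) ≠ Z := by
  let H : Finset G := (Finset.range p ×ˢ Finset.range p).image fun mn => mn.1 • P + mn.2 • Q
  have hH : H.card = p * p := by
    rw [Finset.card_image_of_injOn, Finset.card_product, Finset.card_range]
    rintro ⟨m, n⟩ h ⟨m', n'⟩ h' he
    simp only [Finset.coe_product, Finset.coe_range, Set.mem_prod, Set.mem_Iio] at h h' he
    have := hi (m - m') (n - n') (by
      rw [sub_smul, sub_smul]
      simp only [natCast_zsmul]
      rw [sub_add_sub_comm, he, sub_self])
    obtain ⟨⟨u, hu⟩, ⟨v, hv⟩⟩ := this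
    have e1 : m = m' := by
      have : u = 0 := by nlinarith
      subst this; simp at hu; omega
    have e2 : n = n' := by
      have : v = 0 := by nlinarith
      subst this; simp at hv; omega
    rw [e1, e2]
  have htor : ∀ T ∈ H, p • T = 0 := by
    intro T hT
    obtain ⟨⟨m, n⟩, -, rfl⟩ := Finset.mem_image.mp hT
    dsimp only
    rw [smul_add, smul_comm, hP, smul_comm, hQ]; simp
  have hb1 : (H.filter fun T => T = Z).card ≤ 1 := by
    rw [Finset.card_le_one]
    intro a ha b hb
    rw [Finset.mem_filter] at ha hb
    rw [ha.2, hb.2]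
  have hb2 : (H.filter fun T => 2 • T = Z).card ≤ 1 := by
    rw [Finset.card_le_one]
    intro a ha b hb
    rw [Finset.mem_filter] at ha hb
    obtain ⟨q, hq⟩ := hodd
    have h1 := htor _ ha.1
    have h2 := htor _ hb.1
    rw [hq, add_smul, mul_comm, mul_smul, ha.2, one_smul] at h1
    rw [hq, add_smul, mul_comm, mul_smul, hb.2, one_smul] at h2
    exact add_left_cancel (h1.trans h2.symm)
  let s0 := H.filter fun T => ¬ (T = Z ∨ 2 • T = Z)
  have hc : p * p ≤ s0.card + 2 := by
    have h1 := Finset.card_filter_add_card_filter_not (s := H) (fun T => T = Z ∨ 2 • T = Z)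
    rw [Finset.filter_or] at h1
    have h2 := Finset.card_union_le (H.filter fun T => T = Z) (H.filter fun T => 2 • T = Z)
    change _ + s0.card = _ at h1
    omega
  refine ⟨s0.image fun T => Z - T, ?_, ?_⟩
  · rw [Finset.card_image_of_injective _ (fun a b h => by simpa using h)]
    nlinarith
  · intro R hR
    obtain ⟨T, hT, rfl⟩ := Finset.mem_image.mp hR
    rw [Finset.mem_filter, not_or] at hT
    obtain ⟨⟨m, n⟩, -, rfl⟩ := Finset.mem_image.mp hT.1
    exact ⟨m, n, rfl, hT.2.1, hT.2.2⟩

section F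
variable {K k F : Type*} [Field K] [Field k] [IsAlgClosed k] [Algebra K k] {W : WeierstrassCurve K}
  [hW : Fact (W.Δ ≠ 0)]
  [Field F] [Algebra (W⁄k).CoordinateRing F] [IsFractionRing (W⁄k).CoordinateRing F]
  [Algebra k F] [IsScalarTower k (W⁄k).CoordinateRing F] [Algebra K F] [IsScalarTower K k F]
  {p : ℕ}

/-- the operator of a theta function -/
noncomputable def opr {T : (W⁄k).Point} {f : F} (hf : Theta p T f) : Module.End k (VF W k F p) where
  toFun v := ⟨f * tau F T v, hf.2 _ v.2⟩
  map_add' v w := by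
    apply Subtype.ext
    change f * tau F T (v + w) = f * tau F T v + f * tau F T w
    rw [map_add, mul_add]
  map_smul' c v := by
    apply Subtype.ext
    change f * tau F T (c • (v : F)) = c • (f * tau F T v)
    rw [Algebra.smul_def, map_mul, tau_const, Algebra.smul_def]; ring

instance : FiniteDimensional k (VF W k F p) := by
  unfold VF; infer_instance

instance : Nontrivial (VF W k F p) :=
  ⟨⟨⟨1, one_mem_VF p⟩, 0, fun h => one_ne_zero (congrArg Subtype.val h)⟩⟩

/-- eigenvector condition -/
def IsEig (p : ℕ) (h : F) (T : (W⁄k).Point) : Prop :=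
  ∃ f : F, Theta p T f ∧ ∃ a : k, f * tau F T h = algebraMap k F a * h

lemma isEig_add {h : F} {S T : (W⁄k).Point} (hS : IsEig p h S) (hT : IsEig p h T) :
    IsEig p h (S + T) := by
  obtain ⟨f, hf, a, ha⟩ := hS
  obtain ⟨g, hg, b, hb⟩ := hT
  refine ⟨_, theta_mul hf hg, a * b, ?_⟩
  have := congrArg (tau F S) hb
  rw [map_mul, map_mul, tau_const] at this
  rw [tau_add_apply, map_mul]
  linear_combination f * this + algebraMap k F b * ha

lemma isEig_zero (h : F) : IsEig p h (0 : (W⁄k).Point) :=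
  ⟨1, theta_one, 1, by rw [tau_zero, map_one]; rfl⟩

lemma isEig_nsmul {h : F} {S : (W⁄k).Point} (hS : IsEig p h S) (n : ℕ) : IsEig p h (n • S) := by
  induction n with
  | zero => rw [zero_smul]; exact isEig_zero h
  | succ n ih => rw [succ_nsmul]; exact isEig_add ih hS

lemma eig_all {h : F} (h0 : h ≠ 0) {T : (W⁄k).Point} (hT : IsEig p h T) (hp : p • T = 0) {f : F} (hf : Theta p T f) :
    ∃ a : k, a ≠ 0 ∧ f * tau F T h = algebraMap k F a * h := by
  obtain ⟨g, hg, a, ha⟩ := hT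
  obtain ⟨c, hc, rfl⟩ := theta_unique hp hf hg
  refine ⟨c * a, mul_ne_zero hc ?_, ?_⟩
  · rintro rfl
    rw [map_zero, zero_mul] at ha
    exact mul_ne_zero hg.1 (tau_ne h0) ha
  · rw [map_mul, mul_assoc, ha, mul_assoc]

lemma nondeg_const {P : (W⁄k).Point} (hp3 : 3 ≤ p) (hP : P ≠ 0) {c : k} (hc : c ≠ 0)
    (h : Theta p P (algebraMap k F c)) : False := by
  rcases P with _ | ⟨a, b, hn⟩
  · exact hP rfl
  obtain ⟨v, hv, he⟩ := mem_VF.mp (h.2 (io W k F (xR W k)) (mem_VF.mpr ⟨_, V_mono (by omega) x_mem_V, rfl⟩))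
  have hc' : algebraMap k F c ≠ 0 := by simpa using hc
  have h1 := (tau_xy (F := F) hn).1
  have h2 : algebraMap k (W⁄k).CoordinateRing c * RA W a b = Dx W a ^ 2 * v := by
    apply io_inj (W := W) (k := k) (F := F)
    rw [map_mul, map_mul, map_pow, io_const, h1, he]; ring
  have h3 : v ∈ V W k 0 := by
    have hD : nm (Dx W a ^ 2) = ((X - C a) ^ 2) ^ 2 := by
      have eD : Dx W a = algebraMap k[X] _ (X - C a) := by
        rw [poly_x, map_sub, aeval_X, aeval_C]; rfl
      rw [eD, ← map_pow, nm_poly]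
    refine V_of_mul (u := Dx W a ^ 2) (m := 4) ?_ (pow_ne_zero _ (Dx_ne a)) ?_
    · rw [hD, natDegree_pow, natDegree_pow, natDegree_X_sub_C]
    · rw [← h2]; exact al_mul_V _ (RA_V a b)
  obtain ⟨d, rfl⟩ := V_zero h3
  rw [io_const] at he
  apply x_ne_const (W := W) (F := F) (c⁻¹ * d)
  apply tau_inj (Point.some _ _ hn)
  rw [tau_const, map_mul, he, map_inv₀, inv_mul_cancel_left₀ hc']

lemma nondeg (hp3 : 3 ≤ p) (hodd : Odd p) {P Q : (W⁄k).Point} (hi : Indep p P Q) (h : E F p P Q 1) : False := by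
  obtain ⟨hP, hQ, f, g, hf, hg, he⟩ := h
  rw [map_one, one_mul] at he
  obtain ⟨v, hv0, ⟨a, ha⟩, ⟨b, hb⟩⟩ := joint_eigen (opr hf) (opr hg) (by
    intro v
    apply Subtype.ext
    change f * tau F P (g * tau F Q v) = g * tau F Q (f * tau F P v)
    rw [map_mul, map_mul, ← tau_add_apply, ← tau_add_apply, add_comm Q P]
    linear_combination (tau F (P + Q) v) * he)
  have hPe : IsEig p (v : F) P := ⟨f, hf, a, by
    have := congrArg Subtype.val ha
    rw [← Algebra.smul_def]; exact this⟩
  have hQe : IsEig p (v : F) Q := ⟨g, hg, b, by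
    have := congrArg Subtype.val hb
    rw [← Algebra.smul_def]; exact this⟩
  have hv0' : (v : F) ≠ 0 := fun h => hv0 (Subtype.ext h)
  obtain ⟨r, hr, hrv⟩ := mem_VF.mp v.2
  rw [← hrv] at hPe hQe hv0'
  have hr0 : r ≠ 0 := by rintro rfl; exact hv0' (map_zero _)
  have hP0 : P ≠ 0 := by
    rintro rfl
    have := (hi 1 0 (by simp)).1
    have := Int.le_of_dvd (by norm_num) this
    omega
  by_cases hc : r ∈ V W k 0
  · obtain ⟨c, rfl⟩ := V_zero hc
    obtain ⟨a', ha0, ha'⟩ := eig_all hv0' hPe hP hf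
    rw [io_const, tau_const] at ha'
    rw [io_const] at hv0'
    rw [mul_right_cancel₀ hv0' ha'] at hf
    exact nondeg_const hp3 hP0 ha0 hf
  obtain ⟨Z, hZ⟩ := exists_zero hr0 hc
  obtain ⟨s, hs1, hs2⟩ := grid hp3 hodd hP hQ hi Z
  refine absurd (zeros_card hr0 hr s fun R hR => ?_) (not_le.mpr hs1)
  obtain ⟨m, n, rfl, h1, h2⟩ := hs2 R hR
  have hT : IsEig p (io W k F r) (m • P + n • Q) := isEig_add (isEig_nsmul hPe m) (isEig_nsmul hQe n)
  have hpT : p • (m • P + n • Q) = 0 := by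
    rw [smul_add, smul_comm, hP, smul_comm, hQ]; simp
  generalize m • P + n • Q = T at *
  obtain ⟨Z', rfl⟩ : ∃ Z', Z = T + Z' := ⟨Z - T, by abel⟩
  rw [add_sub_cancel_left]
  rcases T with _ | ⟨a, b, hn⟩
  · have e : (Point.zero : (W⁄k).Point) + Z' = Z' := zero_add Z'
    rwa [e] at hZ
  rcases Z' with _ | ⟨a1, b1, hn1⟩
  · exact absurd (add_zero _).symm h1
  obtain ⟨a2, b2, hn2, hs, hz⟩ := hZ
  have hx : a1 ≠ a := by
    rintro rfl
    rcases Y_eq_of_X_eq hn1.1 hn.1 rfl with h3 | h3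
    · subst h3
      exact h2 (two_nsmul _)
    · subst h3
      have : Point.some _ _ hn + Point.some _ _ hn1 = 0 := Point.add_of_Y_eq rfl (by rw [negY_negY])
      rw [this] at hs
      exact Point.some_ne_zero _ hs.symm
  obtain ⟨G, -, -, hG3, hG4⟩ := key_mono (F := F) hn hr
  obtain ⟨u, f', hu0, hD, hfu, hf'⟩ := exists_theta_some (F := F) hn hpT
  obtain ⟨c, hc0, hce⟩ := eig_all hv0' hT hpT hf'
  have hG : G = algebraMap k _ c * u * r := by
    apply io_inj (W := W) (k := k) (F := F)
    rw [hG3, map_mul, map_mul, io_const, ← hfu]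
    linear_combination (io W k F u) * hce
  have h4 := hG4 _ _ _ _ hn1 hn2 hx hs
  rw [hz, mul_zero, hG, map_mul, map_mul, ev_c] at h4
  refine ⟨a1, b1, hn1, rfl, ?_⟩
  have hu : ev W hn1 u ≠ 0 := by
    intro h5
    obtain ⟨w, hw⟩ := hD
    have := congrArg (ev W hn1) hw
    rw [map_mul, h5, zero_mul, map_pow, ev_D] at this
    exact pow_ne_zero _ (sub_ne_zero.mpr hx) this
  exact (mul_eq_zero.mp h4).resolve_left (mul_ne_zero hc0 hu)

end F
end WP


namespace WP
set_option linter.unusedSectionVars false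
open scoped Classical

section H
variable {K k : Type*} [Field K] [Field k] [IsAlgClosed k] [Algebra K k] {W : WeierstrassCurve K}
  [hW : Fact (W.Δ ≠ 0)] {p : ℕ}

lemma three_le (hp : p.Prime) (hodd : Odd p) : 3 ≤ p := by
  have := hp.two_le
  rcases hodd with ⟨c, rfl⟩
  omega

lemma prim (hp : p.Prime) (hodd : Odd p) {P Q : (W⁄k).Point} (hi : Indep p P Q) {ζ : k}
    (h : E (W⁄k).FunctionField p P Q ζ) : IsPrimitiveRoot ζ p := by
  haveI : Fact p.Prime := ⟨hp⟩
  rw [IsPrimitiveRoot.iff_orderOf]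
  refine orderOf_eq_prime (E_pow h) ?_
  rintro rfl
  exact nondeg (three_le hp hodd) hodd hi h

lemma rank_le (hp : p.Prime) (hodd : Odd p) {P Q R : (W⁄k).Point} (hi : Indep p P Q)
    (hP : p • P = 0) (hQ : p • Q = 0) (hR : p • R = 0) : ∃ m n : ℤ, R = m • P + n • Q := by
  haveI : NeZero p := ⟨hp.ne_zero⟩
  obtain ⟨ζ, hζ⟩ := E_exists (F := (W⁄k).FunctionField) hP hQ
  obtain ⟨ξ, hξ⟩ := E_exists (F := (W⁄k).FunctionField) hP hR
  obtain ⟨j, -, rfl⟩ := (prim hp hodd hi hζ).eq_pow_of_pow_eq_one (E_pow hξ)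
  have h1 := E_add hξ (E_neg (E_nsmul hζ j))
  rw [mul_inv_cancel₀ (pow_ne_zero _ (E_ne hζ))] at h1
  have h2 : ¬ Indep p P (R + -(j • Q)) := fun h => nondeg (three_le hp hodd) hodd h h1
  unfold Indep at h2
  push Not at h2
  obtain ⟨m, n, hmn, hd⟩ := h2
  have hn : ¬ (p : ℤ) ∣ n := by
    intro hn
    refine hd ?_ hn
    obtain ⟨c, rfl⟩ := hn
    have : ((p : ℤ) * c) • (R + -(j • Q)) = 0 := by
      rw [mul_comm, mul_smul, natCast_zsmul, h1.2.1, smul_zero]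
    rw [this, add_zero] at hmn
    exact (hi m 0 (by rw [hmn]; simp)).1
  have hcop : IsCoprime (p : ℤ) n := (Nat.prime_iff_prime_int.mp hp).coprime_iff_not_dvd.mpr hn
  obtain ⟨a, b, hab⟩ := hcop
  refine ⟨-(b * m), j, ?_⟩
  have e1 : R + -(j • Q) = (a * p + b * n) • (R + -(j • Q)) := by rw [hab, one_smul]
  rw [add_smul, mul_smul, mul_smul, natCast_zsmul, h1.2.1, smul_zero, zero_add,
    eq_neg_of_add_eq_zero_right hmn] at e1
  rw [eq_add_of_add_neg_eq e1, natCast_zsmul, neg_smul, mul_smul, smul_neg]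

end H

section G
variable {G H : Type*} [AddCommGroup G] [AddCommGroup H] {p : ℕ}

lemma Indep.map {f : G →+ H} (hf : Function.Injective f) {P Q : G} (h : Indep p P Q) :
    Indep p (f P) (f Q) := by
  intro m n hmn
  refine h m n (hf ?_)
  rw [map_add, map_zsmul, map_zsmul, hmn, map_zero]

lemma dvd_of_smul (hp : p.Prime) {P : G} (h0 : P ≠ 0) (hP : p • P = 0) {m : ℤ} (h : m • P = 0) :
    (p : ℤ) ∣ m := by
  haveI : Fact p.Prime := ⟨hp⟩
  rw [← addOrderOf_eq_prime hP h0]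
  exact addOrderOf_dvd_iff_zsmul_eq_zero.mpr h

lemma dvd_two (hp : p.Prime) (hodd : Odd p) {m : ℤ} (h : (p : ℤ) ∣ 2 * m) : (p : ℤ) ∣ m := by
  refine ((Nat.prime_iff_prime_int.mp hp).dvd_mul.mp h).resolve_left fun h2 => ?_
  have := Int.le_of_dvd (by norm_num) h2
  have := three_le hp hodd
  omega

lemma indep_of_anti (hp : p.Prime) (hodd : Odd p) (s : G →+ G) {P R : G} (hP : p • P = 0)
    (hP0 : P ≠ 0) (hsP : s P = P) (hR : p • R = 0) (hR0 : R ≠ 0) (hsR : s R = -R) :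
    Indep p P R := by
  intro m n h
  have h1 := congrArg s h
  rw [map_add, map_zsmul, map_zsmul, hsP, hsR, map_zero] at h1
  constructor
  · refine dvd_two hp hodd (dvd_of_smul hp hP0 hP ?_)
    rw [two_mul, add_smul]
    calc m • P + m • P = (m • P + n • R) + (m • P + n • -R) := by rw [smul_neg]; abel
      _ = 0 := by rw [h, h1, add_zero]
  · refine dvd_two hp hodd (dvd_of_smul hp hR0 hR ?_)
    rw [two_mul, add_smul]
    calc n • R + n • R = (m • P + n • R) - (m • P + n • -R) := by rw [smul_neg]; abel
      _ = 0 := by rw [h, h1, sub_zero]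

lemma exists_anti (s : G →+ G) (hs : ∀ x, s (s x) = x) {R : G} {i : ℕ} (hR : p ^ i • R = 0)
    (hne : s R ≠ R) : ∃ R' : G, R' ≠ 0 ∧ p • R' = 0 ∧ s R' = -R' := by
  have hex : ∃ n : ℕ, p ^ n • (R - s R) = 0 := ⟨i, by
    rw [smul_sub, ← map_nsmul, hR, map_zero, sub_zero]⟩
  have h0 : Nat.find hex ≠ 0 := by
    intro h
    have := Nat.find_spec hex
    rw [h, pow_zero, one_smul, sub_eq_zero] at this
    exact hne this.symm
  obtain ⟨n, hn⟩ := Nat.exists_eq_succ_of_ne_zero h0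
  refine ⟨p ^ n • (R - s R), Nat.find_min hex (by omega), ?_, ?_⟩
  · rw [← mul_smul, ← pow_succ', ← Nat.succ_eq_add_one, ← hn]
    exact Nat.find_spec hex
  · rw [map_nsmul, map_sub, hs, ← smul_neg, neg_sub]

end G
end WP


namespace WP
set_option linter.unusedSectionVars false
open scoped Classical

section G
variable {G H : Type*} [AddCommGroup G] [AddCommGroup H] {p : ℕ}

lemma gen_iso {P Q : G} (hP : p • P = 0) (hQ : p • Q = 0) (hi : Indep p P Q)
    (hs : ∀ R : G, p • R = 0 → ∃ m n : ℤ, R = m • P + n • Q) :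
    Nonempty (nTorsion G p ≃+ (ZMod p × ZMod p)) := by
  have hP' : ∀ a : ℤ, a • P ∈ nTorsion G p := fun a => (nTorsion G p).zsmul_mem hP a
  let fP : ZMod p →+ nTorsion G p :=
    ZMod.lift p ⟨zmultiplesHom (nTorsion G p) ⟨P, hP⟩, by
      apply Subtype.ext
      simpa using hP⟩
  let fQ : ZMod p →+ nTorsion G p :=
    ZMod.lift p ⟨zmultiplesHom (nTorsion G p) ⟨Q, hQ⟩, by
      apply Subtype.ext
      simpa using hQ⟩
  have eP : ∀ m : ℤ, ((fP m : nTorsion G p) : G) = m • P := fun m => by simp [fP]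
  have eQ : ∀ m : ℤ, ((fQ m : nTorsion G p) : G) = m • Q := fun m => by simp [fQ]
  let f : ZMod p × ZMod p →+ nTorsion G p := fP.coprod fQ
  have hf : ∀ m n : ℤ, ((f ((m : ZMod p), (n : ZMod p)) : nTorsion G p) : G) = m • P + n • Q := by
    intro m n
    rw [← eP, ← eQ]
    rfl
  refine ⟨(AddEquiv.ofBijective f ⟨?_, ?_⟩).symm⟩
  · rw [injective_iff_map_eq_zero]
    rintro ⟨a, b⟩ h
    obtain ⟨m, rfl⟩ := ZMod.intCast_surjective a
    obtain ⟨n, rfl⟩ := ZMod.intCast_surjective b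
    have h1 := hf m n
    rw [h] at h1
    obtain ⟨h2, h3⟩ := hi m n h1.symm
    rw [Prod.mk_eq_zero]
    exact ⟨(ZMod.intCast_zmod_eq_zero_iff_dvd _ _).mpr h2,
      (ZMod.intCast_zmod_eq_zero_iff_dvd _ _).mpr h3⟩
  · rintro ⟨R, hR⟩
    obtain ⟨m, n, h⟩ := hs R hR
    exact ⟨((m : ZMod p), (n : ZMod p)), Subtype.ext ((hf m n).trans h.symm)⟩

lemma basis_of_iso (e : nTorsion G p ≃+ (ZMod p × ZMod p)) :
    ∃ P Q : G, p • P = 0 ∧ p • Q = 0 ∧ Indep p P Q := by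
  refine ⟨e.symm (1, 0), e.symm (0, 1), (e.symm (1, 0)).2, (e.symm (0, 1)).2, ?_⟩
  intro m n h
  have h1 : m • e.symm (1, 0) + n • e.symm (0, 1) = 0 := Subtype.ext h
  have h2 := congrArg e h1
  rw [map_add, map_zsmul, map_zsmul, e.apply_symm_apply, e.apply_symm_apply, map_zero] at h2
  simp only [Prod.smul_mk, Prod.mk_add_mk, smul_zero, add_zero, zero_add, zsmul_eq_mul, mul_one,
    Prod.mk_eq_zero] at h2
  exact ⟨(ZMod.intCast_zmod_eq_zero_iff_dvd _ _).mp h2.1,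
      (ZMod.intCast_zmod_eq_zero_iff_dvd _ _).mp h2.2⟩

lemma gen_of_iso (hp : p.Prime) (e : nTorsion G p ≃+ ZMod p) :
    ∃ P : G, P ≠ 0 ∧ p • P = 0 ∧ ∀ R : G, p • R = 0 → ∃ m : ℤ, R = m • P := by
  have : Fact p.Prime := ⟨hp⟩
  refine ⟨e.symm 1, ?_, (e.symm 1).2, fun R hR => ?_⟩
  · intro h
    have h1 : e.symm 1 = 0 := Subtype.ext h
    have := e.symm.map_eq_zero_iff.mp h1
    exact one_ne_zero this
  · obtain ⟨m, hm⟩ := ZMod.intCast_surjective (e ⟨R, hR⟩)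
    refine ⟨m, ?_⟩
    have : (⟨R, hR⟩ : nTorsion G p) = m • e.symm 1 := by
      apply e.injective
      rw [map_zsmul, e.apply_symm_apply, ← hm]
      simp
    exact congrArg Subtype.val this

lemma not_indep (hp : p.Prime) {P : G} (hP : p • P = 0) (m n : ℤ) : ¬ Indep p (m • P) (n • P) := by
  intro h
  have h1 := (h n (-m) (by rw [← mul_smul, ← mul_smul, ← add_smul]; ring_nf; simp)).2
  have h2 : m • P = 0 := by
    obtain ⟨c, hc⟩ := h1
    rw [show m = (-c) * p by linarith, mul_smul, natCast_zsmul, hP, smul_zero]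
  have h3 := (h 1 0 (by rw [h2]; simp)).1
  have := Int.le_of_dvd (by norm_num) h3
  have := hp.two_le
  omega

end G

section Q
variable {K L : Type*} [Field K] [NumberField K] [Field L] [Algebra K L]

lemma exists_conj (hL : Module.finrank K L = 2) :
    ∃ s : L ≃ₐ[K] L, (∀ x, s (s x) = x) ∧ (∀ t : L ≃ₐ[K] L, t = 1 ∨ t = s) ∧
      ∀ x, s x = x → x ∈ Set.range (algebraMap K L) := by
  have : FiniteDimensional K L := Module.finite_of_finrank_pos (by omega)
  have : Algebra.IsQuadraticExtension K L := { finrank_eq_two' := hL }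
  have hg : IsGalois K L := inferInstance
  have hc := IsGalois.card_aut_eq_finrank K L
  rw [hL, Nat.card_eq_two_iff' 1] at hc
  obtain ⟨s, hs1, hs⟩ := hc
  have ht : ∀ t : L ≃ₐ[K] L, t = 1 ∨ t = s := by
    intro t
    by_cases h : t = 1
    · exact Or.inl h
    · exact Or.inr (hs t h)
  refine ⟨s, fun x => ?_, ht, fun x hx => ?_⟩
  · rcases ht (s * s) with h | h
    · exact DFunLike.congr_fun h x
    · exact absurd (mul_eq_left.mp h) hs1
  · rw [IsGalois.mem_range_algebraMap_iff_fixed]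
    intro t
    rcases ht t with rfl | rfl
    · rfl
    · exact hx

variable {W : WeierstrassCurve K} 

lemma fixed_mem [hW : Fact (W.Δ ≠ 0)] {s : L ≃ₐ[K] L}
    (hs : ∀ x, s x = x → x ∈ Set.range (algebraMap K L)) (R : (W⁄L).Point)
    (h : Point.map (s : L →ₐ[K] L) R = R) : ∃ P : (W⁄K).Point, Point.baseChange K L P = R := by
  rcases R with _ | ⟨x, y, hn⟩
  · exact ⟨0, map_zero _⟩
  · rw [Point.map_some] at h
    rw [Point.some.injEq] at h
    obtain ⟨a, rfl⟩ := hs x h.1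
    obtain ⟨b, rfl⟩ := hs y h.2
    have : (W⁄K).Nonsingular a b :=
      (WeierstrassCurve.Affine.baseChange_nonsingular W (f := Algebra.ofId K L)
        (Algebra.ofId K L).injective a b).mp hn
    refine ⟨Point.some a b this, ?_⟩
    rfl

end Q
end WP


namespace WP
set_option linter.unusedSectionVars false
open scoped Classical

section Fin
variable {K L : Type*} [Field K] [NumberField K] [Field L] [Algebra K L]
  {W : WeierstrassCurve K}

/-- the inclusion of `L`-points in points over the algebraic closure -/
noncomputable def jj (W : WeierstrassCurve K) :
    (W⁄L).Point →+ (W⁄(AlgebraicClosure L)).Point :=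
  Point.map (IsScalarTower.toAlgHom K L (AlgebraicClosure L))

lemma jj_inj : Function.Injective (jj (L := L) W) := Point.map_injective _

/-- the action of an automorphism on points -/
noncomputable def act {M : Type*} [Field M] [Algebra K M] (W : WeierstrassCurve K) (s : M ≃ₐ[K] M) :
    (W⁄M).Point →+ (W⁄M).Point :=
  Point.map (s : M →ₐ[K] M)

lemma act_jj {σ : AlgebraicClosure L ≃ₐ[K] AlgebraicClosure L} {t : L ≃ₐ[K] L}
    (h : ∀ x : L, σ (algebraMap L _ x) = algebraMap L _ (t x)) (P : (W⁄L).Point) :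
    act W σ (jj W P) = jj W (act W t P) := by
  rcases P with _ | ⟨x, y, hn⟩
  · exact (congrArg (act W σ) (map_zero (jj W))).trans <| (map_zero _).trans <|
      ((congrArg (jj W) (map_zero (act W t))).trans (map_zero _)).symm
  · unfold act jj
    rw [Point.map_some, Point.map_some, Point.map_some, Point.map_some, Point.some.injEq]
    exact ⟨h x, h y⟩

lemma act_one (P : (W⁄L).Point) : act W (1 : L ≃ₐ[K] L) P = P := by
  rcases P with _ | ⟨x, y, hn⟩
  · exact map_zero _
  · rfl

lemma act_act {s : L ≃ₐ[K] L} (hs : ∀ x, s (s x) = x) (P : (W⁄L).Point) :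
    act W s (act W s P) = P := by
  rcases P with _ | ⟨x, y, hn⟩
  · exact (congrArg (act W s) (map_zero (act W s))).trans (map_zero _)
  · unfold act
    rw [Point.map_some, Point.map_some, Point.some.injEq]
    exact ⟨hs x, hs y⟩

lemma act_base (s : L ≃ₐ[K] L) (P : (W⁄K).Point) :
    act W s (Point.baseChange K L P) = Point.baseChange K L P :=
  Point.map_baseChange _ _

lemma gal_cases (hL : Module.finrank K L = 2) (σ : AlgebraicClosure L ≃ₐ[K] AlgebraicClosure L) :
    ∃ t : L ≃ₐ[K] L, ∀ x : L, σ (algebraMap L _ x) = algebraMap L _ (t x) := by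
  have : FiniteDimensional K L := Module.finite_of_finrank_pos (by omega)
  have : Algebra.IsQuadraticExtension K L := { finrank_eq_two' := hL }
  have hg : IsGalois K L := inferInstance
  exact ⟨σ.restrictNormal L, fun x => (σ.restrictNormal_commutes L x).symm⟩

lemma gal_lift (hL : Module.finrank K L = 2) (s : L ≃ₐ[K] L) :
    ∃ σ : AlgebraicClosure L ≃ₐ[K] AlgebraicClosure L,
      ∀ x : L, σ (algebraMap L _ x) = algebraMap L _ (s x) := by
  have : FiniteDimensional K L := Module.finite_of_finrank_pos (by omega)
  have : IsGalois K (AlgebraicClosure L) := inferInstance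
  exact ⟨s.liftNormal _, fun x => s.liftNormal_commutes _ x⟩

lemma gal_fixed (hL : Module.finrank K L = 2) {x : AlgebraicClosure L}
    (h : ∀ σ : AlgebraicClosure L ≃ₐ[K] AlgebraicClosure L, σ x = x) :
    ∃ y : K, algebraMap K _ y = x := by
  have : FiniteDimensional K L := Module.finite_of_finrank_pos (by omega)
  have : IsGalois K (AlgebraicClosure L) := inferInstance
  exact (InfiniteGalois.mem_range_algebraMap_iff_fixed x).mpr h

variable [hW : Fact (W.Δ ≠ 0)] {p : ℕ}

lemma rank_L (hp : p.Prime) (hodd : Odd p) {P Q R : (W⁄L).Point} (hi : Indep p P Q)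
    (hP : p • P = 0) (hQ : p • Q = 0) (hR : p • R = 0) : ∃ m n : ℤ, R = m • P + n • Q := by
  have ht : ∀ {T : (W⁄L).Point}, p • T = 0 → p • jj W T = 0 := fun h => by
    rw [← map_nsmul, h, map_zero]
  obtain ⟨m, n, h⟩ := rank_le hp hodd (hi.map jj_inj) (ht hP) (ht hQ) (ht hR)
  refine ⟨m, n, jj_inj ?_⟩
  rw [h, map_add, map_zsmul, map_zsmul]

lemma exists_pair {P Q : (W⁄L).Point} (hP : p • P = 0) (hQ : p • Q = 0) :
    ∃ ζ, E (W⁄(AlgebraicClosure L)).FunctionField p (jj W P) (jj W Q) ζ :=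
  E_exists (by rw [← map_nsmul, hP, map_zero]) (by rw [← map_nsmul, hQ, map_zero])

theorem part_a (hL : Module.finrank K L = 2) (hp : p.Prime) (hodd : Odd p)
    (h0 : nTorsion (W⁄K).Point p = ⊥)
    (h1 : Nonempty (nTorsion (W⁄L).Point p ≃+ (ZMod p × ZMod p))) :
    ∃ ζ : K, IsPrimitiveRoot ζ p := by
  obtain ⟨s, hs2, hst, hsf⟩ := exists_conj hL
  obtain ⟨P, Q, hP, hQ, hi⟩ := basis_of_iso h1.some
  have hanti : ∀ R : (W⁄L).Point, p • R = 0 → act W s R = -R := by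
    intro R hR
    obtain ⟨T, hT⟩ := fixed_mem hsf (R + act W s R) (by
      change act W s _ = _
      rw [map_add, act_act hs2, add_comm])
    have hT0 : T ∈ nTorsion (W⁄K).Point p := by
      change p • T = 0
      apply Point.map_injective (W' := W) (Algebra.ofId K L)
      change Point.baseChange K L _ = Point.baseChange K L _
      rw [map_nsmul, hT, smul_add, ← map_nsmul, hR, map_zero, map_zero, add_zero]
    rw [h0, AddSubgroup.mem_bot] at hT0
    rw [hT0, map_zero] at hT
    exact eq_neg_of_add_eq_zero_right hT.symm
  obtain ⟨ζ, hζ⟩ := exists_pair hP hQ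
  have hprim := prim hp hodd (hi.map jj_inj) hζ
  obtain ⟨y, hy⟩ := gal_fixed (x := ζ) hL (fun σ => by
    obtain ⟨t, ht⟩ := gal_cases hL σ
    have h2 := E_gal σ hζ
    change E _ p (act W σ _) (act W σ _) _ at h2
    rw [act_jj ht, act_jj ht] at h2
    rcases hst t with rfl | rfl
    · rw [act_one, act_one] at h2
      exact E_unique h2 hζ
    · rw [hanti P hP, hanti Q hQ, map_neg, map_neg] at h2
      have h3 := E_neg (E_neg_left hζ)
      rw [inv_inv] at h3
      exact E_unique h2 h3)
  rw [← hy] at hprim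
  exact ⟨y, hprim.of_map_of_injective (algebraMap K _).injective⟩

lemma base_inj : Function.Injective (Point.baseChange (W' := W) K L) :=
  Point.map_injective (W' := W) (Algebra.ofId K L)

lemma exists_anti_L {s : L ≃ₐ[K] L} (hs2 : ∀ x, s (s x) = x)
    (hsf : ∀ x, s x = x → x ∈ Set.range (algebraMap K L))
    {R : (W⁄L).Point} (hR : R ∈ pPrimary (W⁄L).Point p)
    (hne : R ∉ (pPrimary (W⁄K).Point p).map (Point.baseChange (W' := W) K L)) :
    ∃ R' : (W⁄L).Point, R' ≠ 0 ∧ p • R' = 0 ∧ act W s R' = -R' := by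
  obtain ⟨i, hi⟩ := hR
  refine exists_anti (act W s) (act_act hs2) hi fun h => hne ?_
  obtain ⟨T, rfl⟩ := fixed_mem hsf R h
  refine ⟨T, ⟨i, base_inj (L := L) ?_⟩, rfl⟩
  rw [map_nsmul, hi, map_zero]

theorem part_b (hL : Module.finrank K L = 2) (hp : p.Prime) (hodd : Odd p)
    (h0 : Nonempty (nTorsion (W⁄K).Point p ≃+ ZMod p))
    (h1 : (pPrimary (W⁄K).Point p).map (Point.baseChange (W' := W) K L) < pPrimary (W⁄L).Point p) :
    Nonempty (nTorsion (W⁄L).Point p ≃+ (ZMod p × ZMod p)) := by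
  obtain ⟨s, hs2, hst, hsf⟩ := exists_conj hL
  obtain ⟨P, hP0, hP, -⟩ := gen_of_iso hp h0.some
  obtain ⟨R, hR, hne⟩ := SetLike.exists_of_lt h1
  obtain ⟨R', hR0, hR', hs⟩ := exists_anti_L hs2 hsf hR hne
  have hbP : p • Point.baseChange (W' := W) K L P = 0 := by rw [← map_nsmul, hP, map_zero]
  have hi := indep_of_anti hp hodd (act W s) hbP
    (fun h => hP0 (base_inj (L := L) (h.trans (map_zero _).symm))) (act_base s P) hR' hR0 hs
  exact gen_iso hbP hR' hi fun T hT => rank_L hp hodd hi hbP hR' hT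

theorem part_c (hL : Module.finrank K L = 2) (hp : p.Prime) (hodd : Odd p)
    (h0 : Nonempty (nTorsion (W⁄K).Point p ≃+ ZMod p))
    (h1 : Nonempty (nTorsion (W⁄L).Point p ≃+ (ZMod p × ZMod p))) :
    ¬ ∃ ζ : K, IsPrimitiveRoot ζ p := by
  rintro ⟨ξ, hξ⟩
  have : NeZero p := ⟨hp.ne_zero⟩
  obtain ⟨s, hs2, hst, hsf⟩ := exists_conj hL
  obtain ⟨P, hP0, hP, hgen⟩ := gen_of_iso hp h0.some
  obtain ⟨S, T, hS, hT, hST⟩ := basis_of_iso h1.some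
  have hbP : p • Point.baseChange (W' := W) K L P = 0 := by rw [← map_nsmul, hP, map_zero]
  have hex : ∃ R' : (W⁄L).Point, R' ≠ 0 ∧ p • R' = 0 ∧ act W s R' = -R' := by
    by_contra hno
    have hall : ∀ R : (W⁄L).Point, p • R = 0 → ∃ m : ℤ, R = m • Point.baseChange (W' := W) K L P := by
      intro R hR
      by_contra hR2
      refine hno (exists_anti_L (R := R) hs2 hsf ⟨1, by rwa [pow_one]⟩ ?_)
      rintro ⟨U, -, hU⟩
      change Point.baseChange (W' := W) K L U = R at hU
      obtain ⟨m, rfl⟩ := hgen U (base_inj (L := L) (by rw [map_nsmul, hU, hR, map_zero]))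
      exact hR2 ⟨m, by rw [← hU, map_zsmul]⟩
    obtain ⟨m, rfl⟩ := hall S hS
    obtain ⟨n, rfl⟩ := hall T hT
    exact not_indep hp hbP m n hST
  obtain ⟨R', hR0, hR', hs⟩ := hex
  have hi := indep_of_anti hp hodd (act W s) hbP
    (fun h => hP0 (base_inj (L := L) (h.trans (map_zero _).symm))) (act_base s P) hR' hR0 hs
  obtain ⟨ζ, hζ⟩ := exists_pair hbP hR'
  have hprim := prim hp hodd (hi.map jj_inj) hζ
  have hξ' := hξ.map_of_injective (algebraMap K (AlgebraicClosure L)).injective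
  obtain ⟨i, -, hi2⟩ := hξ'.eq_pow_of_pow_eq_one hprim.pow_eq_one
  obtain ⟨σ, hσ⟩ := gal_lift hL s
  have h2 := E_gal σ hζ
  change E _ p (act W σ _) (act W σ _) _ at h2
  rw [act_jj hσ, act_jj hσ, act_base, hs, map_neg] at h2
  have h3 := E_unique h2 (E_neg hζ)
  rw [← hi2, map_pow, AlgEquiv.commutes, hi2] at h3
  have h4 : ζ ^ 2 = 1 := by
    rw [sq]
    nth_rewrite 1 [h3]
    exact inv_mul_cancel₀ (E_ne hζ)
  have := Nat.le_of_dvd (by norm_num) (hprim.dvd_of_pow_eq_one 2 h4)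
  have := three_le hp hodd
  omega

theorem part_d (hL : Module.finrank K L = 2) (hp : p.Prime) (hodd : Odd p)
    (h0 : Nonempty (nTorsion (W⁄K).Point p ≃+ (ZMod p × ZMod p))) :
    (pPrimary (W⁄K).Point p).map (Point.baseChange (W' := W) K L) = pPrimary (W⁄L).Point p := by
  obtain ⟨s, hs2, hst, hsf⟩ := exists_conj hL
  obtain ⟨P, Q, hP, hQ, hi⟩ := basis_of_iso h0.some
  apply le_antisymm
  · rintro _ ⟨T, ⟨i, hT⟩, rfl⟩
    refine ⟨i, ?_⟩
    change p ^ i • Point.baseChange (W' := W) K L T = 0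
    rw [← map_nsmul, hT, map_zero]
  · intro R hR
    by_contra hne
    obtain ⟨R', hR0, hR', hs⟩ := exists_anti_L hs2 hsf hR hne
    have hb : ∀ {P : (W⁄K).Point}, p • P = 0 → p • Point.baseChange (W' := W) K L P = 0 :=
      fun h => by rw [← map_nsmul, h, map_zero]
    obtain ⟨m, n, hmn⟩ := rank_L hp hodd (hi.map (base_inj (L := L))) (hb hP) (hb hQ) hR'
    have hf : act W s R' = R' := by
      rw [hmn, map_add, map_zsmul, map_zsmul, act_base, act_base]
    have hf2 := hf.symm.trans hs
    have h2 : (2 : ℤ) • R' = 0 := by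
      rw [two_smul]
      nth_rewrite 1 [hf2]
      exact neg_add_cancel _
    have := Int.le_of_dvd (by norm_num) (dvd_of_smul hp hR0 hR' h2)
    have := three_le hp hodd
    omega

end Fin
end WP

open scoped Classical in
/-- Let `K` be a number field, `E` an elliptic curve over `K`, `L` a
quadratic extension of `K`, and `p` an odd prime. Then:
(a) if `E(K)[p]` is trivial and `E(L)[p] ≃ C_p ⊕ C_p`, then `K` contains a primitive `p`-th
root of unity;
(b) if `E(K)[p] ≃ C_p` and `E(L)[p^∞]` is strictly larger than the image of `E(K)[p^∞]` under
the base-change inclusion `E(K) → E(L)`, then `E(L)[p] ≃ C_p ⊕ C_p`;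
(c) if `E(K)[p] ≃ C_p` and `E(L)[p] ≃ C_p ⊕ C_p`, then `K` does not contain a primitive `p`-th
root of unity;
(d) if `E(K)[p] ≃ C_p ⊕ C_p`, then `E(L)[p^∞]` equals the image of `E(K)[p^∞]` under the
base-change inclusion. -/
theorem stmt13 {K : Type*} [Field K] [NumberField K]
    {L : Type*} [Field L] [Algebra K L] (hL : Module.finrank K L = 2)
    (W : WeierstrassCurve K) (hW : W.Δ ≠ 0)
    (p : ℕ) (hp : p.Prime) (hodd : Odd p) :
    ((nTorsion (W⁄K).Point p = ⊥ ∧ Nonempty (nTorsion (W⁄L).Point p ≃+ (ZMod p × ZMod p))) →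
        ∃ ζ : K, IsPrimitiveRoot ζ p) ∧
    ((Nonempty (nTorsion (W⁄K).Point p ≃+ ZMod p) ∧
        (pPrimary (W⁄K).Point p).map (Point.baseChange (W' := W) K L) < pPrimary (W⁄L).Point p) →
        Nonempty (nTorsion (W⁄L).Point p ≃+ (ZMod p × ZMod p))) ∧
    ((Nonempty (nTorsion (W⁄K).Point p ≃+ ZMod p) ∧
        Nonempty (nTorsion (W⁄L).Point p ≃+ (ZMod p × ZMod p))) →
        ¬ ∃ ζ : K, IsPrimitiveRoot ζ p) ∧
    (Nonempty (nTorsion (W⁄K).Point p ≃+ (ZMod p × ZMod p)) →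
        (pPrimary (W⁄K).Point p).map (Point.baseChange (W' := W) K L) = pPrimary (W⁄L).Point p) := by
  have : Fact (W.Δ ≠ 0) := ⟨hW⟩
  exact ⟨fun h => WP.part_a hL hp hodd h.1 h.2, fun h => WP.part_b hL hp hodd h.1 h.2,
    fun h => WP.part_c hL hp hodd h.1 h.2, fun h => WP.part_d hL hp hodd h⟩
end
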